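/- For odd d = 2k−1 and 1 ≤ i ≤ k−2, every irreducible component of the algebraic boundary ∂_alg(R_{d,k+i}) is the dual variety (Δ_ρ)^∨ of a coincident root locus for some partition ρ of d with all parts ≥ 2 and length between k−1−i and k−1. -/

import Mathlib

open MvPolynomial

noncomputable section

/-- The Zariski closure of a subset of the affine space `σ → K`. -/
def zClosure {K : Type} [Field K] {σ : Type} [Fintype σ] [DecidableEq σ]
    (S : Set (σ → K)) : Set (σ → K) :=
  {x | ∀ p : MvPolynomial σ K, (∀ y ∈ S, eval y p = 0) → eval x p = 0}

/-- A subset of affine space is Zariski closed if it equals its Zariski closure. -/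
def zClosed {K : Type} [Field K] {σ : Type} [Fintype σ] [DecidableEq σ]
    (S : Set (σ → K)) : Prop :=
  zClosure S = S

/-- Irreducibility of a subset of affine space in the Zariski topology,
tested against the basic open sets. -/
def zIrreducible {K : Type} [Field K] {σ : Type} [Fintype σ] [DecidableEq σ]
    (S : Set (σ → K)) : Prop :=
  S.Nonempty ∧ ∀ p q : MvPolynomial σ K,
    (∀ x ∈ S, eval x p = 0 ∨ eval x q = 0) →
    (∀ x ∈ S, eval x p = 0) ∨ (∀ x ∈ S, eval x q = 0)

/-- There is a strictly increasing chain of `m+1` irreducible Zariski-closed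
subsets contained in `S`. -/
def zChain {K : Type} [Field K] {σ : Type} [Fintype σ] [DecidableEq σ]
    (S : Set (σ → K)) (m : ℕ) : Prop :=
  ∃ c : Fin (m+1) → Set (σ → K),
    (∀ i, zIrreducible (c i) ∧ zClosed (c i) ∧ c i ⊆ S) ∧
    ∀ i j : Fin (m+1), i < j → c i ⊂ c j

/-- `S` has (Krull) dimension `m` in the Zariski topology. -/
def zDimEq {K : Type} [Field K] {σ : Type} [Fintype σ] [DecidableEq σ]
    (S : Set (σ → K)) (m : ℕ) : Prop :=
  zChain S m ∧ ¬ zChain S (m+1)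

/-- The (embedded, affine) Zariski tangent space to `S` at `a`: the common kernel of the
differentials at `a` of all polynomials vanishing on `S`. -/
def zTangentAt {K : Type} [Field K] {σ : Type} [Fintype σ] [DecidableEq σ]
    (S : Set (σ → K)) (a : σ → K) : Set (σ → K) :=
  {v | ∀ p : MvPolynomial σ K, (∀ y ∈ S, eval y p = 0) →
        ∑ i : σ, eval a (pderiv i p) * v i = 0}

/-- Dimension of the Zariski tangent space at a point. -/
def zTangentDim {K : Type} [Field K] {σ : Type} [Fintype σ] [DecidableEq σ]
    (S : Set (σ → K)) (a : σ → K) : ℕ :=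
  Module.finrank K (Submodule.span K (zTangentAt S a))

/-- The binary form of degree `r` with coefficient vector `a`. -/
def binForm {K : Type} [CommSemiring K] (r : ℕ) (a : Fin (r+1) → K) :
    MvPolynomial (Fin 2) K :=
  ∑ i : Fin (r+1), C (a i) * X 0 ^ (r - (i : ℕ)) * X 1 ^ (i : ℕ)

/-- The linear binary form `u·x + v·y`. -/
def linForm {K : Type} [CommSemiring K] (u v : K) : MvPolynomial (Fin 2) K :=
  C u * X 0 + C v * X 1

/-- The affine cone over the coincident root locus `Δ_λ ⊆ ℙ^r`, in coefficient coordinates: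
scalar multiples of forms `∏ ℓ_i ^ λ_i`. -/
def crlCone (r n : ℕ) (lam : Fin n → ℕ) : Set (Fin (r+1) → ℂ) :=
  {a | ∃ (t : ℂ) (u v : Fin n → ℂ),
    binForm r a = C t * ∏ i, (linForm (u i) (v i)) ^ lam i}

/-- `lam` is a partition of `r` of length `n` (all parts positive). -/
def isPartitionOf (r n : ℕ) (lam : Fin n → ℕ) : Prop :=
  (∀ i, 1 ≤ lam i) ∧ ∑ i, lam i = r

/-- The multiplicity `m_j` of the part `j` in the partition `lam`. -/
def multOf {n : ℕ} (lam : Fin n → ℕ) (jj : ℕ) : ℕ :=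
  (Finset.univ.filter fun i => lam i = jj).card

/-- The differential operator of degree `s` with coefficient vector `b`, i.e.
`∑ b_i ∂x^(s-i) ∂y^i`, applied to `f`. -/
def diffOp {K : Type} [CommSemiring K] (s : ℕ) (b : Fin (s+1) → K)
    (f : MvPolynomial (Fin 2) K) : MvPolynomial (Fin 2) K :=
  ∑ i : Fin (s+1), b i •
    ((fun g => pderiv (0 : Fin 2) g)^[s - (i : ℕ)]
      (((fun g => pderiv (1 : Fin 2) g)^[(i : ℕ)]) f))

/-- The apolarity pairing between a degree-`d` operator (coefficients `h`) and a
degree-`d` form (coefficients `a`). -/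
def apolarPair (d : ℕ) (h a : Fin (d+1) → ℂ) : ℂ :=
  eval (fun _ => (0 : ℂ)) (diffOp d h (binForm d a))

/-- The cone over the dual variety of the cone `S ⊆ ℂ^(m+1)` (with `k` the dimension of the
cone `S`, used to select smooth points): closure of the set of hyperplanes, written in dual
coordinates via the apolarity pairing, containing an embedded tangent space at a smooth point. -/
def dualConeOf (m : ℕ) (S : Set (Fin (m+1) → ℂ)) (k : ℕ) : Set (Fin (m+1) → ℂ) :=
  zClosure {h | h ≠ 0 ∧ ∃ a ∈ S, a ≠ 0 ∧ zTangentDim S a = k ∧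
      ∀ v ∈ zTangentAt S a, apolarPair m h v = 0}

/-- The row span of a matrix, as a subspace of `ℂ^m`. -/
def rowSpan {k m : ℕ} (M : Matrix (Fin k) (Fin m) ℂ) : Submodule ℂ (Fin m → ℂ) :=
  Submodule.span ℂ (Set.range fun i => M i)

/-- The (redundant) Plücker coordinate vector of the row span of `M`: all maximal minors. -/
def plucker {k m : ℕ} (M : Matrix (Fin k) (Fin m) ℂ) : (Fin k → Fin m) → ℂ :=
  fun s => (M.submatrix id s).det

/-- The degree-`s` component of the apolar ideal of the degree-`d` form with
coefficients `a`, as a subset of the coefficient space of operators. -/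
def apolarSet (d s : ℕ) (a : Fin (d+1) → ℂ) : Set (Fin (s+1) → ℂ) :=
  {b | diffOp s b (binForm d a) = 0}

/-- The (pre-closure) cone, in Plücker coordinates, over the `j`-th higher associated variety
`CH_j(S)`: spans of `k`-row matrices whose row space contains a smooth point `x` of the cone
`S` (`dimS` = dimension of the cone `S`) and meets the tangent space at `x` in projective
dimension at least `j`. -/
def smoothCHCone (m : ℕ) (S : Set (Fin (m+1) → ℂ)) (dimS k j : ℕ) :
    Set ((Fin k → Fin (m+1)) → ℂ) :=
  {u | ∃ M : Matrix (Fin k) (Fin (m+1)) ℂ, u = plucker M ∧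
    Module.finrank ℂ (rowSpan M) = k ∧
    ∃ x, x ≠ 0 ∧ x ∈ S ∧ zTangentDim S x = dimS ∧ x ∈ rowSpan M ∧
      j + 1 ≤ Module.finrank ℂ ↥(rowSpan M ⊓ Submodule.span ℂ (zTangentAt S x))}

/-- The (pre-closure) cone, in Plücker coordinates, over `Ξ_0(S)`: spans of `k`-row matrices
whose row space meets the cone `S` nontrivially. -/
def meetCone (m : ℕ) (S : Set (Fin (m+1) → ℂ)) (k : ℕ) :
    Set ((Fin k → Fin (m+1)) → ℂ) :=
  {u | ∃ M : Matrix (Fin k) (Fin (m+1)) ℂ, u = plucker M ∧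
    Module.finrank ℂ (rowSpan M) = k ∧ ∃ x, x ≠ 0 ∧ x ∈ S ∧ x ∈ rowSpan M}

/-- The preimage under the apolar map `Ψ_{d,s}` of a subset `T` of the Grassmannian
(in Plücker coordinates) of `(k-1)`-projective-dimensional subspaces of `ℙ(D_s)`. -/
def apolarPull (d s k : ℕ) (T : Set ((Fin k → Fin (s+1)) → ℂ)) : Set (Fin (d+1) → ℂ) :=
  {a | ∃ M : Matrix (Fin k) (Fin (s+1)) ℂ,
    rowSpan M = Submodule.span ℂ (apolarSet d s a) ∧
    Module.finrank ℂ (rowSpan M) = k ∧ plucker M ∈ T}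

/-- The Waring rank over `K` of a binary form: the least `r` such that `f` is a sum of `r`
scalar multiples of `d`-th powers of linear forms. -/
def waringRank {K : Type} [Field K] (d : ℕ) (f : MvPolynomial (Fin 2) K) : ℕ :=
  sInf {r | ∃ (α u v : Fin r → K), f = ∑ i, α i • (linForm (u i) (v i)) ^ d}

/-- The set of coefficient vectors of real binary forms of degree `d` of real rank `r`. -/
def realRankSet (d r : ℕ) : Set (Fin (d+1) → ℝ) :=
  {a | waringRank d (binForm d a) = r}

/-- `R_{d,r}`: the interior, in the Euclidean topology, of the set of real binary forms of
degree `d` and real rank `r`. -/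
def Rdr (d r : ℕ) : Set (Fin (d+1) → ℝ) := interior (realRankSet d r)

/-- The topological boundary of `R_{d,r}`: the closure of `R_{d,r}` minus the interior of
the closure. -/
def topBoundary (d r : ℕ) : Set (Fin (d+1) → ℝ) :=
  closure (Rdr d r) \ interior (closure (Rdr d r))

/-- The algebraic boundary `∂_alg(R_{d,r})`: the Zariski closure over `ℂ` of the topological
boundary of `R_{d,r}`. -/
def algBoundary (d r : ℕ) : Set (Fin (d+1) → ℂ) :=
  zClosure ((fun a i => ((a i : ℝ) : ℂ)) '' topBoundary d r)



/-! ### Zariski generalities -/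

section Zariski
variable {σ : Type} [Fintype σ] [DecidableEq σ]

lemma subset_zClosure' (S : Set (σ → ℂ)) : S ⊆ zClosure S := fun _ hx _ hp => hp _ hx

lemma zClosed_zClosure' (S : Set (σ → ℂ)) : zClosed (zClosure S) := by
  apply Set.Subset.antisymm _ (subset_zClosure' _)
  intro x hx p hp
  exact hx p fun y hy => hy p hp

lemma zClosure_min' {S T : Set (σ → ℂ)} (h : S ⊆ T) (hT : zClosed T) : zClosure S ⊆ T := by
  rw [← hT]
  intro x hx p hp
  exact hx p fun y hy => hp y (h hy)

lemma zIrreducible_zClosure' {S : Set (σ → ℂ)} (h : zIrreducible S) :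
    zIrreducible (zClosure S) := by
  refine ⟨h.1.mono (subset_zClosure' S), fun p q hpq => ?_⟩
  rcases h.2 p q (fun x hx => hpq x (subset_zClosure' S hx)) with h1 | h1
  · exact Or.inl fun x hx => hx p h1
  · exact Or.inr fun x hx => hx q h1

/-- a point outside a finite union of closed sets is separated by a polynomial -/
lemma exists_sep {ι : Type*} (s : Finset ι) (D : ι → Set (σ → ℂ)) (hD : ∀ i ∈ s, zClosed (D i))
    (x : σ → ℂ) (hx : ∀ i ∈ s, x ∉ D i) :
    ∃ p : MvPolynomial σ ℂ, (∀ i ∈ s, ∀ y ∈ D i, eval y p = 0) ∧ eval x p ≠ 0 := by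
  classical
  have : ∀ i, ∃ p : MvPolynomial σ ℂ, i ∈ s → (∀ y ∈ D i, eval y p = 0) ∧ eval x p ≠ 0 := by
    intro i
    by_cases hi : i ∈ s
    · have h := hx i hi
      rw [← hD i hi] at h
      simp only [zClosure, Set.mem_setOf_eq, not_forall] at h
      obtain ⟨p, hp, hpx⟩ := h
      exact ⟨p, fun _ => ⟨hp, hpx⟩⟩
    · exact ⟨0, fun h => absurd h hi⟩
  choose p hp using this
  refine ⟨∏ i ∈ s, p i, fun i hi y hy => ?_, ?_⟩
  · rw [map_prod]; exact Finset.prod_eq_zero hi ((hp i hi).1 y hy)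
  · rw [map_prod]; exact Finset.prod_ne_zero_iff.2 fun i hi => (hp i hi).2

lemma zIrreducible_subset_of_union {ι : Type*} (s : Finset ι) (D : ι → Set (σ → ℂ))
    (hD : ∀ i ∈ s, zClosed (D i)) (Y : Set (σ → ℂ)) (hY : zIrreducible Y)
    (hYD : Y ⊆ ⋃ i ∈ s, D i) : ∃ i ∈ s, Y ⊆ D i := by
  classical
  by_contra hcon
  push Not at hcon
  have : ∀ i, ∃ p : MvPolynomial σ ℂ, i ∈ s → (∀ y ∈ D i, eval y p = 0) ∧ ∃ x ∈ Y, eval x p ≠ 0 := by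
    intro i
    by_cases hi : i ∈ s
    · obtain ⟨x, hxY, hx⟩ := Set.not_subset.1 (hcon i hi)
      rw [← hD i hi] at hx
      simp only [zClosure, Set.mem_setOf_eq, not_forall] at hx
      obtain ⟨p, hp, hpx⟩ := hx
      exact ⟨p, fun _ => ⟨hp, x, hxY, hpx⟩⟩
    · exact ⟨0, fun h => absurd h hi⟩
  choose p hp using this
  have key : ∀ t : Finset ι, t ⊆ s → ∃ x ∈ Y, eval x (∏ i ∈ t, p i) ≠ 0 := by
    intro t
    induction t using Finset.induction_on with
    | empty => intro _; obtain ⟨x, hx⟩ := hY.1; exact ⟨x, hx, by simp⟩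
    | insert a t ha ih =>
      intro hts
      by_contra hc
      push Not at hc
      rcases hY.2 (p a) (∏ i ∈ t, p i) (fun x hx => by
        have := hc x hx
        rw [Finset.prod_insert ha, map_mul] at this
        exact mul_eq_zero.1 this) with h | h
      · obtain ⟨x, hx, hx'⟩ := (hp a (hts (Finset.mem_insert_self a t))).2
        exact hx' (h x hx)
      · obtain ⟨x, hx, hx'⟩ := ih (fun i hi => hts (Finset.mem_insert_of_mem hi))
        exact hx' (h x hx)
  obtain ⟨x, hx, hx'⟩ := key s subset_rfl
  have hxD := hYD hx
  simp only [Set.mem_iUnion] at hxD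
  obtain ⟨i, hi, hxi⟩ := hxD
  apply hx'
  rw [map_prod]
  exact Finset.prod_eq_zero hi ((hp i hi).1 x hxi)

/-- A set whose projection along each coordinate axis lies in a proper hypersurface. -/
def Thin (T : Set (σ → ℂ)) : Prop :=
  ∀ j : σ, ∃ c : MvPolynomial σ ℂ, c ≠ 0 ∧ j ∉ c.vars ∧ ∀ x ∈ T, eval x c = 0

lemma Thin.mono {S T : Set (σ → ℂ)} (h : Thin T) (hST : S ⊆ T) : Thin S := fun j => by
  obtain ⟨c, h0, h1, h2⟩ := h j
  exact ⟨c, h0, h1, fun x hx => h2 x (hST hx)⟩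

lemma Thin.biUnion {ι : Type*} (s : Finset ι) (T : ι → Set (σ → ℂ)) (h : ∀ i ∈ s, Thin (T i)) :
    Thin (⋃ i ∈ s, T i) := by
  classical
  intro j
  have : ∀ i, ∃ c : MvPolynomial σ ℂ, i ∈ s → c ≠ 0 ∧ j ∉ c.vars ∧ ∀ x ∈ T i, eval x c = 0 := by
    intro i
    by_cases hi : i ∈ s
    · obtain ⟨c, hc⟩ := h i hi j; exact ⟨c, fun _ => hc⟩
    · exact ⟨0, fun h => absurd h hi⟩
  choose c hc using this
  refine ⟨∏ i ∈ s, c i, Finset.prod_ne_zero_iff.2 fun i hi => (hc i hi).1, ?_, ?_⟩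
  · intro hj
    have := vars_prod (s := s) c hj
    rw [Finset.mem_biUnion] at this
    obtain ⟨i, hi, hji⟩ := this
    exact (hc i hi).2.1 hji
  · intro x hx
    simp only [Set.mem_iUnion] at hx
    obtain ⟨i, hi, hxi⟩ := hx
    rw [map_prod]
    exact Finset.prod_eq_zero hi ((hc i hi).2.2 x hxi)

lemma Thin.union {S T : Set (σ → ℂ)} (hS : Thin S) (hT : Thin T) : Thin (S ∪ T) := by
  intro j
  obtain ⟨c, h0, h1, h2⟩ := hS j
  obtain ⟨c', h0', h1', h2'⟩ := hT j
  refine ⟨c * c', mul_ne_zero h0 h0', ?_, ?_⟩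
  · intro hj
    have := vars_mul c c' hj
    rw [Finset.mem_union] at this
    tauto
  · rintro x (hx | hx)
    · simp [h2 x hx]
    · simp [h2' x hx]

/-- elimination for univariate polynomials over a domain -/
lemma elim_aux {R : Type*} [CommRing R] [IsDomain R] (f g : Polynomial R) (hf : Prime f)
    (hfg : ¬ f ∣ g) : ∃ r : R, r ≠ 0 ∧ ∃ a b, Polynomial.C r = f * a + g * b := by
  haveI : Fact (Prime f) := ⟨hf⟩
  haveI : IsDomain (AdjoinRoot f) :=
    Ideal.Quotient.isDomain_iff_prime _ |>.2 ((Ideal.span_singleton_prime hf.ne_zero).2 hf)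
  have halg : IsAlgebraic R (AdjoinRoot.mk f g) := by
    have h0 : IsAlgebraic R (AdjoinRoot.root f) := AdjoinRoot.isAlgebraic_root hf.ne_zero
    rw [← AdjoinRoot.aeval_eq]
    rw [Polynomial.aeval_eq_sum_range]
    refine Finset.sum_induction _ (IsAlgebraic R) (fun a b => IsAlgebraic.add)
      (isAlgebraic_zero) ?_
    intro i _
    exact (h0.pow i).smul _
  have hne : AdjoinRoot.mk f g ≠ 0 := by
    rw [Ne, AdjoinRoot.mk_eq_zero]; exact hfg
  obtain ⟨r, hr, q, hq⟩ := halg.exists_nonzero_dvd (mem_nonZeroDivisors_of_ne_zero hne)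
  obtain ⟨b, rfl⟩ := AdjoinRoot.mk_surjective q
  refine ⟨r, hr, ?_⟩
  have : AdjoinRoot.mk f (Polynomial.C r - g * b) = 0 := by
    rw [map_sub, map_mul, ← hq]
    simp [AdjoinRoot.algebraMap_eq]
  rw [AdjoinRoot.mk_eq_zero] at this
  obtain ⟨a, ha⟩ := this
  exact ⟨a, b, by rw [← ha]; ring⟩

lemma thin_inter (F G : MvPolynomial σ ℂ) (hF : Prime F) (hFG : ¬ F ∣ G) :
    Thin {x | eval x F = 0 ∧ eval x G = 0} := by
  intro j
  let e0 := renameEquiv ℂ (Equiv.optionSubtypeNe j)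
  let e1 := optionEquivLeft ℂ {a // a ≠ j}
  let e := e0.symm.trans e1
  obtain ⟨r, hr, a, b, hab⟩ := elim_aux (e F) (e G)
    ((MulEquiv.prime_iff e.toMulEquiv).2 hF) (by
      intro h; exact hFG ((map_dvd_iff e).1 h))
  have hC : e.symm (Polynomial.C r) = rename (fun x : {a // a ≠ j} => (x : σ)) r := by
    show e0 (e1.symm (Polynomial.C r)) = _
    rw [show e1.symm (Polynomial.C r) = rename some r from by
      show Polynomial.aevalTower (MvPolynomial.rename some) (X none) (Polynomial.C r) = _
      simp]
    show rename _ (rename some r) = _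
    rw [rename_rename]
    congr 1
    
  refine ⟨e.symm (Polynomial.C r), ?_, ?_, ?_⟩
  · simpa using hr
  · rw [hC]
    intro hj
    have := vars_rename (fun x : {a // a ≠ j} => (x : σ)) r hj
    rw [Finset.mem_image] at this
    obtain ⟨⟨y, hy⟩, _, h⟩ := this
    exact hy h
  · rintro x ⟨h1, h2⟩
    have : e.symm (Polynomial.C r) = F * e.symm a + G * e.symm b := by
      rw [hab]; simp
    rw [this]; simp [h1, h2]

/-- fewer parameters than coordinates: algebraic dependence -/
lemma exists_dep {τ : Type} [Fintype τ] (A : Finset σ) (φ : σ → MvPolynomial τ ℂ)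
    (h : Fintype.card τ < A.card) :
    ∃ c : MvPolynomial σ ℂ, c ≠ 0 ∧ c.vars ⊆ A ∧ aeval φ c = 0 := by
  by_cases hind : AlgebraicIndependent ℂ (fun a : A => φ a)
  · have := hind.cardinalMk_le_trdeg
    rw [MvPolynomial.trdeg_of_isDomain] at this
    simp at this
    omega
  · rw [algebraicIndependent_iff] at hind
    push Not at hind
    obtain ⟨p, hp, hp0⟩ := hind
    refine ⟨rename (fun a : A => (a : σ)) p, ?_, ?_, ?_⟩
    · intro h
      exact hp0 (rename_injective _ Subtype.val_injective (by rw [h, map_zero]))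
    · intro x hx
      have := vars_rename (fun a : A => (a : σ)) p hx
      rw [Finset.mem_image] at this
      obtain ⟨y, _, rfl⟩ := this
      exact y.2
    · rw [aeval_rename]; exact hp

lemma pderiv_ne_zero_of_mem_vars (p : MvPolynomial σ ℂ) (i : σ) (hi : i ∈ p.vars) :
    pderiv i p ≠ 0 := by
  rw [mem_vars] at hi
  obtain ⟨m, hm, hmi⟩ := hi
  intro h
  have hmi' : m i ≠ 0 := by simpa using hmi
  have h1 : coeff (m - Finsupp.single i 1) (pderiv i p) = 0 := by rw [h]; simp
  rw [coeff_pderiv] at h1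
  have h2 : m - Finsupp.single i 1 + Finsupp.single i 1 = m := by
    ext k
    by_cases hk : k = i
    · subst hk; simp; omega
    · simp [Finsupp.single_apply, Ne.symm hk]
  rw [h2] at h1
  have h3 : coeff m p ≠ 0 := by simpa using hm
  rcases mul_eq_zero.1 h1 with h4 | h4
  · exact h3 h4
  · norm_cast at h4


lemma totalDegree_pderiv_lt (p : MvPolynomial σ ℂ) (i : σ) (h : pderiv i p ≠ 0) :
    (pderiv i p).totalDegree < p.totalDegree := by
  obtain ⟨m, hm, hmd⟩ : ∃ m ∈ (pderiv i p).support, (pderiv i p).totalDegree = m.sum fun _ e => e := by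
    have hne : (pderiv i p).support.Nonempty := support_nonempty.2 h
    obtain ⟨m, hm, h2⟩ := Finset.exists_mem_eq_sup _ hne (fun s : σ →₀ ℕ => s.sum fun _ e => e)
    exact ⟨m, hm, h2⟩
  rw [hmd]
  rw [mem_support_iff, coeff_pderiv] at hm
  have h1 : m + Finsupp.single i 1 ∈ p.support := by
    rw [mem_support_iff]; exact left_ne_zero_of_mul hm
  have h2 := le_totalDegree h1
  rw [Finsupp.sum_add_index' (by simp) (by simp)] at h2
  simp at h2
  simpa using h2

/-- generic bound for the tangent space dimension of a parametrised variety -/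
lemma generic_tangent {τ : Type} [Fintype τ] (φ : σ → MvPolynomial τ ℂ) :
    ∃ D : MvPolynomial σ ℂ, aeval φ D ≠ 0 ∧ ∀ a : σ → ℂ, eval a D ≠ 0 →
      ∃ B : Finset σ, B.card ≤ Fintype.card τ ∧ ∀ v : σ → ℂ,
        (∀ p : MvPolynomial σ ℂ, aeval φ p = 0 → ∑ i, eval a (pderiv i p) * v i = 0) →
        (∀ b ∈ B, v b = 0) → v = 0 := by
  classical
  -- a maximal independent subset
  let good : Finset σ → Prop := fun B => ∀ c : MvPolynomial σ ℂ, c.vars ⊆ B → aeval φ c = 0 → c = 0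
  obtain ⟨B, hB, hmax⟩ : ∃ B, good B ∧ ∀ i, i ∉ B → ¬ good (insert i B) := by
    have hfin : ({B | good B} : Set (Finset σ)).Finite := Set.toFinite _
    have hne : ({B | good B} : Set (Finset σ)).Nonempty := by
      refine ⟨∅, fun c hc h => ?_⟩
      have : c.vars = ∅ := Finset.subset_empty.1 hc
      rw [vars_eq_empty_iff_eq_C] at this
      rw [this] at h ⊢
      simpa [algebraMap_eq] using h
    obtain ⟨B, hB⟩ := hfin.exists_maximal hne
    refine ⟨B, hB.1, fun i hi h => ?_⟩
    have := hB.2 h (Finset.subset_insert i B)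
    exact hi (this (Finset.mem_insert_self i B))
  have hcard : B.card ≤ Fintype.card τ := by
    by_contra hlt
    obtain ⟨c, h0, h1, h2⟩ := exists_dep B φ (not_le.1 hlt)
    exact h0 (hB c h1 h2)
  have hP : ∀ i, ∃ p : MvPolynomial σ ℂ, i ∉ B → p.vars ⊆ insert i B ∧ aeval φ p = 0 ∧
      aeval φ (pderiv i p) ≠ 0 := by
    intro i
    by_cases hi : i ∈ B
    · exact ⟨0, fun h => absurd hi h⟩
    have h1 := hmax i hi
    have h2 : ∃ n : ℕ, ∃ c : MvPolynomial σ ℂ, c.totalDegree = n ∧ c.vars ⊆ insert i B ∧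
        aeval φ c = 0 ∧ c ≠ 0 := by
      simp only [good] at h1
      push Not at h1
      obtain ⟨c, h1, h2, h3⟩ := h1
      exact ⟨_, c, rfl, h1, h2, h3⟩
    obtain ⟨p, hpd, hpv, hp0, hpne⟩ := Nat.find_spec h2
    have hmin := fun m => Nat.find_min h2 (m := m)
    refine ⟨p, fun _ => ⟨hpv, hp0, fun hd => ?_⟩⟩
    have hivar : i ∈ p.vars := by
      by_contra hiv
      refine hpne (hB p (fun x hx => ?_) hp0)
      rcases Finset.mem_insert.1 (hpv hx) with h | h
      · exact absurd (h ▸ hx) hiv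
      · exact h
    have hne := pderiv_ne_zero_of_mem_vars p i hivar
    refine hmin _ ?_ ⟨pderiv i p, rfl, ?_, hd, hne⟩
    · rw [← hpd]; exact totalDegree_pderiv_lt p i hne
    · intro x hx
      apply hpv
      rw [mem_vars] at hx ⊢
      obtain ⟨m, hm, hmx⟩ := hx
      rw [mem_support_iff, coeff_pderiv] at hm
      refine ⟨m + Finsupp.single i 1, mem_support_iff.2 (left_ne_zero_of_mul hm), ?_⟩
      simp only [Finsupp.mem_support_iff, Finsupp.add_apply] at hmx ⊢
      omega
  choose P hPP using hP
  refine ⟨∏ i ∈ Bᶜ, pderiv i (P i), ?_, ?_⟩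
  · rw [map_prod]
    exact Finset.prod_ne_zero_iff.2 fun i hi => (hPP i (Finset.mem_compl.1 hi)).2.2
  · intro a ha
    refine ⟨B, hcard, fun v hv hvB => ?_⟩
    rw [map_prod] at ha
    have ha' := Finset.prod_ne_zero_iff.1 ha
    funext i
    by_cases hi : i ∈ B
    · exact hvB i hi
    obtain ⟨h1, h2, h3⟩ := hPP i hi
    have h4 := hv (P i) h2
    rw [Finset.sum_eq_single i] at h4
    · exact (mul_eq_zero.1 h4).resolve_left (ha' i (Finset.mem_compl.2 hi))
    · intro b _ hbi
      by_cases hbB : b ∈ B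
      · rw [hvB b hbB, mul_zero]
      · have : b ∉ (P i).vars := fun h => by
          rcases Finset.mem_insert.1 (h1 h) with h | h
          · exact hbi h
          · exact hbB h
        rw [pderiv_eq_zero_of_notMem_vars this]; simp
    · simp

/-- a non-zero complex polynomial does not vanish on a real open set -/
lemma exists_real_ne_zero (c : MvPolynomial σ ℂ) (hc : c ≠ 0) (a : σ → ℝ) (δ : ℝ) (hδ : 0 < δ) :
    ∃ b ∈ Metric.ball a δ, eval (fun i => ((b i : ℝ) : ℂ)) c ≠ 0 := by
  by_contra h
  push Not at h
  apply hc
  refine funext_set (fun i => (fun r : ℝ => (r : ℂ)) '' Metric.ball (a i) δ) (fun i => ?_) ?_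
  · apply Set.Infinite.image (Complex.ofReal_injective.injOn)
    rw [Real.ball_eq_Ioo]
    exact Set.Ioo_infinite (by linarith)
  · intro x hx
    have : ∀ i, ∃ r : ℝ, r ∈ Metric.ball (a i) δ ∧ (r : ℂ) = x i := fun i => hx i trivial
    choose r hr hrx using this
    have := h r (by rw [ball_pi _ hδ]; exact fun i _ => hr i)
    rw [map_zero, ← this]
    congr
    funext i
    exact (hrx i).symm

end Zariski


/-! ### Families of kernels of matrices with polynomial entries -/

section KerFam
variable {R ν : Type} [Fintype R] [DecidableEq R] [Fintype ν] [DecidableEq ν]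

lemma exists_minor (A : Matrix R ν ℂ) (hA : LinearIndependent ℂ (fun a => A a)) :
    ∃ J : R → ν, (A.submatrix id J).det ≠ 0 := by
  obtain ⟨κ, a, ha, hsp, hli⟩ := exists_linearIndependent' ℂ (A.col)
  have hrank : A.rank = Fintype.card R := by
    have := LinearIndependent.rank_matrix (M := A) hA
    exact this
  have htop : Submodule.span ℂ (Set.range A.col) = ⊤ := by
    apply Submodule.eq_top_of_finrank_eq
    rw [← Matrix.rank_eq_finrank_span_cols, hrank]; simp
  haveI : Finite κ := Finite.of_injective a ha
  haveI : Fintype κ := Fintype.ofFinite κ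
  have hcard : Fintype.card κ = Fintype.card R := by
    have h1 := finrank_span_eq_card hli
    rw [hsp, htop] at h1
    rw [← h1]; simp
  let e : R ≃ κ := (Fintype.equivOfCardEq hcard).symm
  refine ⟨a ∘ e, ?_⟩
  have h2 : LinearIndependent ℂ ((A.col ∘ a) ∘ e) := hli.comp e e.injective
  have h3 : IsUnit (A.submatrix id (a ∘ e)) := by
    rw [← Matrix.linearIndependent_cols_iff_isUnit]
    exact h2
  rw [Matrix.isUnit_iff_isUnit_det] at h3
  exact h3.ne_zero

/-- polynomial projection onto the kernel of a matrix -/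
def kp {K : Type*} [CommRing K] (M : Matrix R ν K) (J : R → ν) (y : ν → K) : ν → K :=
  fun l => (M.submatrix id J).det * y l -
    ∑ a, if J a = l then ((M.submatrix id J).adjugate.mulVec (M.mulVec y)) a else 0

lemma map_kp {K L : Type*} [CommRing K] [CommRing L] (f : K →+* L) (M : Matrix R ν K) (J : R → ν)
    (y : ν → K) (l : ν) : f (kp M J y l) = kp (M.map f) J (fun i => f (y i)) l := by
  unfold kp
  rw [map_sub, map_mul, map_sum, RingHom.map_det]
  congr 1
  apply Finset.sum_congr rfl
  intro a _
  split_ifs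
  · rw [RingHom.map_mulVec]
    have h2 : (M.submatrix id J).adjugate.map f = ((M.map f).submatrix id J).adjugate := by
      have := RingHom.map_adjugate f (M.submatrix id J)
      exact this
    rw [h2]
    have : (f ∘ M.mulVec y) = (M.map f).mulVec (fun i => f (y i)) := by
      funext b
      exact RingHom.map_mulVec f M y b
    rw [this]
  · simp

lemma mulVec_spread {K : Type*} [CommRing K] (M : Matrix R ν K) (J : R → ν) (z : R → K) :
    M.mulVec (fun l => ∑ a, if J a = l then z a else 0) = (M.submatrix id J).mulVec z := by
  funext b
  simp only [Matrix.mulVec, dotProduct, Matrix.submatrix_apply, id]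
  simp_rw [Finset.mul_sum]
  rw [Finset.sum_comm]
  apply Finset.sum_congr rfl
  intro a _
  simp

lemma mulVec_kp {K : Type*} [CommRing K] (M : Matrix R ν K) (J : R → ν) (y : ν → K) :
    M.mulVec (kp M J y) = 0 := by
  have : kp M J y = (M.submatrix id J).det • y - (fun l => ∑ a, if J a = l then
      ((M.submatrix id J).adjugate.mulVec (M.mulVec y)) a else 0) := by
    funext l; simp [kp]
  rw [this, Matrix.mulVec_sub, mulVec_spread, Matrix.mulVec_mulVec, Matrix.mul_adjugate,
    Matrix.mulVec_smul, Matrix.smul_mulVec, Matrix.one_mulVec, sub_self]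

lemma kp_of_ker (M : Matrix R ν ℂ) (J : R → ν) (f : ν → ℂ)
    (hJ : (M.submatrix id J).det ≠ 0) (hf : M.mulVec f = 0) :
    kp M J (fun l => f l / (M.submatrix id J).det) = f := by
  have h1 : (fun l => f l / (M.submatrix id J).det) = (M.submatrix id J).det⁻¹ • f := by
    funext l; simp [div_eq_inv_mul]
  rw [h1]
  funext l
  unfold kp
  rw [Matrix.mulVec_smul, hf]
  simp
  field_simp

lemma kp_off (M : Matrix R ν ℂ) (J : R → ν) (f : ν → ℂ)
    (hJ : (M.submatrix id J).det ≠ 0) (hf : M.mulVec f = 0) :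
    kp M J (fun l => if ∃ a, J a = l then 0 else f l / (M.submatrix id J).det) = f := by
  have hinj : Function.Injective J := by
    intro a b hab
    by_contra hne
    exact hJ (Matrix.det_zero_of_column_eq hne (fun i => by simp [hab]))
  set D := (M.submatrix id J).det with hD
  have hy : (fun l => if ∃ a, J a = l then 0 else f l / D) =
      D⁻¹ • f - (fun l => ∑ a, if J a = l then (D⁻¹ • f) (J a) else 0) := by
    funext l
    simp only [Pi.sub_apply, Pi.smul_apply, smul_eq_mul]
    split_ifs with h
    · obtain ⟨a, rfl⟩ := h
      rw [Finset.sum_eq_single a]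
      · simp
      · intro b _ hb; rw [if_neg (fun h => hb (hinj h))]
      · simp
    · rw [Finset.sum_eq_zero]
      · field_simp; simp
      · intro a _; rw [if_neg (fun h' => h ⟨a, h'⟩)]
  rw [hy]
  funext l
  unfold kp
  rw [Matrix.mulVec_sub, Matrix.mulVec_smul, hf, mulVec_spread, smul_zero, zero_sub,
    Matrix.mulVec_neg, Matrix.mulVec_mulVec, Matrix.adjugate_mul, Matrix.smul_mulVec,
    Matrix.one_mulVec, ← hD]
  simp only [Pi.sub_apply, Pi.smul_apply, smul_eq_mul, Pi.neg_apply]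
  have : (∑ a, if J a = l then -(D * (D⁻¹ * f (J a))) else 0) =
      - (D * ∑ a, if J a = l then (D⁻¹ * f (J a)) else 0) := by
    rw [Finset.mul_sum, ← Finset.sum_neg_distrib]
    apply Finset.sum_congr rfl
    intro a _
    split_ifs <;> simp
  rw [this]
  field_simp
  ring

variable {σ : Type} [Fintype σ] [DecidableEq σ]

/-- evaluation of the matrix -/
def evM (M : Matrix R ν (MvPolynomial σ ℂ)) (x : σ → ℂ) : Matrix R ν ℂ := M.map (eval x)

/-- the union of kernels over points where the matrix has full row rank and `P` holds -/
def kerFam (M : Matrix R ν (MvPolynomial σ ℂ)) (P : (σ → ℂ) → Prop) : Set (ν → ℂ) :=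
  {f | ∃ x, LinearIndependent ℂ (fun a => evM M x a) ∧ P x ∧ (evM M x).mulVec f = 0}

/-- generic kernel parametrisation -/
def gkp (M : Matrix R ν (MvPolynomial σ ℂ)) (J : R → ν) : ν → MvPolynomial (σ ⊕ ν) ℂ :=
  kp (M.map (rename Sum.inl : MvPolynomial σ ℂ →ₐ[ℂ] MvPolynomial (σ ⊕ ν) ℂ).toRingHom) J
    (fun l => X (Sum.inr l))

lemma eval_gkp (M : Matrix R ν (MvPolynomial σ ℂ)) (J : R → ν) (x : σ → ℂ) (y : ν → ℂ) (l : ν) :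
    eval (Sum.elim x y) (gkp M J l) = kp (evM M x) J y l := by
  unfold gkp
  rw [map_kp, Matrix.map_map]
  congr 1
  · ext a b
    simp [evM, eval_rename, Function.comp_def]
  · simp

lemma eval_aeval {τ : Type} (z : τ → ℂ) (φ : ν → MvPolynomial τ ℂ) (p : MvPolynomial ν ℂ) :
    eval z (aeval φ p) = eval (fun l => eval z (φ l)) p := by
  induction p using MvPolynomial.induction_on with
  | C a => simp [algebraMap_eq]
  | add p q hp hq => rw [map_add, map_add, map_add, hp, hq]
  | mul_X p i hp => rw [map_mul, map_mul, map_mul, hp, aeval_X, eval_X]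

lemma eval_aeval_gkp (M : Matrix R ν (MvPolynomial σ ℂ)) (J : R → ν) (x : σ → ℂ) (y : ν → ℂ)
    (p : MvPolynomial ν ℂ) :
    eval (Sum.elim x y) (aeval (gkp M J) p) = eval (kp (evM M x) J y) p := by
  rw [eval_aeval]
  simp only [eval_gkp]

/-- the minor polynomial -/
def minorP (M : Matrix R ν (MvPolynomial σ ℂ)) (J : R → ν) : MvPolynomial σ ℂ :=
  (M.submatrix id J).det

lemma eval_minorP (M : Matrix R ν (MvPolynomial σ ℂ)) (J : R → ν) (x : σ → ℂ) :
    eval x (minorP M J) = ((evM M x).submatrix id J).det := by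
  unfold minorP evM
  rw [RingHom.map_det]; rfl

lemma li_of_minor (A : Matrix R ν ℂ) (J : R → ν) (h : (A.submatrix id J).det ≠ 0) :
    LinearIndependent ℂ (fun a => A a) := by
  have h1 : LinearIndependent ℂ (fun a => (A.submatrix id J) a) := by
    have : IsUnit (A.submatrix id J) := by
      rw [Matrix.isUnit_iff_isUnit_det]; exact isUnit_iff_ne_zero.2 h
    exact Matrix.linearIndependent_rows_iff_isUnit.2 this
  have h2 : (fun a => (A.submatrix id J) a) = (LinearMap.funLeft ℂ ℂ J) ∘ (fun a => A a) := rfl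
  rw [h2] at h1
  exact h1.of_comp _

lemma mv_eq_zero {τ : Type} (p : MvPolynomial τ ℂ) (h : ∀ z, eval z p = 0) : p = 0 := by
  apply MvPolynomial.funext; intro z; rw [h, map_zero]

lemma kerFam_dense (M : Matrix R ν (MvPolynomial σ ℂ)) (Q : MvPolynomial σ ℂ) (hQ : Q ≠ 0)
    (p : MvPolynomial ν ℂ)
    (hp : ∀ f ∈ kerFam M (fun x => eval x Q ≠ 0), eval f p = 0) :
    ∀ f ∈ kerFam M (fun _ => True), eval f p = 0 := by
  rintro f ⟨x, hx, -, hf⟩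
  obtain ⟨J, hJ⟩ := exists_minor _ hx
  have hm : minorP M J ≠ 0 := by
    intro h; apply hJ; rw [← eval_minorP, h, map_zero]
  have hinl : Function.Injective (rename (R := ℂ) (Sum.inl : σ → σ ⊕ ν)) :=
    rename_injective _ Sum.inl_injective
  have h0 : aeval (gkp M J) p * rename Sum.inl Q * rename Sum.inl (minorP M J) = 0 := by
    apply mv_eq_zero
    intro z
    obtain ⟨x', y', rfl⟩ : ∃ x' y', z = Sum.elim x' y' :=
      ⟨fun i => z (Sum.inl i), fun i => z (Sum.inr i), by
        funext i; cases i <;> rfl⟩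
    rw [map_mul, map_mul, eval_aeval_gkp, eval_rename, eval_rename, Sum.elim_comp_inl, eval_minorP]
    by_cases hq : eval x' Q = 0
    · simp [hq]
    by_cases hd : ((evM M x').submatrix id J).det = 0
    · simp [hd]
    rw [hp _ ⟨x', li_of_minor _ J hd, hq, mulVec_kp _ _ _⟩]
    simp
  have h1 : aeval (gkp M J) p = 0 := by
    rcases mul_eq_zero.1 h0 with h | h
    · rcases mul_eq_zero.1 h with h | h
      · exact h
      · exact absurd (hinl (by rw [h, map_zero])) hQ
    · exact absurd (hinl (by rw [h, map_zero])) hm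
  have h2 := eval_aeval_gkp M J x (fun l => f l / ((evM M x).submatrix id J).det) p
  rw [h1, kp_of_ker _ _ _ hJ hf, map_zero] at h2
  exact h2.symm

lemma kerFam_irreducible (M : Matrix R ν (MvPolynomial σ ℂ))
    (hM : ∃ x, LinearIndependent ℂ (fun a => evM M x a)) :
    zIrreducible (kerFam M (fun _ => True)) := by
  obtain ⟨x0, hx0⟩ := hM
  refine ⟨⟨0, x0, hx0, trivial, Matrix.mulVec_zero _⟩, ?_⟩
  intro p q hpq
  obtain ⟨J, hJ⟩ := exists_minor _ hx0
  have hm : minorP M J ≠ 0 := by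
    intro h; apply hJ; rw [← eval_minorP, h, map_zero]
  have hinl : Function.Injective (rename (R := ℂ) (Sum.inl : σ → σ ⊕ ν)) :=
    rename_injective _ Sum.inl_injective
  have h0 : aeval (gkp M J) p * aeval (gkp M J) q * rename Sum.inl (minorP M J) = 0 := by
    apply mv_eq_zero
    intro z
    obtain ⟨x', y', rfl⟩ : ∃ x' y', z = Sum.elim x' y' :=
      ⟨fun i => z (Sum.inl i), fun i => z (Sum.inr i), by
        funext i; cases i <;> rfl⟩
    rw [map_mul, map_mul, eval_aeval_gkp, eval_aeval_gkp, eval_rename, Sum.elim_comp_inl,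
      eval_minorP]
    by_cases hd : ((evM M x').submatrix id J).det = 0
    · simp [hd]
    rcases hpq _ ⟨x', li_of_minor _ J hd, trivial, mulVec_kp _ J y'⟩ with h | h <;> simp [h]
  have key : ∀ p : MvPolynomial ν ℂ, aeval (gkp M J) p = 0 →
      ∀ f ∈ kerFam M (fun _ => True), eval f p = 0 := by
    intro p h1
    apply kerFam_dense M (minorP M J) hm
    rintro f ⟨x, hx, hd, hf⟩
    rw [eval_minorP] at hd
    have h2 := eval_aeval_gkp M J x (fun l => f l / ((evM M x).submatrix id J).det) p
    rw [h1, kp_of_ker _ _ _ hd hf, map_zero] at h2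
    exact h2.symm
  rcases mul_eq_zero.1 h0 with h | h
  · rcases mul_eq_zero.1 h with h | h
    · exact Or.inl (key p h)
    · exact Or.inr (key q h)
  · exact absurd (hinl (by rw [h, map_zero])) hm

lemma kerFam_small (M : Matrix R ν (MvPolynomial σ ℂ)) (A : Finset ν)
    (hcard : Fintype.card σ + Fintype.card ν < A.card + Fintype.card R) :
    ∃ c : MvPolynomial ν ℂ, c ≠ 0 ∧ c.vars ⊆ A ∧
      ∀ f ∈ kerFam M (fun _ => True), eval f c = 0 := by
  classical
  have : ∀ J : R → ν, ∃ c : MvPolynomial ν ℂ, c ≠ 0 ∧ c.vars ⊆ A ∧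
      ∀ x f, ((evM M x).submatrix id J).det ≠ 0 → (evM M x).mulVec f = 0 → eval f c = 0 := by
    intro J
    by_cases hinj : Function.Injective J
    swap
    · refine ⟨1, one_ne_zero, by simp, fun x f hd => ?_⟩
      exfalso
      apply hinj
      intro a b hab
      by_contra hne
      exact hd (Matrix.det_zero_of_column_eq hne (fun i => by simp [hab]))
    let τ := σ ⊕ {l : ν // ¬ ∃ a, J a = l}
    let y0 : ν → MvPolynomial τ ℂ := fun l => if h : ∃ a, J a = l then 0 else X (Sum.inr ⟨l, h⟩)
    let φ : ν → MvPolynomial τ ℂ :=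
      kp (M.map (rename Sum.inl : MvPolynomial σ ℂ →ₐ[ℂ] MvPolynomial τ ℂ).toRingHom) J y0
    have hτ : Fintype.card τ < A.card := by
      have h1 : Fintype.card {l : ν // ∃ a, J a = l} = Fintype.card R := by
        have := Set.card_range_of_injective hinj
        rw [← this]
        exact Fintype.card_congr (Equiv.refl _)
      have h2 := Fintype.card_subtype_compl (fun l : ν => ∃ a, J a = l)
      have h3 : Fintype.card R ≤ Fintype.card ν := Fintype.card_le_of_injective J hinj
      simp only [τ, Fintype.card_sum]
      omega
    obtain ⟨c, h0, h1, h2⟩ := exists_dep A φ hτ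
    refine ⟨c, h0, h1, fun x f hd hf => ?_⟩
    have h3 := eval_aeval (Sum.elim x (fun l => f l.1 / ((evM M x).submatrix id J).det)) φ c
    rw [h2, map_zero] at h3
    rw [h3]
    congr 1
    have h4 := kp_off _ J f hd hf
    refine congrArg _ (funext fun l => ?_)
    rw [← congrFun h4 l]
    simp only [φ]
    rw [map_kp, Matrix.map_map]
    congr 1
    · ext a b
      simp [evM, eval_rename, Function.comp_def]
    · funext i
      simp only [y0]
      split_ifs with h
      · simp
      · simp
  choose c hc0 hcA hc using this
  refine ⟨∏ J, c J, Finset.prod_ne_zero_iff.2 fun J _ => hc0 J, ?_, ?_⟩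
  · intro j hj
    have := vars_prod (s := Finset.univ) c hj
    rw [Finset.mem_biUnion] at this
    obtain ⟨J, _, hJ⟩ := this
    exact hcA J hJ
  · rintro f ⟨x, hx, -, hf⟩
    obtain ⟨J, hJ⟩ := exists_minor _ hx
    rw [map_prod]
    exact Finset.prod_eq_zero (Finset.mem_univ J) (hc J x f hJ hf)

end KerFam


/-! ### Binary forms as univariate polynomials -/

section Apolar
variable {K : Type} [Field K]

def lin (u v : K) : Polynomial K := Polynomial.C u + Polynomial.C v * Polynomial.X

lemma natDegree_lin_le (u v : K) : (lin u v).natDegree ≤ 1 := by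
  unfold lin
  compute_degree

lemma coeff_lin_zero (u v : K) : (lin u v).coeff 0 = u := by simp [lin]
lemma coeff_lin_one (u v : K) : (lin u v).coeff 1 = v := by simp [lin, Polynomial.coeff_C]

lemma lin_ne_zero {u v : K} (h : (u, v) ≠ 0) : lin u v ≠ 0 := by
  intro h0
  apply h
  have h1 := coeff_lin_zero u v
  have h2 := coeff_lin_one u v
  rw [h0] at h1 h2
  simp at h1 h2
  rw [← h1, ← h2]; rfl

lemma natDegree_prod_lin_le {ι : Type*} (s : Finset ι) (u v : ι → K) (n : ι → ℕ) :
    (∏ i ∈ s, lin (u i) (v i) ^ n i).natDegree ≤ ∑ i ∈ s, n i := by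
  refine (Polynomial.natDegree_prod_le _ _).trans (Finset.sum_le_sum fun i _ => ?_)
  refine (Polynomial.natDegree_pow_le).trans ?_
  have := natDegree_lin_le (u i) (v i)
  nlinarith [Nat.zero_le (n i)]

def toPoly (r : ℕ) (a : Fin (r+1) → K) : Polynomial K :=
  ∑ i : Fin (r+1), Polynomial.C (a i) * Polynomial.X ^ (i : ℕ)

lemma coeff_toPoly (r : ℕ) (a : Fin (r+1) → K) (i : Fin (r+1)) : (toPoly r a).coeff i = a i := by
  simp only [toPoly, Polynomial.finset_sum_coeff, Polynomial.coeff_C_mul, Polynomial.coeff_X_pow]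
  rw [Finset.sum_eq_single i]
  · simp
  · intro b _ hb
    rw [if_neg]; · simp
    intro h; exact hb (Fin.ext h.symm)
  · simp

lemma natDegree_toPoly_le (r : ℕ) (a : Fin (r+1) → K) : (toPoly r a).natDegree ≤ r := by
  unfold toPoly
  refine Polynomial.natDegree_sum_le_of_forall_le _ _ fun i _ => ?_
  exact (Polynomial.natDegree_C_mul_X_pow_le _ _).trans (by omega)

lemma toPoly_coeff (r : ℕ) (H : Polynomial K) (h : H.natDegree ≤ r) :
    toPoly r (fun i => H.coeff i) = H := by
  ext n
  by_cases hn : n < r + 1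
  · exact coeff_toPoly r (fun i => H.coeff i) ⟨n, hn⟩
  · rw [Polynomial.coeff_eq_zero_of_natDegree_lt (lt_of_le_of_lt (natDegree_toPoly_le _ _) (by omega)),
      Polynomial.coeff_eq_zero_of_natDegree_lt (by omega)]

lemma toPoly_injective (r : ℕ) : Function.Injective (toPoly (K := K) r) := by
  intro a b h
  funext i
  rw [← coeff_toPoly r a, ← coeff_toPoly r b, h]

lemma aeval_binForm (r : ℕ) (a : Fin (r+1) → K) :
    aeval ![1, (Polynomial.X : Polynomial K)] (binForm r a) = toPoly r a := by
  simp [binForm, toPoly]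

lemma aeval_linForm (u v : K) :
    aeval ![1, (Polynomial.X : Polynomial K)] (linForm u v) = lin u v := by
  simp [linForm, lin]

lemma isHomogeneous_binForm (r : ℕ) (a : Fin (r+1) → K) : (binForm r a).IsHomogeneous r := by
  unfold binForm
  refine MvPolynomial.IsHomogeneous.sum _ _ _ fun i _ => ?_
  have h := ((isHomogeneous_C (Fin 2) (a i)).mul ((isHomogeneous_X K (0 : Fin 2)).pow (r - (i:ℕ)))).mul
    ((isHomogeneous_X K (1 : Fin 2)).pow (i : ℕ))
  convert h using 1
  have := i.2
  omega

lemma isHomogeneous_linForm (u v : K) : (linForm u v).IsHomogeneous 1 := by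
  unfold linForm
  have h1 := ((isHomogeneous_C (Fin 2) u).mul (isHomogeneous_X K (0 : Fin 2)))
  have h2 := ((isHomogeneous_C (Fin 2) v).mul (isHomogeneous_X K (1 : Fin 2)))
  simp only [zero_add] at h1 h2
  exact h1.add h2

lemma homog_inj {r : ℕ} {P Q : MvPolynomial (Fin 2) K} (hP : P.IsHomogeneous r)
    (hQ : Q.IsHomogeneous r)
    (h : aeval ![1, (Polynomial.X : Polynomial K)] P = aeval ![1, (Polynomial.X : Polynomial K)] Q) :
    P = Q := by
  let e : Fin 2 ≃ Fin 2 := Equiv.swap 0 1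
  have key : ∀ P : MvPolynomial (Fin 2) K, aeval ![(Polynomial.X : Polynomial K), 1] (rename e P)
      = aeval ![1, (Polynomial.X : Polynomial K)] P := by
    intro P
    rw [aeval_rename]
    congr 2
    funext i
    fin_cases i <;> simp [e]
  have h1 := Polynomial.homogenize_eq_of_isHomogeneous
    (hP.rename_isHomogeneous (f := e)) (key P)
  have h2 := Polynomial.homogenize_eq_of_isHomogeneous
    (hQ.rename_isHomogeneous (f := e)) (key Q)
  rw [h, h2] at h1
  exact (rename_injective e e.injective h1).symm

lemma binForm_eq_iff {r : ℕ} {a : Fin (r+1) → K} {Q : MvPolynomial (Fin 2) K}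
    (hQ : Q.IsHomogeneous r) :
    binForm r a = Q ↔ toPoly r a = aeval ![1, (Polynomial.X : Polynomial K)] Q := by
  constructor
  · rintro rfl; rw [aeval_binForm]
  · intro h
    exact homog_inj (isHomogeneous_binForm r a) hQ (by rw [aeval_binForm, h])

lemma binForm_eq_prod_iff {r n : ℕ} {a : Fin (r+1) → K} (t : K) (u v : Fin n → K) (lam : Fin n → ℕ)
    (h : ∑ i, lam i = r) :
    binForm r a = C t * ∏ i, (linForm (u i) (v i)) ^ lam i ↔
      toPoly r a = Polynomial.C t * ∏ i, lin (u i) (v i) ^ lam i := by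
  rw [binForm_eq_iff]
  · simp [aeval_linForm, map_prod, ← Polynomial.C_eq_algebraMap]
  · have h1 := (isHomogeneous_C (Fin 2) t).mul
      (MvPolynomial.IsHomogeneous.prod Finset.univ (fun i => (linForm (u i) (v i)) ^ lam i) lam
        (fun i _ => by simpa using (isHomogeneous_linForm (u i) (v i)).pow (lam i)))
    rwa [h, zero_add] at h1

/-- homogeneous evaluation -/
def heval (e : ℕ) (u v : K) : Polynomial K →ₗ[K] K :=
  ∑ i ∈ Finset.range (e+1), (u ^ (e - i) * v ^ i) • Polynomial.lcoeff K i

lemma heval_apply (e : ℕ) (u v : K) (H : Polynomial K) :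
    heval e u v H = ∑ i ∈ Finset.range (e+1), u ^ (e - i) * v ^ i * H.coeff i := by
  simp [heval, LinearMap.sum_apply]

lemma heval_eq (e : ℕ) (u v : K) (H : Polynomial K) :
    heval e u v H = eval ![v, u] (H.homogenize e) := by
  rw [heval_apply, Polynomial.homogenize, map_sum,
    Finset.Nat.sum_antidiagonal_eq_sum_range_succ_mk]
  apply Finset.sum_congr rfl
  intro i _
  rw [eval_monomial, Finsupp.prod_fintype _ _ (by simp)]
  simp
  ring

lemma heval_mul {m n : ℕ} (u v : K) (P Q : Polynomial K) (hP : P.natDegree ≤ m)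
    (hQ : Q.natDegree ≤ n) : heval (m + n) u v (P * Q) = heval m u v P * heval n u v Q := by
  rw [heval_eq, heval_eq, heval_eq, Polynomial.homogenize_mul P Q hP hQ, map_mul]

lemma heval_lin (u v b c : K) : heval 1 u v (lin b c) = b * u + c * v := by
  rw [heval_apply, Finset.sum_range_succ, Finset.sum_range_one, coeff_lin_zero, coeff_lin_one]
  simp; ring

lemma lin_dvd {e : ℕ} {b c : K} (hbc : (b, c) ≠ 0) (H : Polynomial K) (hH : H.natDegree ≤ e + 1)
    (h0 : heval (e+1) (-c) b H = 0) : ∃ Q : Polynomial K, Q.natDegree ≤ e ∧ H = lin b c * Q := by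
  by_cases hc : c = 0
  · subst hc
    have hb : b ≠ 0 := by
      rintro rfl; exact hbc rfl
    refine ⟨Polynomial.C b⁻¹ * H, ?_, ?_⟩
    · refine (Polynomial.natDegree_C_mul_le _ _).trans ?_
      rw [heval_apply, Finset.sum_range_succ, Finset.sum_eq_zero] at h0
      · simp [hb] at h0
        rw [Polynomial.natDegree_le_iff_coeff_eq_zero] at hH ⊢
        intro N hN
        rcases Nat.lt_or_ge (e+1) N with h | h
        · exact hH N h
        · have : N = e + 1 := by omega
          rw [this, h0]
      · intro i hi
        rw [neg_zero, zero_pow, zero_mul, zero_mul]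
        simp at hi; omega
    · unfold lin
      rw [← mul_assoc]
      simp only [map_zero, zero_mul, add_zero, ← map_mul]
      rw [mul_inv_cancel₀ hb]; simp
  · have hroot : H.IsRoot (-b / c) := by
      rw [Polynomial.IsRoot, Polynomial.eval_eq_sum_range' (n := e + 1 + 1) (by omega)]
      have : (-c) ^ (e+1) * ∑ i ∈ Finset.range (e + 1 + 1), H.coeff i * (-b / c) ^ i = 0 := by
        rw [← h0, heval_apply, Finset.mul_sum]
        apply Finset.sum_congr rfl
        intro i hi
        have hi' : i ≤ e + 1 := by simp at hi; omega
        rw [← Nat.sub_add_cancel hi', pow_add, Nat.sub_add_cancel hi', neg_div, ← div_neg, div_pow]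
        have : (-c) ^ i ≠ 0 := pow_ne_zero _ (neg_ne_zero.2 hc)
        field_simp
      exact (mul_eq_zero.1 this).resolve_left (pow_ne_zero _ (neg_ne_zero.2 hc))
    obtain ⟨Q, hQ⟩ := Polynomial.dvd_iff_isRoot.2 hroot
    refine ⟨Polynomial.C c⁻¹ * Q, ?_, ?_⟩
    · refine (Polynomial.natDegree_C_mul_le _ _).trans ?_
      by_cases hQ0 : Q = 0
      · simp [hQ0]
      · rw [hQ, Polynomial.natDegree_mul (Polynomial.X_sub_C_ne_zero _) hQ0,
          Polynomial.natDegree_X_sub_C] at hH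
        omega
    · rw [hQ]
      have : lin b c * Polynomial.C c⁻¹ = Polynomial.X - Polynomial.C (-b/c) := by
        unfold lin
        rw [add_mul, mul_right_comm, ← map_mul, ← map_mul, mul_inv_cancel₀ hc]
        rw [map_one, one_mul, neg_div, map_neg, div_eq_mul_inv]
        ring
      rw [← mul_assoc, this]

/-- apolarity functional -/
def apL (d : ℕ) (f : Fin (d+1) → K) : Polynomial K →ₗ[K] K :=
  ∑ i : Fin (d+1), (((d - (i:ℕ)).factorial * (i:ℕ).factorial : ℕ) * f i : K) • Polynomial.lcoeff K i

lemma apL_apply (d : ℕ) (f : Fin (d+1) → K) (H : Polynomial K) :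
    apL d f H = ∑ i : Fin (d+1), (((d - (i:ℕ)).factorial * (i:ℕ).factorial : ℕ) * f i : K) * H.coeff i := by
  simp [apL, LinearMap.sum_apply]

lemma apL_add (d : ℕ) (f g : Fin (d+1) → K) (H : Polynomial K) :
    apL d (f + g) H = apL d f H + apL d g H := by
  simp only [apL_apply, ← Finset.sum_add_distrib, Pi.add_apply]
  exact Finset.sum_congr rfl fun i _ => by ring

lemma apL_smul (d : ℕ) (c : K) (f : Fin (d+1) → K) (H : Polynomial K) :
    apL d (c • f) H = c * apL d f H := by
  simp only [apL_apply, Finset.mul_sum, Pi.smul_apply, smul_eq_mul]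
  exact Finset.sum_congr rfl fun i _ => by ring

/-- `p` annihilates `f` up to degree `r` multiples. -/
def Ann (d : ℕ) (f : Fin (d+1) → K) (p : Polynomial K) (r : ℕ) : Prop :=
  ∀ q : Polynomial K, q.natDegree ≤ r → apL d f (p * q) = 0

lemma Ann_iff (d : ℕ) (f : Fin (d+1) → K) (p : Polynomial K) (r : ℕ) :
    Ann d f p r ↔ ∀ m : Fin (r+1), apL d f (p * Polynomial.X ^ (m:ℕ)) = 0 := by
  constructor
  · intro h m
    exact h _ (by rw [Polynomial.natDegree_X_pow]; omega)
  · intro h q hq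
    rw [Polynomial.as_sum_range' q (r+1) (by omega), Finset.mul_sum, map_sum]
    apply Finset.sum_eq_zero
    intro i hi
    rw [← Polynomial.C_mul_X_pow_eq_monomial, mul_left_comm, ← Polynomial.smul_eq_C_mul, map_smul]
    rw [h ⟨i, by simpa using hi⟩, smul_zero]

def powVec (d : ℕ) (u v : K) : Fin (d+1) → K := fun i => (d.choose i : K) * u ^ (d - (i:ℕ)) * v ^ (i:ℕ)

lemma toPoly_powVec (d : ℕ) (u v : K) : toPoly d (powVec d u v) = lin u v ^ d := by
  unfold toPoly powVec lin
  rw [add_comm (Polynomial.C u), add_pow]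
  refine (Fin.sum_univ_eq_sum_range
    (fun i => Polynomial.C ((d.choose i : K) * u ^ (d - i) * v ^ i) * Polynomial.X ^ i) (d+1)).trans ?_
  apply Finset.sum_congr rfl
  intro i _
  simp only [map_mul, map_pow, mul_pow, map_natCast]
  ring

lemma toPoly_add (d : ℕ) (a b : Fin (d+1) → K) : toPoly d (a + b) = toPoly d a + toPoly d b := by
  simp [toPoly, add_mul, Finset.sum_add_distrib]
lemma toPoly_smul (d : ℕ) (c : K) (b : Fin (d+1) → K) : toPoly d (c • b) = Polynomial.C c * toPoly d b := by
  simp [toPoly, Finset.mul_sum, mul_assoc]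
lemma toPoly_zero (d : ℕ) : toPoly d (0 : Fin (d+1) → K) = 0 := by
  simp [toPoly]
lemma toPoly_sum {ι : Type*} (s : Finset ι) (d : ℕ) (a : ι → Fin (d+1) → K) :
    toPoly d (∑ j ∈ s, a j) = ∑ j ∈ s, toPoly d (a j) := by
  classical
  induction s using Finset.induction_on with
  | empty => simp [toPoly_zero]
  | insert j s hj ih => rw [Finset.sum_insert hj, Finset.sum_insert hj, toPoly_add, ih]

lemma binForm_eq_sum_iff {d : ℕ} {ι : Type} [Fintype ι] {a : Fin (d+1) → K} (α u v : ι → K) :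
    binForm d a = ∑ j, α j • (linForm (u j) (v j)) ^ d ↔ a = ∑ j, α j • powVec d (u j) (v j) := by
  rw [binForm_eq_iff]
  · rw [← (toPoly_injective d).eq_iff, toPoly_sum]
    simp [aeval_linForm, toPoly_smul, toPoly_powVec, Polynomial.smul_eq_C_mul]
  · refine MvPolynomial.IsHomogeneous.sum _ _ _ fun i _ => ?_
    rw [smul_eq_C_mul]
    simpa using (isHomogeneous_C (Fin 2) (α i)).mul ((isHomogeneous_linForm (u i) (v i)).pow d)

lemma apL_powVec (d : ℕ) (u v : K) (H : Polynomial K) :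
    apL d (powVec d u v) H = d.factorial * heval d u v H := by
  rw [apL_apply, heval_apply, Finset.mul_sum]
  refine (Fin.sum_univ_eq_sum_range (fun i =>
    (((d - i).factorial * i.factorial : ℕ) * ((d.choose i : K) * u ^ (d - i) * v ^ i)) * H.coeff i) (d+1)).trans ?_
  apply Finset.sum_congr rfl
  intro i hi
  have hi' : i ≤ d := by simp at hi; omega
  rw [← Nat.choose_mul_factorial_mul_factorial hi']
  push_cast
  ring

lemma apL_sum {ι : Type*} (s : Finset ι) (d : ℕ) (a : ι → Fin (d+1) → K) (H : Polynomial K) :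
    apL d (∑ j ∈ s, a j) H = ∑ j ∈ s, apL d (a j) H := by
  classical
  induction s using Finset.induction_on with
  | empty => simp [apL_apply]
  | insert j s hj ih => rw [Finset.sum_insert hj, Finset.sum_insert hj, apL_add, ih]

end Apolar

lemma coeff_pderiv_iter {σ : Type} [DecidableEq σ] {K : Type} [CommSemiring K] (i : σ) (n : ℕ) (p : MvPolynomial σ K)
    (m : σ →₀ ℕ) : coeff m ((fun g => pderiv i g)^[n] p) =
      coeff (m + Finsupp.single i n) p * (m i + 1).ascFactorial n := by
  induction n generalizing p m with
  | zero => simp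
  | succ n ih =>
    rw [Function.iterate_succ_apply, ih, coeff_pderiv]
    rw [Nat.ascFactorial_succ, add_assoc, ← Finsupp.single_add]
    simp
    ring

lemma coeff_binForm {K : Type} [CommSemiring K] (r : ℕ) (a : Fin (r+1) → K) (i : Fin (r+1)) :
    coeff (Finsupp.single 0 (r - (i:ℕ)) + Finsupp.single 1 (i:ℕ)) (binForm r a) = a i := by
  unfold binForm
  rw [coeff_sum, Finset.sum_eq_single i]
  · rw [mul_assoc, coeff_C_mul, X_pow_eq_monomial, X_pow_eq_monomial, monomial_mul, coeff_monomial]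
    simp
  · intro j _ hj
    rw [mul_assoc, coeff_C_mul, X_pow_eq_monomial, X_pow_eq_monomial, monomial_mul, coeff_monomial,
      if_neg, mul_zero]
    intro h
    apply hj
    have := DFunLike.congr_fun h 1
    simp at this
    exact Fin.ext this
  · simp

lemma apolarPair_eq (d : ℕ) (h a : Fin (d+1) → ℂ) : apolarPair d h a = apL d h (toPoly d a) := by
  unfold apolarPair diffOp
  rw [map_sum, apL_apply]
  apply Finset.sum_congr rfl
  intro i _
  rw [smul_eval]
  have h0 : ∀ p : MvPolynomial (Fin 2) ℂ, eval (fun _ : Fin 2 => (0:ℂ)) p = coeff 0 p := by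
    intro p
    have := eval₂_zero_apply (RingHom.id ℂ) p (σ := Fin 2)
    simpa [constantCoeff_eq] using this
  rw [h0, coeff_pderiv_iter, coeff_pderiv_iter, zero_add, coeff_binForm, coeff_toPoly]
  simp [Nat.one_ascFactorial]
  ring


/-! ### Products of linear forms, interpolation -/

section Prod
variable {K : Type} [Field K]

lemma heval_prod_lin {ι : Type*} (s : Finset ι) (b c : ι → K) (u v : K) :
    heval s.card u v (∏ j ∈ s, lin (b j) (c j)) = ∏ j ∈ s, (b j * u + c j * v) := by
  have h1 : heval s.card u v (∏ j ∈ s, lin (b j) (c j)) =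
      eval ![v, u] ((∏ j ∈ s, lin (b j) (c j)).homogenize (∑ j ∈ s, 1)) := by
    rw [heval_eq]; simp
  rw [h1, Polynomial.homogenize_finsetProd (fun i _ => natDegree_lin_le _ _), map_prod]
  apply Finset.prod_congr rfl
  intro j _
  rw [← heval_eq, heval_lin]

lemma natDegree_prod_lin_le' {ι : Type*} (s : Finset ι) (b c : ι → K) :
    (∏ j ∈ s, lin (b j) (c j)).natDegree ≤ s.card := by
  simpa using natDegree_prod_lin_le s b c (fun _ => 1)

lemma prod_lin_dvd {ι : Type*} (s : Finset ι) (b c : ι → K) (h0 : ∀ j ∈ s, (b j, c j) ≠ 0)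
    (hne : ∀ j ∈ s, ∀ k ∈ s, j ≠ k → b j * c k - b k * c j ≠ 0) :
    ∀ (e : ℕ) (H : Polynomial K), H.natDegree ≤ e + s.card →
      (∀ j ∈ s, heval (e + s.card) (-c j) (b j) H = 0) →
      ∃ Q : Polynomial K, Q.natDegree ≤ e ∧ H = (∏ j ∈ s, lin (b j) (c j)) * Q := by
  classical
  induction s using Finset.induction_on with
  | empty => intro e H hH _; exact ⟨H, by simpa using hH, by simp⟩
  | insert j s hj ih =>
    intro e H hH hv
    rw [Finset.card_insert_of_notMem hj] at hH hv
    obtain ⟨H1, hH1, rfl⟩ := lin_dvd (e := e + s.card) (h0 j (by simp)) H (by omega)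
      (by simpa [add_assoc] using hv j (by simp))
    obtain ⟨Q, hQ, rfl⟩ := ih (fun k hk => h0 k (by simp [hk]))
      (fun k hk l hl => hne k (by simp [hk]) l (by simp [hl])) e H1 hH1 (by
        intro k hk
        have h1 := hv k (by simp [hk])
        have h2 : e + (s.card + 1) = 1 + (e + s.card) := by ring
        rw [h2, heval_mul _ _ _ _ (natDegree_lin_le _ _) hH1, heval_lin] at h1
        refine (mul_eq_zero.1 h1).resolve_left ?_
        have := hne k (by simp [hk]) j (by simp) (by rintro rfl; exact hj hk)
        intro h; apply this; linear_combination h)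
    refine ⟨Q, hQ, ?_⟩
    rw [Finset.prod_insert hj, mul_assoc]

lemma eq_zero_of_vanish {ι : Type*} (s : Finset ι) (b c : ι → K) (h0 : ∀ j ∈ s, (b j, c j) ≠ 0)
    (hne : ∀ j ∈ s, ∀ k ∈ s, j ≠ k → b j * c k - b k * c j ≠ 0) (e : ℕ) (hs : e < s.card)
    (H : Polynomial K) (hH : H.natDegree ≤ e) (hv : ∀ j ∈ s, heval e (-c j) (b j) H = 0) : H = 0 := by
  classical
  obtain ⟨s', hs', hcard⟩ := Finset.exists_subset_card_eq (show e + 1 ≤ s.card by omega)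
  obtain ⟨j, hj⟩ : s'.Nonempty := by rw [← Finset.card_pos]; omega
  have hc : (s'.erase j).card = e := by rw [Finset.card_erase_of_mem hj, hcard]; simp
  have hsub : s'.erase j ⊆ s := (Finset.erase_subset _ _).trans hs'
  obtain ⟨Q, hQ, rfl⟩ := prod_lin_dvd (s'.erase j) b c (fun k hk => h0 k (hsub hk))
    (fun k hk l hl => hne k (hsub hk) l (hsub hl)) 0 H (by omega) (by
      intro k hk; rw [hc, zero_add]; exact hv k (hsub hk))
  have h1 := hv j (hs' hj)
  have h2 : e = (s'.erase j).card + 0 := by omega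
  rw [h2, heval_mul _ _ _ _ (natDegree_prod_lin_le' _ _ _) hQ, heval_prod_lin] at h1
  rcases mul_eq_zero.1 h1 with h | h
  · rw [Finset.prod_eq_zero_iff] at h
    obtain ⟨k, hk, h⟩ := h
    exact absurd (by linear_combination -h)
      (hne k (hsub hk) j (hs' hj) (Finset.ne_of_mem_erase hk))
  · rw [Polynomial.eq_C_of_natDegree_le_zero hQ] at h ⊢
    rw [heval_apply] at h
    simp at h
    simp [h]

/-- Sylvester: annihilated by a product of distinct linear forms. -/
lemma sylvester [CharZero K] {ι : Type} [Fintype ι] (b c : ι → K) (h0 : ∀ j, (b j, c j) ≠ 0)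
    (hne : ∀ j k, j ≠ k → b j * c k - b k * c j ≠ 0) (d : ℕ) (hs : Fintype.card ι ≤ d)
    (f : Fin (d+1) → K) (hf : Ann d f (∏ j, lin (b j) (c j)) (d - Fintype.card ι)) :
    ∃ α : ι → K, f = ∑ j, α j • powVec d (-c j) (b j) := by
  classical
  let tp : (Fin (d+1) → K) →ₗ[K] Polynomial K :=
    { toFun := toPoly d
      map_add' := toPoly_add d
      map_smul' := fun r x => by rw [toPoly_smul, Polynomial.smul_eq_C_mul]; rfl }
  have hmem := mem_span_of_iInf_ker_le_ker (ι := ι) (L := fun j => (heval d (-c j) (b j)).comp tp)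
    (K := (apL d f).comp tp) (by
      intro x hx
      simp only [Submodule.mem_iInf, LinearMap.mem_ker, LinearMap.comp_apply] at hx ⊢
      have hcard : d = (d - Fintype.card ι) + (Finset.univ : Finset ι).card := by
        rw [Finset.card_univ]; omega
      obtain ⟨Q, hQ, he⟩ := prod_lin_dvd Finset.univ b c (fun j _ => h0 j)
        (fun j _ k _ => hne j k) (d - Fintype.card ι) (toPoly d x)
        (by rw [← hcard]; exact natDegree_toPoly_le d x)
        (by intro j _; rw [← hcard]; exact hx j)
      show apL d f (toPoly d x) = 0
      rw [he]; exact hf Q hQ)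
  rw [Submodule.mem_span_range_iff_exists_fun] at hmem
  obtain ⟨α, hα⟩ := hmem
  refine ⟨fun j => α j / d.factorial, ?_⟩
  have hd : (d.factorial : K) ≠ 0 := by exact_mod_cast d.factorial_ne_zero
  funext i
  have h1 := LinearMap.congr_fun hα (fun k => if k = i then 1 else 0)
  have h2 : ∀ n : Fin (d+1), (toPoly d (fun k : Fin (d+1) => if k = i then (1:K) else 0)).coeff n =
    if n = i then 1 else 0 := fun n => coeff_toPoly d _ n
  simp only [LinearMap.sum_apply, LinearMap.smul_apply, LinearMap.comp_apply] at h1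
  have h3 : ∀ j, heval d (-c j) (b j) (tp fun k => if k = i then 1 else 0) =
      (-c j) ^ (d - (i:ℕ)) * b j ^ (i:ℕ) := by
    intro j
    show heval d _ _ (toPoly d _) = _
    rw [heval_apply]
    rw [Finset.sum_range]
    simp [h2]
  have h4 : apL d f (tp fun k => if k = i then 1 else 0) =
      ((d - (i:ℕ)).factorial * (i:ℕ).factorial : ℕ) * f i := by
    show apL d f (toPoly d _) = _
    rw [apL_apply]
    simp [h2]
  simp only [h3, h4] at h1
  have hi : (i:ℕ) ≤ d := by omega
  have hch := Nat.choose_mul_factorial_mul_factorial hi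
  have hA : (((d - (i:ℕ)).factorial * (i:ℕ).factorial : ℕ) : K) ≠ 0 := by
    exact_mod_cast (Nat.mul_pos (Nat.factorial_pos _) (Nat.factorial_pos _)).ne'
  apply mul_left_cancel₀ hA
  rw [← h1, Finset.sum_apply, Finset.mul_sum]
  apply Finset.sum_congr rfl
  intro j _
  simp only [Pi.smul_apply, smul_eq_mul, powVec]
  rw [← hch]
  have h5 : (d.choose i : K) ≠ 0 := by exact_mod_cast (Nat.choose_pos hi).ne'
  have h6 : ((i:ℕ).factorial : K) ≠ 0 := by exact_mod_cast (Nat.factorial_pos _).ne'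
  have h7 : ((d - (i:ℕ)).factorial : K) ≠ 0 := by exact_mod_cast (Nat.factorial_pos _).ne'
  push_cast
  field_simp

end Prod

/-! ### The sets of forms of rank at most s -/

def Eset (d s : ℕ) : Set (Fin (d+1) → ℝ) :=
  {a | ∃ α u v : Fin s → ℝ, a = ∑ j, α j • powVec d (u j) (v j)}

lemma exists_perp (u v : ℝ) : ∃ b c : ℝ, b^2 + c^2 = 1 ∧ b * u + c * v = 0 := by
  by_cases h : u = 0 ∧ v = 0
  · exact ⟨1, 0, by simp, by simp [h]⟩
  · have hp : 0 < u^2 + v^2 := by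
      by_contra hn
      apply h
      constructor <;> nlinarith [sq_nonneg u, sq_nonneg v]
    have hs := Real.sq_sqrt hp.le
    have hs0 : Real.sqrt (u^2+v^2) ≠ 0 := (Real.sqrt_pos.2 hp).ne'
    refine ⟨-v / Real.sqrt (u^2+v^2), u / Real.sqrt (u^2+v^2), ?_, ?_⟩
    · rw [div_pow, div_pow, hs]; field_simp; ring
    · field_simp; ring

def AnnUnit (d s : ℕ) : Set (Fin (d+1) → ℝ) :=
  {a | ∃ b c : Fin s → ℝ, (∀ j, b j ^ 2 + c j ^ 2 = 1) ∧ Ann d a (∏ j, lin (b j) (c j)) (d - s)}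

lemma Eset_subset_AnnUnit (d s : ℕ) (hd : s ≤ d) : Eset d s ⊆ AnnUnit d s := by
  classical
  rintro a ⟨α, u, v, rfl⟩
  choose b c h1 h2 using fun j => exists_perp (u j) (v j)
  refine ⟨b, c, h1, ?_⟩
  intro q hq
  rw [apL_sum]
  apply Finset.sum_eq_zero
  intro j _
  rw [apL_smul, apL_powVec]
  have hdd : d = (Finset.univ : Finset (Fin s)).card + (d - s) := by simp; omega
  have : heval d (u j) (v j) ((∏ j, lin (b j) (c j)) * q) = 0 := by
    conv_lhs => rw [hdd]
    rw [heval_mul _ _ _ _ (natDegree_prod_lin_le' _ _ _) hq, heval_prod_lin,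
      Finset.prod_eq_zero (Finset.mem_univ j) (h2 j), zero_mul]
  rw [this]; simp

/-- polynomial-valued maps with smooth coefficients -/
def SmP {E : Type*} [NormedAddCommGroup E] [NormedSpace ℝ E] (p : E → Polynomial ℝ) : Prop :=
  ∀ n, ContDiff ℝ 1 (fun x => (p x).coeff n)

section SmP
variable {E : Type*} [NormedAddCommGroup E] [NormedSpace ℝ E]

lemma SmP.const (p : Polynomial ℝ) : SmP (fun _ : E => p) := fun n => contDiff_const

lemma SmP.mul {p q : E → Polynomial ℝ} (hp : SmP p) (hq : SmP q) : SmP (fun x => p x * q x) := by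
  intro n
  simp only [Polynomial.coeff_mul]
  exact ContDiff.sum fun i _ => (hp _).mul (hq _)

lemma SmP.prod {ι : Type*} (s : Finset ι) {p : ι → E → Polynomial ℝ} (hp : ∀ i, SmP (p i)) :
    SmP (fun x => ∏ i ∈ s, p i x) := by
  classical
  induction s using Finset.induction_on with
  | empty => simpa using SmP.const 1
  | insert j s hj ih => simp only [Finset.prod_insert hj]; exact (hp j).mul ih

lemma SmP.lin {b c : E → ℝ} (hb : ContDiff ℝ 1 b) (hc : ContDiff ℝ 1 c) :
    SmP (fun x => lin (b x) (c x)) := by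
  intro n
  rcases n with _ | _ | n
  · simpa [coeff_lin_zero] using hb
  · simpa [coeff_lin_one] using hc
  · have : ∀ x, (_root_.lin (b x) (c x)).coeff (n+1+1) = 0 := fun x =>
      Polynomial.coeff_eq_zero_of_natDegree_lt (lt_of_le_of_lt (natDegree_lin_le _ _) (by omega))
    simp only [this]; exact contDiff_const

lemma SmP.apL {d : ℕ} {a : E → Fin (d+1) → ℝ} (ha : ContDiff ℝ 1 a) {p : E → Polynomial ℝ} (hp : SmP p) :
    ContDiff ℝ 1 (fun x => apL d (a x) (p x)) := by
  simp only [apL_apply]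
  refine ContDiff.sum fun i _ => ContDiff.mul (ContDiff.mul contDiff_const ?_) (hp _)
  exact (contDiff_apply ℝ ℝ i).comp ha

end SmP

lemma isClosed_AnnUnit (d s : ℕ) : IsClosed (AnnUnit d s) := by
  let E := (Fin (d+1) → ℝ) × ((Fin s → ℝ) × (Fin s → ℝ))
  let C : Set ((Fin s → ℝ) × (Fin s → ℝ)) := {x | ∀ j, x.1 j ^ 2 + x.2 j ^ 2 = 1}
  have hC : IsCompact C := by
    apply Metric.isCompact_of_isClosed_isBounded
    · simp only [C, Set.setOf_forall]
      exact isClosed_iInter fun j => isClosed_eq (by fun_prop) continuous_const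
    · refine (Metric.isBounded_closedBall (x := (0 : (Fin s → ℝ) × (Fin s → ℝ))) (r := 1)).subset ?_
      intro x hx
      rw [mem_closedBall_zero_iff, Prod.norm_def, max_le_iff, pi_norm_le_iff_of_nonneg zero_le_one,
        pi_norm_le_iff_of_nonneg zero_le_one]
      refine ⟨fun j => ?_, fun j => ?_⟩ <;>
      · rw [Real.norm_eq_abs, abs_le]
        have := hx j
        constructor <;> nlinarith [sq_nonneg (x.1 j), sq_nonneg (x.2 j)]
  haveI : CompactSpace C := isCompact_iff_compactSpace.1 hC
  let Z : Set ((Fin (d+1) → ℝ) × C) :=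
    {x | ∀ m : Fin (d - s + 1), apL d x.1 ((∏ j, lin (x.2.1.1 j) (x.2.1.2 j)) * Polynomial.X ^ (m:ℕ)) = 0}
  have hZ : IsClosed Z := by
    simp only [Z, Set.setOf_forall]
    refine isClosed_iInter fun m => isClosed_eq ?_ continuous_const
    have hsm : ContDiff ℝ 1 (fun x : E => apL d x.1 ((∏ j, lin (x.2.1 j) (x.2.2 j)) * Polynomial.X ^ (m:ℕ))) := by
      refine SmP.apL contDiff_fst (SmP.mul (SmP.prod _ fun j => SmP.lin ?_ ?_) (SmP.const _))
      · exact (contDiff_apply ℝ ℝ j).comp (contDiff_fst.comp contDiff_snd)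
      · exact (contDiff_apply ℝ ℝ j).comp (contDiff_snd.comp contDiff_snd)
    exact hsm.continuous.comp (f := fun x : (Fin (d+1) → ℝ) × C => ((x.1, x.2.1) : E)) (by fun_prop)
  have := isClosedMap_fst_of_compactSpace (X := Fin (d+1) → ℝ) (Y := C) Z hZ
  convert this using 1
  ext a
  simp only [Set.mem_image, Prod.exists, exists_and_right, exists_eq_right]
  constructor
  · rintro ⟨b, c, h1, h2⟩
    exact ⟨⟨(b, c), h1⟩, (Ann_iff _ _ _ _).1 h2⟩
  · rintro ⟨⟨⟨b, c⟩, h1⟩, h2⟩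
    exact ⟨b, c, h1, (Ann_iff _ _ _ _).2 h2⟩

/-- grouping proportional linear forms -/
lemma exists_grouping (d s : ℕ) (a : Fin (d+1) → ℝ) (b c : Fin s → ℝ)
    (h1 : ∀ j, b j ^ 2 + c j ^ 2 = 1) (hann : Ann d a (∏ j, lin (b j) (c j)) (d - s)) :
    ∃ (ι : Type) (_ : Fintype ι) (_ : DecidableEq ι) (B C : ι → ℝ) (lam : ι → ℕ),
      (∀ i, (B i, C i) ≠ 0) ∧ (∀ i j, i ≠ j → B i * C j - B j * C i ≠ 0) ∧
      (∀ i, 1 ≤ lam i) ∧ ∑ i, lam i = s ∧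
      Ann d a (∏ i, lin (B i) (C i) ^ lam i) (d - s) := by
  classical
  let P : Fin s → ℝ × ℝ := fun j => if c j = 0 then (1, 0) else (b j / c j, 1)
  have hP : ∀ j, ∃ t : ℝ, t ≠ 0 ∧ lin (b j) (c j) = Polynomial.C t * lin (P j).1 (P j).2 := by
    intro j
    by_cases hc : c j = 0
    · refine ⟨b j, ?_, ?_⟩
      · intro h; have := h1 j; rw [hc, h] at this; norm_num at this
      · simp [P, hc, lin]
    · refine ⟨c j, hc, ?_⟩
      simp only [P, hc, if_false, lin, mul_add, ← mul_assoc, ← map_mul]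
      rw [mul_div_cancel₀ _ hc, mul_one]
  choose t ht htP using hP
  let A := Finset.univ.image P
  have hA : ∀ x ∈ A, x.2 = 1 ∨ x = (1, 0) := by
    intro x hx
    obtain ⟨j, _, rfl⟩ := Finset.mem_image.1 hx
    by_cases hc : c j = 0
    · right; simp [P, hc]
    · left; simp [P, hc]
  refine ⟨A, inferInstance, inferInstance, fun x => x.1.1, fun x => x.1.2,
    fun x => (Finset.univ.filter fun j => P j = x.1).card, ?_, ?_, ?_, ?_, ?_⟩
  · intro x h
    rcases hA x.1 x.2 with h' | h'
    · have := congrArg Prod.snd h; simp [h'] at this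
    · have := congrArg Prod.fst h; simp [h'] at this
  · intro x y hxy h
    apply hxy
    apply Subtype.ext
    rcases hA x.1 x.2 with h' | h' <;> rcases hA y.1 y.2 with h'' | h''
    · simp only [h', h'', mul_one] at h
      exact Prod.ext (by linarith) (by rw [h', h''])
    · simp [h', h''] at h
    · simp [h', h''] at h
    · rw [h', h'']
  · intro x
    obtain ⟨j, _, hj⟩ := Finset.mem_image.1 x.2
    exact Finset.card_pos.2 ⟨j, by simp [hj]⟩
  · have := Finset.card_eq_sum_card_image P (Finset.univ : Finset (Fin s))
    rw [Finset.card_univ, Fintype.card_fin] at this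
    rw [Finset.sum_coe_sort A (fun x => (Finset.univ.filter fun j => P j = x).card)]
    exact this.symm
  · intro q hq
    have e1 := Finset.prod_comp (s := Finset.univ) (fun x : ℝ × ℝ => lin x.1 x.2) P
    have e2 : ∏ x : A, lin x.1.1 x.1.2 ^ (Finset.univ.filter fun j => P j = x.1).card =
      ∏ j, lin (P j).1 (P j).2 := by
      rw [e1]
      exact Finset.prod_coe_sort A (fun x => lin x.1 x.2 ^ (Finset.univ.filter fun j => P j = x).card)
    have e3 : ∏ j, lin (b j) (c j) = Polynomial.C (∏ j, t j) * ∏ j, lin (P j).1 (P j).2 := by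
      rw [map_prod, ← Finset.prod_mul_distrib]
      exact Finset.prod_congr rfl fun j _ => htP j
    have h3 := hann q hq
    rw [e3, mul_assoc, ← Polynomial.smul_eq_C_mul, map_smul, smul_eq_mul] at h3
    rw [e2]
    exact (mul_eq_zero.1 h3).resolve_left (Finset.prod_ne_zero_iff.2 fun j _ => ht j)


section Real1
variable {ι : Type} [Fintype ι] [DecidableEq ι]

/-- Lagrange interpolation for binary forms. -/
lemma lagrange (A : Finset ι) (b c : ι → ℝ) (h0 : ∀ i, (b i, c i) ≠ 0)
    (hne : ∀ i j, i ≠ j → b i * c j - b j * c i ≠ 0) (e : ℕ) (y : ι → ℝ) :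
    ∃ α : ι → ℝ, ∀ k ∈ A, heval (A.card + e) (-c k) (b k)
      (∑ i ∈ A, Polynomial.C (α i) * ((∏ j ∈ A.erase i, lin (b j) (c j)) * lin (-c i) (b i) ^ (e+1))) = y k := by
  have hn : ∀ i, b i ^ 2 + c i ^ 2 ≠ 0 := by
    intro i h
    apply h0 i
    have h1 : b i = 0 := by nlinarith [sq_nonneg (b i), sq_nonneg (c i)]
    have h2 : c i = 0 := by nlinarith [sq_nonneg (b i), sq_nonneg (c i)]
    rw [h1, h2]; rfl
  have key : ∀ i ∈ A, ∀ k ∈ A, heval (A.card + e) (-c k) (b k)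
      ((∏ j ∈ A.erase i, lin (b j) (c j)) * lin (-c i) (b i) ^ (e+1)) =
      (∏ j ∈ A.erase i, (b j * (-c k) + c j * b k)) * (-c i * -c k + b i * b k) ^ (e+1) := by
    intro i hi k hk
    have hc : A.card + e = (A.erase i).card + (e+1) := by
      rw [Finset.card_erase_of_mem hi]
      have := Finset.card_pos.2 ⟨i, hi⟩
      omega
    have hpd : (lin (-c i) (b i) ^ (e+1)).natDegree ≤ e+1 := by
      simpa using natDegree_prod_lin_le' (Finset.range (e+1)) (fun _ => -c i) (fun _ => b i)
    rw [hc, heval_mul _ _ _ _ (natDegree_prod_lin_le' _ _ _) hpd, heval_prod_lin]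
    congr 1
    simpa using heval_prod_lin (Finset.range (e+1)) (fun _ => -c i) (fun _ => b i) (-c k) (b k)
  refine ⟨fun i => y i / ((∏ j ∈ A.erase i, (b j * (-c i) + c j * b i)) * (-c i * -c i + b i * b i) ^ (e+1)), ?_⟩
  intro k hk
  rw [map_sum, Finset.sum_eq_single_of_mem k hk]
  · rw [← Polynomial.smul_eq_C_mul, map_smul, key k hk k hk, smul_eq_mul, div_mul_cancel₀]
    apply mul_ne_zero
    · rw [Finset.prod_ne_zero_iff]
      intro j hj h
      apply hne j k (Finset.ne_of_mem_erase hj)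
      linear_combination -h
    · apply pow_ne_zero
      intro h; apply hn k; linear_combination h
  · intro i hi hik
    rw [← Polynomial.smul_eq_C_mul, map_smul, key i hi k hk,
      Finset.prod_eq_zero (Finset.mem_erase.2 ⟨hik.symm, hk⟩) (by ring), zero_mul, smul_zero]

lemma natDegree_lagr (A : Finset ι) (b c : ι → ℝ) (e : ℕ) (α : ι → ℝ) :
    (∑ i ∈ A, Polynomial.C (α i) * ((∏ j ∈ A.erase i, lin (b j) (c j)) * lin (-c i) (b i) ^ (e+1))).natDegree
      ≤ A.card + e := by
  refine Polynomial.natDegree_sum_le_of_forall_le _ _ fun i hi => ?_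
  refine (Polynomial.natDegree_C_mul_le _ _).trans ?_
  refine Polynomial.natDegree_mul_le.trans ?_
  have h1 := natDegree_prod_lin_le' (A.erase i) b c
  have hpd : (lin (-c i) (b i) ^ (e+1)).natDegree ≤ e+1 := by
    simpa using natDegree_prod_lin_le' (Finset.range (e+1)) (fun _ => -c i) (fun _ => b i)
  rw [Finset.card_erase_of_mem hi] at h1
  have := Finset.card_pos.2 ⟨i, hi⟩
  omega

variable (b c : ι → ℝ) (h0 : ∀ i, (b i, c i) ≠ 0)
    (hne : ∀ i j, i ≠ j → b i * c j - b j * c i ≠ 0) (lam : ι → ℕ) (hlam : ∀ i, 1 ≤ lam i)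
    (d s : ℕ) (f : Fin (d+1) → ℝ)

include h0 hne hlam in
/-- if all tangent directions are killed then the full multiple space is killed -/
lemma ann_of_tangent (hf : Ann d f (∏ i, lin (b i) (c i) ^ lam i) (d - s)) (θ : Polynomial ℝ)
    (hθ : θ.natDegree ≤ d - s)
    (ht : ∀ i, apL d f ((∏ j ∈ Finset.univ.erase i, lin (b j) (c j) ^ lam j) *
      (lin (b i) (c i) ^ (lam i - 1) * lin (-c i) (b i)) * θ) = 0) :
    Ann d f ((∏ i, lin (b i) (c i) ^ (lam i - 1)) * θ) (Fintype.card ι) := by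
  intro q hq
  obtain ⟨α, hα⟩ := lagrange Finset.univ b c h0 hne 0
    (fun k => heval (Fintype.card ι) (-c k) (b k) q)
  set S := ∑ i ∈ Finset.univ, Polynomial.C (α i) * ((∏ j ∈ Finset.univ.erase i, lin (b j) (c j)) *
    lin (-c i) (b i) ^ (0+1)) with hS
  have hSd : S.natDegree ≤ Fintype.card ι := natDegree_lagr Finset.univ b c 0 α
  obtain ⟨Q, hQ, hqS⟩ := prod_lin_dvd Finset.univ b c (fun i _ => h0 i) (fun i _ j _ => hne i j) 0
    (q - S) (by
      rw [zero_add]; exact (Polynomial.natDegree_sub_le _ _).trans (max_le hq hSd))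
    (by
      intro k hk
      have := hα k hk
      rw [zero_add, map_sub]
      simp only [add_zero, Finset.card_univ] at this ⊢
      rw [this, sub_self])
  have hq' : q = S + (∏ j, lin (b j) (c j)) * Q := by rw [← hqS]; ring
  have hprod : (∏ i, lin (b i) (c i) ^ (lam i - 1)) * ∏ i, lin (b i) (c i) = ∏ i, lin (b i) (c i) ^ lam i := by
    rw [← Finset.prod_mul_distrib]
    refine Finset.prod_congr rfl fun i _ => ?_
    rw [← pow_succ, Nat.sub_add_cancel (hlam i)]
  rw [hq', mul_add, map_add]
  have e2 : (∏ i, lin (b i) (c i) ^ (lam i - 1)) * θ * ((∏ j, lin (b j) (c j)) * Q) =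
      (∏ i, lin (b i) (c i) ^ lam i) * (θ * Q) := by rw [← hprod]; ring
  rw [e2, hf _ (Polynomial.natDegree_mul_le.trans (by omega)), add_zero, hS, Finset.mul_sum, map_sum]
  apply Finset.sum_eq_zero
  intro i _
  have e3 : (∏ i, lin (b i) (c i) ^ (lam i - 1)) = (∏ j ∈ Finset.univ.erase i, lin (b j) (c j) ^ (lam j - 1)) *
      lin (b i) (c i) ^ (lam i - 1) := (Finset.prod_erase_mul _ _ (Finset.mem_univ i)).symm
  have e4 : (∏ j ∈ Finset.univ.erase i, lin (b j) (c j) ^ (lam j - 1)) *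
      (∏ j ∈ Finset.univ.erase i, lin (b j) (c j)) = ∏ j ∈ Finset.univ.erase i, lin (b j) (c j) ^ lam j := by
    rw [← Finset.prod_mul_distrib]
    refine Finset.prod_congr rfl fun i _ => ?_
    rw [← pow_succ, Nat.sub_add_cancel (hlam i)]
  have e5 : (∏ i, lin (b i) (c i) ^ (lam i - 1)) * θ *
    (Polynomial.C (α i) * ((∏ j ∈ Finset.univ.erase i, lin (b j) (c j)) * lin (-c i) (b i) ^ (0 + 1))) =
    α i • ((∏ j ∈ Finset.univ.erase i, lin (b j) (c j) ^ lam j) *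
      (lin (b i) (c i) ^ (lam i - 1) * lin (-c i) (b i)) * θ) := by
    rw [e3, ← e4, Polynomial.smul_eq_C_mul]; ring
  rw [e5, map_smul, ht i, smul_zero]

include h0 hne hlam in
/-- passing from a nonzero θ to an annihilating product -/
lemma ann_of_theta (hs : s ≤ d) (hsum : ∑ i, lam i = s)
    (hf : Ann d f (∏ i, lin (b i) (c i) ^ lam i) (d - s)) (θ : Polynomial ℝ)
    (hθ : θ.natDegree ≤ d - s) (hθ0 : θ ≠ 0)
    (ht : Ann d f ((∏ i, lin (b i) (c i) ^ (lam i - 1)) * θ) (Fintype.card ι)) :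
    ∃ J : Finset ι, J.card ≤ d - s ∧
      Ann d f (∏ i, lin (b i) (c i) ^ (lam i - 1 + if i ∈ J then 1 else 0))
        (d - ∑ i, (lam i - 1 + if i ∈ J then 1 else 0)) := by
  let J : Finset ι := Finset.univ.filter fun i => heval (d - s) (-c i) (b i) θ = 0
  have hJ : J.card ≤ d - s := by
    by_contra hlt
    push Not at hlt
    exact hθ0 (eq_zero_of_vanish J b c (fun i _ => h0 i) (fun i _ j _ => hne i j) _ hlt θ hθ
      (fun j hj => (Finset.mem_filter.1 hj).2))
  refine ⟨J, hJ, ?_⟩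
  have hdJ : d - s = (d - s - J.card) + J.card := by omega
  obtain ⟨θ0, hθ0d, hθe⟩ := prod_lin_dvd J b c (fun i _ => h0 i) (fun i _ j _ => hne i j) (d - s - J.card) θ
    (by rw [← hdJ]; exact hθ) (fun j hj => by rw [← hdJ]; exact (Finset.mem_filter.1 hj).2)
  have hnv : ∀ i ∈ Jᶜ, heval (d - s - J.card) (-c i) (b i) θ0 ≠ 0 := by
    intro i hi h
    rw [Finset.mem_compl] at hi
    apply hi
    refine Finset.mem_filter.2 ⟨Finset.mem_univ _, ?_⟩
    rw [hdJ, hθe, add_comm, heval_mul _ _ _ _ (natDegree_prod_lin_le' _ _ _) hθ0d, h, mul_zero]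
  have hcompl : Jᶜ.card + J.card = Fintype.card ι := by
    rw [add_comm]; exact Finset.card_add_card_compl J
  have hsumJ : ∑ i, (lam i - 1 + if i ∈ J then 1 else 0) + Fintype.card ι = s + J.card := by
    have h1 : ∑ i, (lam i - 1) + Fintype.card ι = s := by
      rw [← hsum, ← Finset.card_univ, Finset.card_eq_sum_ones, ← Finset.sum_add_distrib]
      exact Finset.sum_congr rfl fun i _ => Nat.sub_add_cancel (hlam i)
    rw [Finset.sum_add_distrib, ← h1]
    simp
    omega
  intro H hH
  have hdeg : d - ∑ i, (lam i - 1 + if i ∈ J then 1 else 0) = (d - s - J.card) + Fintype.card ι := by omega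
  rw [hdeg] at hH
  obtain ⟨α, hα⟩ := lagrange Jᶜ b c h0 hne J.card
    (fun k => heval (d - s - J.card + Fintype.card ι) (-c k) (b k) H / heval (d - s - J.card) (-c k) (b k) θ0)
  set S := ∑ i ∈ Jᶜ, Polynomial.C (α i) * ((∏ j ∈ Jᶜ.erase i, lin (b j) (c j)) *
    lin (-c i) (b i) ^ (J.card+1)) with hS
  have hSd : S.natDegree ≤ Fintype.card ι := by
    rw [← hcompl]; exact natDegree_lagr Jᶜ b c J.card α
  have hdd : d - s - J.card + Fintype.card ι = (d - s) + Jᶜ.card := by omega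
  obtain ⟨Q, hQ, hqS⟩ := prod_lin_dvd Jᶜ b c (fun i _ => h0 i) (fun i _ j _ => hne i j) (d - s)
    (H - θ0 * S) (by
      rw [← hdd]
      exact (Polynomial.natDegree_sub_le _ _).trans (max_le hH (Polynomial.natDegree_mul_le.trans (by omega))))
    (by
      intro k hk
      have := hα k hk
      rw [← hdd, map_sub, heval_mul _ _ _ _ hθ0d hSd, ← hcompl, this, hcompl,
        mul_div_cancel₀ _ (hnv k hk), sub_self])
  have hH' : H = θ0 * S + (∏ j ∈ Jᶜ, lin (b j) (c j)) * Q := by rw [← hqS]; ring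
  have eJ : ∏ i, lin (b i) (c i) ^ (lam i - 1 + if i ∈ J then 1 else 0) =
      (∏ i, lin (b i) (c i) ^ (lam i - 1)) * ∏ j ∈ J, lin (b j) (c j) := by
    simp only [pow_add, Finset.prod_mul_distrib, pow_ite, pow_one, pow_zero]
    simp
  have eJ2 : (∏ j ∈ J, lin (b j) (c j)) * (∏ j ∈ Jᶜ, lin (b j) (c j)) = ∏ j, lin (b j) (c j) :=
    Finset.prod_mul_prod_compl J _
  have hprod : (∏ i, lin (b i) (c i) ^ (lam i - 1)) * ∏ i, lin (b i) (c i) = ∏ i, lin (b i) (c i) ^ lam i := by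
    rw [← Finset.prod_mul_distrib]
    refine Finset.prod_congr rfl fun i _ => ?_
    rw [← pow_succ, Nat.sub_add_cancel (hlam i)]
  have e1 : (∏ i, lin (b i) (c i) ^ (lam i - 1 + if i ∈ J then 1 else 0)) * H =
      ((∏ i, lin (b i) (c i) ^ (lam i - 1)) * θ) * S + (∏ i, lin (b i) (c i) ^ lam i) * Q := by
    rw [eJ, hH', hθe, ← hprod, ← eJ2]; ring
  rw [e1, map_add, ht S hSd, hf Q hQ, add_zero]

end Real1


section HDPsec
variable {𝕜 : Type} [NontriviallyNormedField 𝕜]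

def HDP (p : 𝕜 → Polynomial 𝕜) (p' : Polynomial 𝕜) (t : 𝕜) : Prop :=
  ∀ n, HasDerivAt (fun x => (p x).coeff n) (p'.coeff n) t

lemma HDP.const (p : Polynomial 𝕜) (t : 𝕜) : HDP (fun _ => p) 0 t := by
  intro n; simpa using hasDerivAt_const t (p.coeff n)

lemma HDP.mul {p q : 𝕜 → Polynomial 𝕜} {p' q' : Polynomial 𝕜} {t : 𝕜} (hp : HDP p p' t) (hq : HDP q q' t) :
    HDP (fun x => p x * q x) (p' * q t + p t * q') t := by
  intro n
  simp only [Polynomial.coeff_add, Polynomial.coeff_mul, ← Finset.sum_add_distrib]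
  exact HasDerivAt.fun_sum fun i _ => (hp _).mul (hq _)

lemma HDP.pow {p : 𝕜 → Polynomial 𝕜} {p' : Polynomial 𝕜} {t : 𝕜} (hp : HDP p p' t) (n : ℕ) :
    HDP (fun x => p x ^ n) (n * p t ^ (n - 1) * p') t := by
  induction n with
  | zero => simpa using HDP.const 1 t
  | succ n ih =>
    have := ih.mul hp
    simp only [pow_succ]
    convert this using 1
    rcases n with _ | n
    · simp
    · simp [pow_succ]; ring

lemma HDP.apL {p : 𝕜 → Polynomial 𝕜} {p' : Polynomial 𝕜} {t : 𝕜} (hp : HDP p p' t) (d : ℕ) (f : Fin (d+1) → 𝕜) :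
    HasDerivAt (fun x => apL d f (p x)) (apL d f p') t := by
  simp only [apL_apply]
  exact HasDerivAt.fun_sum fun i _ => (hp _).const_mul _

lemma HDP.lin (b c b' c' : 𝕜) : HDP (fun t => lin (b + t * b') (c + t * c')) (_root_.lin b' c') 0 := by
  intro n
  rcases n with _ | _ | n
  · simp only [coeff_lin_zero]
    simpa using ((hasDerivAt_id (0:𝕜)).mul_const b').const_add b
  · simp only [zero_add, coeff_lin_one]
    simpa using ((hasDerivAt_id (0:𝕜)).mul_const c').const_add c
  · have : ∀ x y : 𝕜, (_root_.lin x y).coeff (n+1+1) = 0 := fun x y =>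
      Polynomial.coeff_eq_zero_of_natDegree_lt (lt_of_le_of_lt (natDegree_lin_le _ _) (by omega))
    simp only [this]; exact hasDerivAt_const _ _

end HDPsec

section Interior
variable {ι : Type} [Fintype ι] [DecidableEq ι]
variable (b c : ι → ℝ) (h0 : ∀ i, (b i, c i) ≠ 0)
    (hne : ∀ i j, i ≠ j → b i * c j - b j * c i ≠ 0) (lam : ι → ℕ) (hlam : ∀ i, 1 ≤ lam i)
    (d s : ℕ) (f : Fin (d+1) → ℝ)

/-- perturbed product -/
def gpert (ε : ℝ) (w : ι → ℝ) : Polynomial ℝ :=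
  ∏ i, ∏ j ∈ Finset.range (lam i), lin (b i + (w i + ε * j) * (-c i)) (c i + (w i + ε * j) * b i)

lemma mem_Eset_of_fintype {κ : Type} [Fintype κ] (hκ : Fintype.card κ = s) (α u v : κ → ℝ)
    (hf : f = ∑ j, α j • powVec d (u j) (v j)) : f ∈ Eset d s := by
  let e : Fin s ≃ κ := (Fintype.equivFinOfCardEq hκ).symm
  refine ⟨α ∘ e, u ∘ e, v ∘ e, ?_⟩
  rw [hf]
  exact (Equiv.sum_comp e (fun j => α j • powVec d (u j) (v j))).symm

include h0 hne in
lemma mem_Eset_of_gpert (hs : s ≤ d) (hsum : ∑ i, lam i = s) :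
    ∃ δ > 0, ∀ (ε : ℝ) (w : ι → ℝ) (h : Fin (d+1) → ℝ), ε ≠ 0 → |ε| < δ → (∀ i, |w i| < δ) →
      Ann d h (gpert b c lam ε w) (d - s) → h ∈ Eset d s := by
  have hn : ∀ i, b i ^ 2 + c i ^ 2 ≠ 0 := by
    intro i h
    apply h0 i
    have h1 : b i = 0 := by nlinarith [sq_nonneg (b i), sq_nonneg (c i)]
    have h2 : c i = 0 := by nlinarith [sq_nonneg (b i), sq_nonneg (c i)]
    rw [h1, h2]; rfl
  -- small perturbations stay non proportional
  have hev : ∀ᶠ η in nhdsWithin (0:ℝ) (Set.Ioi 0), ∀ i j, i ≠ j → ∀ x y : ℝ, |x| ≤ η → |y| ≤ η →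
      (b i + x * (-c i)) * (c j + y * b j) - (b j + y * (-c j)) * (c i + x * b i) ≠ 0 := by
    simp only [Filter.eventually_all]
    intro i j hij
    have hcont : Continuous (fun p : ℝ × ℝ => (b i + p.1 * (-c i)) * (c j + p.2 * b j) - (b j + p.2 * (-c j)) * (c i + p.1 * b i)) := by
      fun_prop
    have h1 : ∀ᶠ p in nhds ((0:ℝ), (0:ℝ)), (b i + p.1 * (-c i)) * (c j + p.2 * b j) - (b j + p.2 * (-c j)) * (c i + p.1 * b i) ≠ 0 := by
      apply hcont.continuousAt.eventually_ne
      simpa using hne i j hij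
    obtain ⟨η, hη, hb⟩ := Metric.eventually_nhds_iff_ball.1 h1
    filter_upwards [Ioo_mem_nhdsGT hη] with η' hη' x y hx hy
    apply hb (x, y)
    rw [Metric.mem_ball, Prod.dist_eq, max_lt_iff, Real.dist_eq, Real.dist_eq]
    simp only [sub_zero]
    exact ⟨lt_of_le_of_lt hx hη'.2, lt_of_le_of_lt hy hη'.2⟩
  obtain ⟨η, hη, hηpos⟩ := (hev.and self_mem_nhdsWithin).exists
  have hηpos : 0 < η := hηpos
  refine ⟨η / (s + 1), by positivity, ?_⟩
  intro ε w h hε hεδ hw hann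
  let κ := Σ i, Fin (lam i)
  have hκ : Fintype.card κ = s := by simp [κ, hsum]
  let t : κ → ℝ := fun x => w x.1 + ε * (x.2 : ℕ)
  have ht : ∀ x, |t x| ≤ η := by
    intro x
    have h1 : ((x.2 : ℕ) : ℝ) ≤ s := by
      have h2 := x.2.2
      have h3 := Finset.single_le_sum (f := lam) (fun i _ => Nat.zero_le _) (Finset.mem_univ x.1)
      have : (x.2 : ℕ) ≤ s := by omega
      exact_mod_cast this
    calc |t x| ≤ |w x.1| + |ε * (x.2:ℕ)| := abs_add_le _ _
      _ = |w x.1| + |ε| * (x.2:ℕ) := by rw [abs_mul, Nat.abs_cast]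
      _ ≤ η / (s+1) + η / (s+1) * s := by
        gcongr
        exact (hw _).le
      _ = η := by field_simp; ring
  obtain ⟨α, hα⟩ := sylvester (ι := κ) (fun x => b x.1 + t x * (-c x.1)) (fun x => c x.1 + t x * b x.1)
    (by
      intro x hx
      have h1 := congrArg Prod.fst hx
      have h2 := congrArg Prod.snd hx
      simp only [Prod.fst_zero, Prod.snd_zero] at h1 h2
      apply hn x.1
      have : (1 + t x ^ 2) * (b x.1 ^ 2 + c x.1 ^ 2) = 0 := by
        linear_combination (b x.1 + t x * (-c x.1)) * h1 + (c x.1 + t x * b x.1) * h2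
      rcases mul_eq_zero.1 this with h | h
      · nlinarith [sq_nonneg (t x)]
      · exact h)
    (by
      rintro ⟨i, p⟩ ⟨j, q⟩ hxy
      by_cases hij : i = j
      · subst hij
        have hpq : (p:ℕ) ≠ q := by
          intro h; apply hxy; rw [Fin.ext h]
        have : ((p:ℕ):ℝ) ≠ (q:ℕ) := by exact_mod_cast hpq
        simp only [t]
        intro h
        have h2 : ε * ((q:ℕ) - (p:ℕ) : ℝ) * (b i ^ 2 + c i ^ 2) = 0 := by linear_combination h
        rcases mul_eq_zero.1 h2 with h | h
        · rcases mul_eq_zero.1 h with h | h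
          · exact hε h
          · exact this (by linarith)
        · exact hn i h
      · exact hη i j hij _ _ (ht _) (ht _))
    d (by rw [hκ]; exact hs) h (by
      rw [hκ]
      convert hann using 1
      rw [gpert, Fintype.prod_sigma]
      apply Finset.prod_congr rfl
      intro i _
      exact Fin.prod_univ_eq_prod_range (fun j => lin (b i + (w i + ε * j) * (-c i)) (c i + (w i + ε * j) * b i)) (lam i))
  exact mem_Eset_of_fintype d s h hκ α _ _ hα

include h0 hne hlam in
lemma mem_interior_Eset (hs : s ≤ d) (hsum : ∑ i, lam i = s)
    (hf : Ann d f (∏ i, lin (b i) (c i) ^ lam i) (d - s))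
    (hθ : ∀ θ : Polynomial ℝ, θ.natDegree ≤ d - s →
      Ann d f ((∏ i, lin (b i) (c i) ^ (lam i - 1)) * θ) (Fintype.card ι) → θ = 0) :
    f ∈ interior (Eset d s) := by
  let V := ℝ × (ι → ℝ) × (Fin (d+1) → ℝ)
  let W := Fin (d - s + 1) → ℝ
  let F : V → W := fun x m => apL d x.2.2 (gpert b c lam x.1 x.2.1 * Polynomial.X ^ (m:ℕ))
  have hFs : ContDiff ℝ 1 F := by
    rw [contDiff_pi]
    intro m
    refine SmP.apL (contDiff_snd.comp contDiff_snd) (SmP.mul (SmP.prod _ fun i => SmP.prod _ fun j => ?_) (SmP.const _))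
    have hw : ContDiff ℝ 1 (fun x : V => x.2.1 i) :=
      (contDiff_apply ℝ ℝ i).comp (contDiff_fst.comp contDiff_snd)
    have hε : ContDiff ℝ 1 (fun x : V => x.1) := contDiff_fst
    refine SmP.lin ?_ ?_
    · exact contDiff_const.add ((hw.add (hε.mul contDiff_const)).mul contDiff_const)
    · exact contDiff_const.add ((hw.add (hε.mul contDiff_const)).mul contDiff_const)
  let x0 : V := (0, 0, f)
  have hg0 : gpert b c lam 0 0 = ∏ i, lin (b i) (c i) ^ lam i := by
    simp [gpert]
  have hF0 : F x0 = 0 := by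
    funext m
    show apL d f (gpert b c lam 0 0 * _) = 0
    rw [hg0]
    exact (Ann_iff _ _ _ _).1 hf m
  have hFd : HasStrictFDerivAt F (fderiv ℝ F x0) x0 :=
    hFs.contDiffAt.hasStrictFDerivAt (by norm_num)
  set F' := fderiv ℝ F x0 with hF'
  let T : ι → Polynomial ℝ := fun i => (∏ j ∈ Finset.univ.erase i, lin (b j) (c j) ^ lam j) *
      (lin (b i) (c i) ^ (lam i - 1) * lin (-c i) (b i))
  have hpart : ∀ i m, F' (0, Pi.single i 1, 0) m = lam i * apL d f (T i * Polynomial.X ^ (m:ℕ)) := by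
    intro i m
    have hcurve : HasDerivAt (fun t : ℝ => ((0, Pi.single i t, f) : V)) ((0, Pi.single i 1, 0) : V) 0 := by
      refine (hasDerivAt_const _ _).prodMk (HasDerivAt.prodMk ?_ (hasDerivAt_const _ _))
      rw [hasDerivAt_pi]
      intro j
      by_cases hj : j = i
      · subst hj; simp only [Pi.single_eq_same]; exact hasDerivAt_id (0:ℝ)
      · simpa [Pi.single_eq_of_ne hj] using hasDerivAt_const (0:ℝ) (0:ℝ)
    have h1 : HasFDerivAt F F' ((fun t : ℝ => ((0, Pi.single i t, f) : V)) 0) := by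
      simpa [x0] using hFd.hasFDerivAt
    have h2 := h1.comp_hasDerivAt (0:ℝ) hcurve
    rw [hasDerivAt_pi] at h2
    have h3 := h2 m
    have h4 : HDP (fun t => (∏ j ∈ Finset.univ.erase i, lin (b j) (c j) ^ lam j) *
        lin (b i + t * (-c i)) (c i + t * b i) ^ lam i * Polynomial.X ^ (m:ℕ))
        (Polynomial.C (lam i : ℝ) * (T i * Polynomial.X ^ (m:ℕ))) 0 := by
      convert ((HDP.const (∏ j ∈ Finset.univ.erase i, lin (b j) (c j) ^ lam j) 0).mul
        ((HDP.lin (b i) (c i) (-c i) (b i)).pow (lam i))).mul (HDP.const (Polynomial.X ^ (m:ℕ)) 0) using 1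
      simp [T]
      ring
    have h5 := h4.apL d f
    rw [← Polynomial.smul_eq_C_mul, map_smul, smul_eq_mul] at h5
    refine (h3.unique (h5.congr_of_eventuallyEq (Filter.Eventually.of_forall fun t => ?_)))
    show apL d f (gpert b c lam 0 (Pi.single i t) * _) = _
    congr 2
    rw [gpert, ← Finset.prod_erase_mul _ _ (Finset.mem_univ i)]
    congr 1
    · apply Finset.prod_congr rfl
      intro j hj
      simp [Pi.single_eq_of_ne (Finset.ne_of_mem_erase hj)]
    · simp
  -- surjectivity in the w direction
  have hsurj : ∀ y : W, ∃ w : ι → ℝ, F' (0, w, 0) = y := by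
    let Lw : (ι → ℝ) →ₗ[ℝ] W := F'.toLinearMap.comp
      ((LinearMap.inr ℝ ℝ ((ι → ℝ) × (Fin (d+1) → ℝ))).comp (LinearMap.inl ℝ (ι → ℝ) (Fin (d+1) → ℝ)))
    have hLw : ∀ w, Lw w = F' (0, w, 0) := fun w => rfl
    have : LinearMap.range Lw = ⊤ := by
      by_contra hlt
      obtain ⟨φ, hφ0, hφ⟩ := Submodule.exists_le_ker_of_lt_top _ (lt_top_iff_ne_top.2 hlt)
      apply hφ0
      let θv : W := fun m => φ (Pi.single m 1)
      have hφe : ∀ y : W, φ y = ∑ m, θv m * y m := by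
        intro y
        conv_lhs => rw [← Finset.univ_sum_single y]
        rw [map_sum]
        apply Finset.sum_congr rfl
        intro m _
        have : Pi.single m (y m) = y m • (Pi.single m 1 : W) := by
          rw [← Pi.single_smul, smul_eq_mul, mul_one]
        rw [this, map_smul, smul_eq_mul, mul_comm]
      have hθ0 : toPoly (d - s) θv = 0 := by
        refine hθ _ (natDegree_toPoly_le _ _) (ann_of_tangent b c h0 hne lam hlam d s f hf _
          (natDegree_toPoly_le _ _) ?_)
        intro i
        have h1 : φ (Lw (Pi.single i 1)) = 0 := hφ ⟨_, rfl⟩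
        rw [hφe, hLw] at h1
        simp only [hpart] at h1
        have hl : (lam i : ℝ) ≠ 0 := by have := hlam i; positivity
        rw [toPoly, Finset.mul_sum, map_sum]
        apply mul_left_cancel₀ hl
        rw [mul_zero, ← h1, Finset.mul_sum]
        apply Finset.sum_congr rfl
        intro m _
        have e : (∏ j ∈ Finset.univ.erase i, lin (b j) (c j) ^ lam j) *
            (lin (b i) (c i) ^ (lam i - 1) * lin (-c i) (b i)) * (Polynomial.C (θv m) * Polynomial.X ^ (m:ℕ)) =
            θv m • (T i * Polynomial.X ^ (m:ℕ)) := by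
          rw [Polynomial.smul_eq_C_mul]; ring
        rw [e, map_smul, smul_eq_mul]
        ring
      have hθv : θv = 0 := toPoly_injective _ (by rw [hθ0, toPoly_zero])
      ext m
      rw [LinearMap.comp_apply]
      exact congrFun hθv m
    intro y
    obtain ⟨w, hw⟩ := LinearMap.range_eq_top.1 this y
    exact ⟨w, hw⟩
  let Φ : V → ℝ × (Fin (d+1) → ℝ) × W := fun x => (x.1, x.2.2, F x)
  let Φ' : V →L[ℝ] ℝ × (Fin (d+1) → ℝ) × W :=
    (ContinuousLinearMap.fst ℝ ℝ ((ι → ℝ) × (Fin (d+1) → ℝ))).prod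
      (((ContinuousLinearMap.snd ℝ (ι → ℝ) (Fin (d+1) → ℝ)).comp
        (ContinuousLinearMap.snd ℝ ℝ ((ι → ℝ) × (Fin (d+1) → ℝ)))).prod F')
  have hΦ : HasStrictFDerivAt Φ Φ' x0 :=
    (ContinuousLinearMap.hasStrictFDerivAt (ContinuousLinearMap.fst ℝ ℝ ((ι → ℝ) × (Fin (d+1) → ℝ)))).prodMk
      ((ContinuousLinearMap.hasStrictFDerivAt ((ContinuousLinearMap.snd ℝ (ι → ℝ) (Fin (d+1) → ℝ)).comp
        (ContinuousLinearMap.snd ℝ ℝ ((ι → ℝ) × (Fin (d+1) → ℝ))))).prodMk hFd)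
  have hΦr : Φ'.range = ⊤ := by
    rw [LinearMap.range_eq_top]
    rintro ⟨ε, h, y⟩
    obtain ⟨w, hw⟩ := hsurj (y - F' (ε, 0, h))
    refine ⟨(ε, w, h), ?_⟩
    have : ((ε, w, h) : V) = (ε, 0, h) + (0, w, 0) := by simp
    have h2 : F' (ε, w, h) = y := by rw [this, map_add, hw]; abel
    show (ε, h, F' (ε, w, h)) = _
    rw [h2]
  have hmap := hΦ.map_nhds_eq_of_surj hΦr
  obtain ⟨δ, hδ, hE⟩ := mem_Eset_of_gpert b c h0 hne lam d s hs hsum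
  have hU : {x : V | |x.1| < δ ∧ ∀ i, |x.2.1 i| < δ} ∈ nhds x0 := by
    have : Metric.ball x0 δ ⊆ {x : V | |x.1| < δ ∧ ∀ i, |x.2.1 i| < δ} := by
      intro x hx
      rw [Metric.mem_ball, dist_eq_norm, Prod.norm_def, max_lt_iff, Prod.norm_def, max_lt_iff] at hx
      have e1 : (x - x0).1 = x.1 := sub_zero x.1
      have e2 : (x - x0).2.1 = x.2.1 := sub_zero x.2.1
      rw [e1, e2] at hx
      refine ⟨hx.1, fun i => ?_⟩
      exact lt_of_le_of_lt (norm_le_pi_norm x.2.1 i) hx.2.1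
    exact Filter.mem_of_superset (Metric.ball_mem_nhds _ hδ) this
  have hV := Filter.image_mem_map (m := Φ) hU
  rw [hmap] at hV
  have hx0 : Φ x0 = (0, f, 0) := by simp [Φ, hF0]; exact ⟨rfl, rfl⟩
  rw [hx0, Metric.mem_nhds_iff] at hV
  obtain ⟨η, hη, hball⟩ := hV
  rw [mem_interior_iff_mem_nhds, Metric.mem_nhds_iff]
  refine ⟨η, hη, ?_⟩
  intro h hh
  have hin : ((η/2, h, 0) : ℝ × (Fin (d+1) → ℝ) × W) ∈ Metric.ball ((0, f, 0) : ℝ × (Fin (d+1) → ℝ) × W) η := by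
    rw [Metric.mem_ball, Prod.dist_eq, max_lt_iff, Prod.dist_eq, max_lt_iff]
    refine ⟨?_, hh, ?_⟩
    · rw [Real.dist_eq, sub_zero, abs_of_pos (by positivity)]; linarith
    · simpa using hη
  obtain ⟨⟨ε, w, h'⟩, ⟨hx1, hx2⟩, hx3⟩ := hball hin
  simp only [Φ, Prod.mk.injEq] at hx3
  obtain ⟨h1, h2, h3⟩ := hx3
  subst h2
  refine hE ε w h' (by rw [h1]; positivity) hx1 hx2 ((Ann_iff _ _ _ _).2 fun m => ?_)
  exact congrFun h3 m

end Interior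


lemma boundary_pt (d s : ℕ) (hs : s ≤ d) (f : Fin (d+1) → ℝ) (hcl : f ∈ closure (Eset d s))
    (hInt : f ∉ interior (Eset d s)) :
    ∃ (N : ℕ) (μ : Fin N → ℕ) (B C : Fin N → ℝ), (∀ j, 1 ≤ μ j) ∧ (∀ j, (B j, C j) ≠ 0) ∧
      Ann d f (∏ j, lin (B j) (C j) ^ μ j) (d - ∑ j, μ j) ∧ N + ∑ j, μ j ≤ d ∧
      (N + ∑ j, μ j = d → d - s ≤ N) := by
  have h1 : f ∈ AnnUnit d s :=
    closure_minimal (Eset_subset_AnnUnit d s hs) (isClosed_AnnUnit d s) hcl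
  obtain ⟨b, c, hbc, hann⟩ := h1
  obtain ⟨ι, _, _, B, C, lam, h0, hne, hlam, hsum, hf⟩ := exists_grouping d s f b c hbc hann
  have h2 : ∃ θ : Polynomial ℝ, θ.natDegree ≤ d - s ∧
      Ann d f ((∏ i, lin (B i) (C i) ^ (lam i - 1)) * θ) (Fintype.card ι) ∧ θ ≠ 0 := by
    by_contra hcon
    push Not at hcon
    exact hInt (mem_interior_Eset B C h0 hne lam hlam d s f hs hsum hf hcon)
  obtain ⟨θ, hθd, hθ, hθ0⟩ := h2
  obtain ⟨J, hJ, hA⟩ := ann_of_theta B C h0 hne lam hlam d s f hs hsum hf θ hθd hθ0 hθ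
  set μ : ι → ℕ := fun i => lam i - 1 + if i ∈ J then 1 else 0 with hμ
  let S := {i // μ i ≠ 0}
  let e : Fin (Fintype.card S) ≃ S := (Fintype.equivFin S).symm
  have hsumS : ∑ j, μ (e j) = ∑ i, μ i := by
    rw [Equiv.sum_comp e (fun x : S => μ x), ← Finset.sum_subtype (Finset.univ.filter fun i => μ i ≠ 0) (by simp) μ]
    apply Finset.sum_subset (Finset.filter_subset _ _)
    intro x _ hx
    simpa using hx
  have hprodS : ∏ j, lin (B (e j)) (C (e j)) ^ μ (e j) = ∏ i, lin (B i) (C i) ^ μ i := by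
    rw [Equiv.prod_comp e (fun x : S => lin (B x) (C x) ^ μ x),
      ← Finset.prod_subtype (Finset.univ.filter fun i => μ i ≠ 0) (by simp) (fun x => lin (B x) (C x) ^ μ x)]
    apply Finset.prod_subset (Finset.filter_subset _ _)
    intro x _ hx
    have : μ x = 0 := by simpa using hx
    rw [this, pow_zero]
  have hcardS : Fintype.card S ≤ Fintype.card ι := Fintype.card_subtype_le _
  have hJc : J.card ≤ Fintype.card ι := Finset.card_le_univ J
  have hsumJ : ∑ i, μ i + Fintype.card ι = s + J.card := by
    have h1 : ∑ i, (lam i - 1) + Fintype.card ι = s := by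
      rw [← hsum, ← Finset.card_univ, Finset.card_eq_sum_ones, ← Finset.sum_add_distrib]
      exact Finset.sum_congr rfl fun i _ => Nat.sub_add_cancel (hlam i)
    rw [hμ, Finset.sum_add_distrib, ← h1]
    simp
    omega
  refine ⟨Fintype.card S, fun j => μ (e j), fun j => B (e j), fun j => C (e j), ?_, fun j => h0 _, ?_, ?_, ?_⟩
  · intro j; exact Nat.one_le_iff_ne_zero.2 (e j).2
  · rw [hsumS, hprodS]; exact hA
  · rw [hsumS]; omega
  · rw [hsumS]; omega

/-! ### Complexification -/

lemma lin_map (u v : ℝ) : (lin u v).map Complex.ofRealHom = lin (u : ℂ) (v : ℂ) := by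
  simp [lin]

lemma apL_ofReal (d : ℕ) (f : Fin (d+1) → ℝ) (H : Polynomial ℝ) :
    apL d (fun i => (f i : ℂ)) (H.map Complex.ofRealHom) = ((apL d f H : ℝ) : ℂ) := by
  rw [apL_apply, apL_apply]
  push_cast
  apply Finset.sum_congr rfl
  intro i _
  rw [Polynomial.coeff_map]; rfl

lemma Ann_ofReal (d : ℕ) (f : Fin (d+1) → ℝ) (p : Polynomial ℝ) (r : ℕ) (h : Ann d f p r) :
    Ann d (fun i => (f i : ℂ)) (p.map Complex.ofRealHom) r := by
  rw [Ann_iff] at h ⊢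
  intro m
  have : p.map Complex.ofRealHom * Polynomial.X ^ (m:ℕ) = (p * Polynomial.X ^ (m:ℕ)).map Complex.ofRealHom := by
    simp
  rw [this, apL_ofReal, h m, Complex.ofReal_zero]

/-- forms annihilated by some product of powers -/
def GG (d N : ℕ) (μ : Fin N → ℕ) : Set (Fin (d+1) → ℂ) :=
  {f | ∃ u v : Fin N → ℂ, (∀ j, (u j, v j) ≠ 0) ∧ Ann d f (∏ j, lin (u j) (v j) ^ μ j) (d - ∑ j, μ j)}

lemma boundary_pt_complex (d s : ℕ) (hs : s ≤ d) (f : Fin (d+1) → ℝ) (hcl : f ∈ closure (Eset d s))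
    (hInt : f ∉ interior (Eset d s)) :
    ∃ (N : ℕ) (μ : Fin N → ℕ), (∀ j, 1 ≤ μ j) ∧ (fun i => (f i : ℂ)) ∈ GG d N μ ∧
      N + ∑ j, μ j ≤ d ∧ (N + ∑ j, μ j = d → d - s ≤ N) := by
  obtain ⟨N, μ, B, C, h1, h2, h3, h4, h5⟩ := boundary_pt d s hs f hcl hInt
  refine ⟨N, μ, h1, ⟨fun j => B j, fun j => C j, ?_, ?_⟩, h4, h5⟩
  · intro j h
    apply h2 j
    rw [Prod.ext_iff] at h ⊢
    simpa using h
  · have := Ann_ofReal _ _ _ _ h3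
    simpa [Polynomial.map_prod, lin_map] using this


section Gen
variable {σ : Type} [Fintype σ] [DecidableEq σ]

/-- generic product of powers of linear forms -/
def gprod {N : ℕ} (U V : Fin N → MvPolynomial σ ℂ) (μ : Fin N → ℕ) : Polynomial (MvPolynomial σ ℂ) :=
  ∏ j, (Polynomial.C (U j) + Polynomial.C (V j) * Polynomial.X) ^ μ j

lemma gprod_map {N : ℕ} (U V : Fin N → MvPolynomial σ ℂ) (μ : Fin N → ℕ) (x : σ → ℂ) :
    (gprod U V μ).map (eval x) = ∏ j, lin (eval x (U j)) (eval x (V j)) ^ μ j := by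
  simp [gprod, Polynomial.map_prod, lin]

def MM (d : ℕ) {N : ℕ} (U V : Fin N → MvPolynomial σ ℂ) (μ : Fin N → ℕ) :
    Matrix (Fin (d - ∑ j, μ j + 1)) (Fin (d+1)) (MvPolynomial σ ℂ) :=
  fun m i => C (((d - (i:ℕ)).factorial * (i:ℕ).factorial : ℕ) : ℂ) *
    (gprod U V μ * Polynomial.X ^ (m:ℕ)).coeff i

lemma evM_MM (d : ℕ) {N : ℕ} (U V : Fin N → MvPolynomial σ ℂ) (μ : Fin N → ℕ) (x : σ → ℂ) (m) (i) :
    evM (MM d U V μ) x m i = (((d - (i:ℕ)).factorial * (i:ℕ).factorial : ℕ) : ℂ) *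
      ((∏ j, lin (eval x (U j)) (eval x (V j)) ^ μ j) * Polynomial.X ^ (m:ℕ)).coeff i := by
  have : (∏ j, lin (eval x (U j)) (eval x (V j)) ^ μ j) * Polynomial.X ^ (m:ℕ) =
      (gprod U V μ * Polynomial.X ^ (m:ℕ)).map (eval x) := by
    rw [Polynomial.map_mul, gprod_map]; simp
  rw [this, Polynomial.coeff_map]
  simp [evM, MM]

lemma evM_mulVec (d : ℕ) {N : ℕ} (U V : Fin N → MvPolynomial σ ℂ) (μ : Fin N → ℕ) (x : σ → ℂ)
    (f : Fin (d+1) → ℂ) : (evM (MM d U V μ) x).mulVec f = 0 ↔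
      Ann d f (∏ j, lin (eval x (U j)) (eval x (V j)) ^ μ j) (d - ∑ j, μ j) := by
  rw [Ann_iff, funext_iff]
  apply forall_congr'
  intro m
  simp only [Matrix.mulVec, dotProduct, evM_MM, apL_apply, Pi.zero_apply]
  have : ∀ x y z : ℂ, x * y * z = x * z * y := fun x y z => by ring
  simp only [this]

lemma evM_li (d : ℕ) {N : ℕ} (U V : Fin N → MvPolynomial σ ℂ) (μ : Fin N → ℕ) (hμ : ∑ j, μ j ≤ d) (x : σ → ℂ) :
    LinearIndependent ℂ (fun a => evM (MM d U V μ) x a) ↔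
      (∏ j, lin (eval x (U j)) (eval x (V j)) ^ μ j) ≠ 0 := by
  constructor
  · intro h h0
    apply h.ne_zero 0
    funext i
    rw [evM_MM, h0]; simp
  · intro h
    rw [Fintype.linearIndependent_iff]
    intro g hg
    have h1 : (∏ j, lin (eval x (U j)) (eval x (V j)) ^ μ j) * toPoly _ g = 0 := by
      have hd : ((∏ j, lin (eval x (U j)) (eval x (V j)) ^ μ j) * toPoly _ g).natDegree ≤ d := by
        refine Polynomial.natDegree_mul_le.trans ?_
        have h1 := natDegree_prod_lin_le Finset.univ (fun j => eval x (U j)) (fun j => eval x (V j)) μ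
        have h2 := natDegree_toPoly_le _ g
        omega
      rw [← toPoly_coeff d _ hd]
      convert toPoly_zero d using 2
      funext i
      have h3 := congrFun hg i
      simp only [Finset.sum_apply, Pi.smul_apply, evM_MM, smul_eq_mul, Pi.zero_apply] at h3
      have hA : (((d - (i:ℕ)).factorial * (i:ℕ).factorial : ℕ) : ℂ) ≠ 0 := by
        exact_mod_cast (Nat.mul_pos (Nat.factorial_pos _) (Nat.factorial_pos _)).ne'
      apply mul_left_cancel₀ hA
      rw [Pi.zero_apply, mul_zero, ← h3, toPoly, Finset.mul_sum, Polynomial.finset_sum_coeff, Finset.mul_sum]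
      apply Finset.sum_congr rfl
      intro m _
      rw [mul_left_comm _ (Polynomial.C (g m)), Polynomial.coeff_C_mul]
      ring
    have h2 : toPoly _ g = 0 := (mul_eq_zero.1 h1).resolve_left h
    intro m
    rw [← coeff_toPoly _ g m, h2]; simp

lemma mem_kerFam_MM (d : ℕ) {N : ℕ} (U V : Fin N → MvPolynomial σ ℂ) (μ : Fin N → ℕ) (hμ : ∑ j, μ j ≤ d)
    (P : (σ → ℂ) → Prop) (f : Fin (d+1) → ℂ) : f ∈ kerFam (MM d U V μ) P ↔
      ∃ x, (∏ j, lin (eval x (U j)) (eval x (V j)) ^ μ j) ≠ 0 ∧ P x ∧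
        Ann d f (∏ j, lin (eval x (U j)) (eval x (V j)) ^ μ j) (d - ∑ j, μ j) := by
  unfold kerFam
  simp only [Set.mem_setOf_eq, evM_li d U V μ hμ, evM_mulVec]

end Gen

lemma prod_lin_ne_zero {N : ℕ} {μ : Fin N → ℕ} {u v : Fin N → ℂ} (h : ∀ j, (u j, v j) ≠ 0) :
    (∏ j, lin (u j) (v j) ^ μ j) ≠ 0 :=
  Finset.prod_ne_zero_iff.2 fun j _ => pow_ne_zero _ (lin_ne_zero (h j))

lemma ne_zero_of_prod_lin {N : ℕ} {μ : Fin N → ℕ} (hμ : ∀ j, 1 ≤ μ j) {u v : Fin N → ℂ}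
    (h : (∏ j, lin (u j) (v j) ^ μ j) ≠ 0) : ∀ j, (u j, v j) ≠ 0 := by
  intro j hj
  rw [Finset.prod_ne_zero_iff] at h
  apply h j (Finset.mem_univ _)
  have h1 : u j = 0 := congrArg Prod.fst hj
  have h2 : v j = 0 := congrArg Prod.snd hj
  rw [h1, h2, lin]
  simp
  have := hμ j; omega

abbrev hU (N : ℕ) : Fin N → MvPolynomial (Fin N × Fin 2) ℂ := fun j => X (j, 0)
abbrev hV (N : ℕ) : Fin N → MvPolynomial (Fin N × Fin 2) ℂ := fun j => X (j, 1)

lemma GG_eq (d N : ℕ) (μ : Fin N → ℕ) (hμ1 : ∀ j, 1 ≤ μ j) (hμ : ∑ j, μ j ≤ d) :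
    GG d N μ = kerFam (MM d (hU N) (hV N) μ) (fun _ => True) := by
  ext f
  rw [mem_kerFam_MM d _ _ μ hμ]
  constructor
  · rintro ⟨u, v, h1, h2⟩
    refine ⟨fun x => if x.2 = 0 then u x.1 else v x.1, ?_, trivial, ?_⟩
    · simpa using prod_lin_ne_zero h1
    · simpa using h2
  · rintro ⟨x, h1, _, h2⟩
    exact ⟨_, _, ne_zero_of_prod_lin hμ1 h1, h2⟩

lemma GG_irreducible (d N : ℕ) (μ : Fin N → ℕ) (hμ1 : ∀ j, 1 ≤ μ j) (hμ : ∑ j, μ j ≤ d) :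
    zIrreducible (GG d N μ) := by
  rw [GG_eq d N μ hμ1 hμ]
  apply kerFam_irreducible
  refine ⟨fun _ => 1, ?_⟩
  rw [evM_li d _ _ μ hμ]
  apply prod_lin_ne_zero
  intro j h
  have := congrArg Prod.fst h
  simp at this

abbrev cU {N : ℕ} (ε : Fin N → Bool) : Fin N → MvPolynomial (Fin N) ℂ := fun j => if ε j then 1 else X j
abbrev cV {N : ℕ} (ε : Fin N → Bool) : Fin N → MvPolynomial (Fin N) ℂ := fun j => if ε j then X j else 1

lemma Ann_C_mul {K : Type} [Field K] {d : ℕ} {f : Fin (d+1) → K} {p : Polynomial K} {r : ℕ} {t : K} (ht : t ≠ 0) :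
    Ann d f (Polynomial.C t * p) r ↔ Ann d f p r := by
  have h : ∀ q, apL d f (Polynomial.C t * p * q) = t * apL d f (p * q) := by
    intro q
    rw [mul_assoc, ← Polynomial.smul_eq_C_mul, map_smul, smul_eq_mul]
  unfold Ann
  simp only [h, mul_eq_zero, ht, false_or]

lemma GG_charts (d N : ℕ) (μ : Fin N → ℕ) (hμ : ∑ j, μ j ≤ d) :
    GG d N μ ⊆ ⋃ ε ∈ (Finset.univ : Finset (Fin N → Bool)), kerFam (MM d (cU ε) (cV ε) μ) (fun _ => True) := by
  classical
  rintro f ⟨u, v, h1, h2⟩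
  simp only [Finset.mem_univ, Set.iUnion_true, Set.mem_iUnion]
  refine ⟨fun j => decide (u j ≠ 0), ?_⟩
  rw [mem_kerFam_MM d _ _ μ hμ]
  let x : Fin N → ℂ := fun j => if u j = 0 then 0 else v j / u j
  let t : Fin N → ℂ := fun j => if u j = 0 then v j else u j
  have ht : ∀ j, t j ≠ 0 := by
    intro j h
    simp only [t] at h
    split_ifs at h with hu
    · exact h1 j (by rw [hu, h]; rfl)
    · exact hu h
  have hl : ∀ j, lin (u j) (v j) = Polynomial.C (t j) *
      lin (eval x (cU (fun j => decide (u j ≠ 0)) j)) (eval x (cV (fun j => decide (u j ≠ 0)) j)) := by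
    intro j
    by_cases hu : u j = 0
    · have e1 : eval x (cU (fun j => decide (u j ≠ 0)) j) = 0 := by simp [cU, hu, x]
      have e2 : eval x (cV (fun j => decide (u j ≠ 0)) j) = 1 := by simp [cV, hu, x]
      rw [e1, e2]
      simp [lin, t, hu]
    · have e1 : eval x (cU (fun j => decide (u j ≠ 0)) j) = 1 := by simp [cU, hu, x]
      have e2 : eval x (cV (fun j => decide (u j ≠ 0)) j) = v j / u j := by simp [cV, hu, x]
      have e3 : t j = u j := by simp [t, hu]
      rw [e1, e2, e3, lin, lin, mul_add, ← mul_assoc, ← map_mul, ← map_mul, mul_div_cancel₀ _ hu, mul_one]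
  have hprod : ∏ j, lin (u j) (v j) ^ μ j = Polynomial.C (∏ j, t j ^ μ j) *
     ∏ j, lin (eval x (cU (fun j => decide (u j ≠ 0)) j)) (eval x (cV (fun j => decide (u j ≠ 0)) j)) ^ μ j := by
    rw [map_prod, ← Finset.prod_mul_distrib]
    refine Finset.prod_congr rfl fun j _ => ?_
    rw [hl j, mul_pow, map_pow]
  have htp : (∏ j, t j ^ μ j) ≠ 0 := Finset.prod_ne_zero_iff.2 fun j _ => pow_ne_zero _ (ht j)
  refine ⟨x, ?_, trivial, ?_⟩
  · have := prod_lin_ne_zero (μ := μ) h1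
    rw [hprod] at this
    exact right_ne_zero_of_mul this
  · rw [hprod, Ann_C_mul htp] at h2
    exact h2

lemma GG_thin (d N : ℕ) (μ : Fin N → ℕ) (h : N + ∑ j, μ j < d) : Thin (GG d N μ) := by
  classical
  refine Thin.mono (Thin.biUnion _ _ fun ε _ => ?_) (GG_charts d N μ (by omega))
  intro j
  obtain ⟨c, hc, hcv, hc0⟩ := kerFam_small (MM d (cU ε) (cV ε) μ) (Finset.univ.erase j) (by
    rw [Finset.card_erase_of_mem (Finset.mem_univ j)]
    simp
    omega)
  refine ⟨c, hc, fun hj => ?_, hc0⟩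
  exact Finset.notMem_erase j _ (hcv hj)

lemma GG_hyper (d N : ℕ) (μ : Fin N → ℕ) (h : N + ∑ j, μ j ≤ d) :
    ∃ c : MvPolynomial (Fin (d+1)) ℂ, c ≠ 0 ∧ ∀ f ∈ GG d N μ, eval f c = 0 := by
  classical
  have : ∀ ε : Fin N → Bool, ∃ c : MvPolynomial (Fin (d+1)) ℂ, c ≠ 0 ∧
      ∀ f ∈ kerFam (MM d (cU ε) (cV ε) μ) (fun _ => True), eval f c = 0 := by
    intro ε
    obtain ⟨c, hc, hcv, hc0⟩ := kerFam_small (MM d (cU ε) (cV ε) μ) Finset.univ (by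
      simp
      omega)
    exact ⟨c, hc, hc0⟩
  choose c hc hc0 using this
  refine ⟨∏ ε, c ε, Finset.prod_ne_zero_iff.2 fun ε _ => hc ε, ?_⟩
  intro f hf
  have := GG_charts d N μ (by omega) hf
  simp only [Set.mem_iUnion] at this
  obtain ⟨ε, _, hε⟩ := this
  rw [map_prod]
  exact Finset.prod_eq_zero (Finset.mem_univ ε) (hc0 ε f hε)


lemma hasDerivAt_eval {σ : Type} [Fintype σ] [DecidableEq σ] (p : MvPolynomial σ ℂ) (a : ℂ → σ → ℂ) (a' : σ → ℂ)
    (t : ℂ) (h : ∀ i, HasDerivAt (fun s => a s i) (a' i) t) :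
    HasDerivAt (fun s => eval (a s) p) (∑ i, eval (a t) (pderiv i p) * a' i) t := by
  induction p using MvPolynomial.induction_on with
  | C c => simpa using hasDerivAt_const t c
  | add p q hp hq =>
    simp only [map_add, add_mul, Finset.sum_add_distrib]
    exact hp.add hq
  | mul_X p j hp =>
    have h1 := hp.mul (h j)
    simp only [map_mul, eval_X, pderiv_mul, map_add, pderiv_X]
    refine HasDerivAt.congr_deriv h1 ?_
    simp only [add_mul, Finset.sum_add_distrib, Finset.sum_mul]
    congr 1
    · exact Finset.sum_congr rfl fun i _ => by ring
    · rw [Finset.sum_eq_single j]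
      · simp
      · intro i _ hi
        simp [Pi.single_apply, hi.symm]
      · simp

lemma span_T {m : ℕ} (hm : 1 ≤ m) (b c : Fin m → ℂ) (h0 : ∀ j, (b j, c j) ≠ 0)
    (hne : ∀ j k, j ≠ k → b j * c k - b k * c j ≠ 0) (W : Submodule ℂ (Polynomial ℂ))
    (hW : ∀ j n0 n1, (∏ k ∈ Finset.univ.erase j, lin (b k) (c k)) * lin n0 n1 ∈ W) :
    ∀ H : Polynomial ℂ, H.natDegree ≤ m → H ∈ W := by
  intro H hH
  have hn : ∀ j, ∃ n : ℂ × ℂ, n.1 * (-c j) + n.2 * b j = 1 := by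
    intro j
    by_cases hb : b j = 0
    · have hc : c j ≠ 0 := fun hc => h0 j (by rw [hb, hc]; rfl)
      exact ⟨(-(c j)⁻¹, 0), by field_simp; simp⟩
    · exact ⟨(0, (b j)⁻¹), by simp [hb]⟩
  choose n hn using hn
  have hcard : ∀ j : Fin m, (Finset.univ.erase j).card + 1 = m := by
    intro j
    rw [Finset.card_erase_of_mem (Finset.mem_univ j)]; simp; omega
  let E : Fin m → Polynomial ℂ := fun j => (∏ k ∈ Finset.univ.erase j, lin (b k) (c k)) * lin (n j).1 (n j).2
  have hE : ∀ j k, heval m (-c k) (b k) (E j) =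
      (∏ l ∈ Finset.univ.erase j, (b l * (-c k) + c l * b k)) * ((n j).1 * (-c k) + (n j).2 * b k) := by
    intro j k
    conv_lhs => rw [← hcard j]
    rw [heval_mul _ _ _ _ (natDegree_prod_lin_le' _ _ _) (natDegree_lin_le _ _), heval_prod_lin, heval_lin]
  have hEd : ∀ j, (E j).natDegree ≤ m := by
    intro j
    refine Polynomial.natDegree_mul_le.trans ?_
    have h1 := natDegree_prod_lin_le' (Finset.univ.erase j) b c
    have h2 := natDegree_lin_le (n j).1 (n j).2
    have := hcard j
    omega
  have hEjj : ∀ j, heval m (-c j) (b j) (E j) ≠ 0 := by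
    intro j
    rw [hE, hn, mul_one, Finset.prod_ne_zero_iff]
    intro l hl h
    apply hne l j (Finset.ne_of_mem_erase hl)
    linear_combination -h
  have hEjk : ∀ j k, j ≠ k → heval m (-c k) (b k) (E j) = 0 := by
    intro j k hjk
    rw [hE, Finset.prod_eq_zero (i := k) (by simp [hjk.symm]) (by ring), zero_mul]
  let S : Polynomial ℂ := ∑ j, (heval m (-c j) (b j) H / heval m (-c j) (b j) (E j)) • E j
  have hSd : S.natDegree ≤ m := Polynomial.natDegree_sum_le_of_forall_le _ _ fun j _ =>
    (Polynomial.natDegree_smul_le _ _).trans (hEd j)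
  have hSW : S ∈ W := W.sum_mem fun j _ => W.smul_mem _ (hW j _ _)
  obtain ⟨Q, hQ, hHS⟩ := prod_lin_dvd Finset.univ b c (fun j _ => h0 j) (fun j _ k _ => hne j k) 0 (H - S)
    (by
      simp only [Finset.card_univ, Fintype.card_fin, zero_add]
      exact (Polynomial.natDegree_sub_le _ _).trans (max_le hH hSd)) (by
      intro k _
      simp only [Finset.card_univ, Fintype.card_fin, zero_add]
      rw [map_sub, map_sum, Finset.sum_eq_single k]
      · rw [map_smul, smul_eq_mul, div_mul_cancel₀ _ (hEjj k), sub_self]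
      · intro j _ hj
        rw [map_smul, hEjk j k hj, smul_zero]
      · simp)
  have hQ' : Q = Polynomial.C (Q.coeff 0) := Polynomial.eq_C_of_natDegree_le_zero hQ
  have h1 : H = S + (Q.coeff 0) • ∏ j, lin (b j) (c j) := by
    rw [Polynomial.smul_eq_C_mul, ← hQ', mul_comm, ← hHS]; ring
  rw [h1]
  refine W.add_mem hSW (W.smul_mem _ ?_)
  let j0 : Fin m := ⟨0, by omega⟩
  rw [← Finset.prod_erase_mul _ _ (Finset.mem_univ j0)]
  exact hW j0 _ _

section Dual
variable {d m : ℕ} {ρ : Fin m → ℕ}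

lemma mem_crl_iff (hρ : ∑ j, ρ j = d) (a : Fin (d+1) → ℂ) : a ∈ crlCone d m ρ ↔
    ∃ (t : ℂ) (u v : Fin m → ℂ), toPoly d a = Polynomial.C t * ∏ j, lin (u j) (v j) ^ ρ j := by
  unfold crlCone
  simp only [Set.mem_setOf_eq, binForm_eq_prod_iff _ _ _ ρ hρ]

/-- the point of the cone with given parameters -/
def crlPt (d : ℕ) (ρ : Fin m → ℕ) (t : ℂ) (u v : Fin m → ℂ) : Fin (d+1) → ℂ :=
  fun i => (Polynomial.C t * ∏ j, lin (u j) (v j) ^ ρ j).coeff i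

lemma toPoly_crlPt (hρ : ∑ j, ρ j = d) (t : ℂ) (u v : Fin m → ℂ) :
    toPoly d (crlPt d ρ t u v) = Polynomial.C t * ∏ j, lin (u j) (v j) ^ ρ j := by
  apply toPoly_coeff
  refine (Polynomial.natDegree_C_mul_le _ _).trans ?_
  rw [← hρ]
  exact natDegree_prod_lin_le _ _ _ _

lemma crlPt_mem (hρ : ∑ j, ρ j = d) (t : ℂ) (u v : Fin m → ℂ) : crlPt d ρ t u v ∈ crlCone d m ρ := by
  rw [mem_crl_iff hρ]
  exact ⟨t, u, v, toPoly_crlPt hρ t u v⟩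

lemma tangent_one (hρ : ∑ j, ρ j = d) (p : MvPolynomial (Fin (d+1)) ℂ) (hp : ∀ y ∈ crlCone d m ρ, eval y p = 0)
    (t : ℂ) (u v : Fin m → ℂ) (j : Fin m) (n0 n1 : ℂ) :
    ∑ i : Fin (d+1), eval (crlPt d ρ t u v) (pderiv i p) *
      (Polynomial.C t * ((ρ j * lin (u j) (v j) ^ (ρ j - 1) * lin n0 n1) *
        ∏ k ∈ Finset.univ.erase j, lin (u k) (v k) ^ ρ k)).coeff i = 0 := by
  let U : ℂ → Fin m → ℂ := fun s => Function.update u j (u j + s * n0)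
  let V : ℂ → Fin m → ℂ := fun s => Function.update v j (v j + s * n1)
  have hU0 : U 0 = u := by simp [U]
  have hV0 : V 0 = v := by simp [V]
  have hprod : ∀ s, ∏ k, lin (U s k) (V s k) ^ ρ k = lin (u j + s * n0) (v j + s * n1) ^ ρ j *
      ∏ k ∈ Finset.univ.erase j, lin (u k) (v k) ^ ρ k := by
    intro s
    rw [← Finset.mul_prod_erase _ _ (Finset.mem_univ j)]
    congr 1
    · simp [U, V]
    · refine Finset.prod_congr rfl fun k hk => ?_
      have := Finset.ne_of_mem_erase hk
      simp [U, V, this]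
  have h1 : HDP (fun s => Polynomial.C t * ∏ k, lin (U s k) (V s k) ^ ρ k)
     (Polynomial.C t * ((ρ j * lin (u j) (v j) ^ (ρ j - 1) * lin n0 n1) *
        ∏ k ∈ Finset.univ.erase j, lin (u k) (v k) ^ ρ k)) 0 := by
    simp only [hprod]
    have := (HDP.const (Polynomial.C t) 0).mul ((((HDP.lin (u j) (v j) n0 n1).pow (ρ j)).mul
      (HDP.const (∏ k ∈ Finset.univ.erase j, lin (u k) (v k) ^ ρ k) 0)))
    convert this using 1
    simp
  have h2 := hasDerivAt_eval p (fun s => crlPt d ρ t (U s) (V s)) _ 0 (fun i => h1 i)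
  simp only [hU0, hV0] at h2
  have h3 : (fun s => eval (crlPt d ρ t (U s) (V s)) p) = fun _ => 0 := by
    funext s
    exact hp _ (crlPt_mem hρ _ _ _)
  rw [h3] at h2
  exact h2.unique (hasDerivAt_const _ _)

lemma tangent_distinct (hρ : ∑ j, ρ j = d) (hρ2 : ∀ j, 2 ≤ ρ j) (hm : 1 ≤ m) (p : MvPolynomial (Fin (d+1)) ℂ) (hp : ∀ y ∈ crlCone d m ρ, eval y p = 0)
    (t : ℂ) (ht : t ≠ 0) (u v : Fin m → ℂ) (h0 : ∀ j, (u j, v j) ≠ 0)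
    (hne : ∀ j k, j ≠ k → u j * v k - u k * v j ≠ 0) (H : Polynomial ℂ) (hH : H.natDegree ≤ m) :
    ∑ i : Fin (d+1), eval (crlPt d ρ t u v) (pderiv i p) *
      ((∏ k, lin (u k) (v k) ^ (ρ k - 1)) * H).coeff i = 0 := by
  let Λ : Polynomial ℂ →ₗ[ℂ] ℂ := (∑ i : Fin (d+1), (eval (crlPt d ρ t u v) (pderiv i p)) • Polynomial.lcoeff ℂ i) ∘ₗ
    LinearMap.mulLeft ℂ (∏ k, lin (u k) (v k) ^ (ρ k - 1))
  have hΛ : ∀ H, Λ H = ∑ i : Fin (d+1), eval (crlPt d ρ t u v) (pderiv i p) *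
      ((∏ k, lin (u k) (v k) ^ (ρ k - 1)) * H).coeff i := by
    intro H
    simp [Λ, LinearMap.sum_apply]
  rw [← hΛ]
  refine span_T hm u v h0 hne (LinearMap.ker Λ) ?_ H hH
  intro j n0 n1
  rw [LinearMap.mem_ker, hΛ]
  have h1 := tangent_one hρ p hp t u v j n0 n1
  have h2 : Polynomial.C t * ((ρ j * lin (u j) (v j) ^ (ρ j - 1) * lin n0 n1) *
        ∏ k ∈ Finset.univ.erase j, lin (u k) (v k) ^ ρ k) = Polynomial.C (t * ρ j) *
        ((∏ k, lin (u k) (v k) ^ (ρ k - 1)) *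
        ((∏ k ∈ Finset.univ.erase j, lin (u k) (v k)) * lin n0 n1)) := by
    have h3 : ∏ k ∈ Finset.univ.erase j, lin (u k) (v k) ^ ρ k =
      (∏ k ∈ Finset.univ.erase j, lin (u k) (v k) ^ (ρ k - 1)) * ∏ k ∈ Finset.univ.erase j, lin (u k) (v k) := by
      rw [← Finset.prod_mul_distrib]
      refine Finset.prod_congr rfl fun k _ => ?_
      rw [← pow_succ, Nat.sub_add_cancel (by have := hρ2 k; omega)]
    rw [h3, ← Finset.mul_prod_erase _ _ (Finset.mem_univ j), map_mul]
    simp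
    ring
  rw [h2] at h1
  simp only [Polynomial.coeff_C_mul] at h1
  have h4 : (t * ρ j) * ∑ i : Fin (d+1), eval (crlPt d ρ t u v) (pderiv i p) *
      ((∏ k, lin (u k) (v k) ^ (ρ k - 1)) * ((∏ k ∈ Finset.univ.erase j, lin (u k) (v k)) * lin n0 n1)).coeff i = 0 := by
    rw [← h1, Finset.mul_sum]
    exact Finset.sum_congr rfl fun i _ => by ring
  refine (mul_eq_zero.1 h4).resolve_left (mul_ne_zero ht ?_)
  have := hρ2 j
  exact_mod_cast (by omega : ρ j ≠ 0)

/-- parametrisation with fixed scalar -/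
def Apar (d : ℕ) (ρ : Fin m → ℕ) (t : ℂ) : Fin (d+1) → MvPolynomial (Fin m × Fin 2) ℂ :=
  fun i => C t * (gprod (hU m) (hV m) ρ).coeff i

lemma eval_Apar (t : ℂ) (x : Fin m × Fin 2 → ℂ) :
    (fun i => eval x (Apar d ρ t i)) = crlPt d ρ t (fun j => x (j,0)) (fun j => x (j,1)) := by
  funext i
  have := gprod_map (hU m) (hV m) ρ x
  simp only [hU, hV, eval_X] at this
  rw [crlPt, ← this, Polynomial.coeff_C_mul, Polynomial.coeff_map]
  simp [Apar]

lemma tangent_all (hρ : ∑ j, ρ j = d) (hρ2 : ∀ j, 2 ≤ ρ j) (hm : 1 ≤ m) (p : MvPolynomial (Fin (d+1)) ℂ) (hp : ∀ y ∈ crlCone d m ρ, eval y p = 0)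
    (t : ℂ) (ht : t ≠ 0) (u v : Fin m → ℂ) (H : Polynomial ℂ) (hH : H.natDegree ≤ m) :
    ∑ i : Fin (d+1), eval (crlPt d ρ t u v) (pderiv i p) *
      ((∏ k, lin (u k) (v k) ^ (ρ k - 1)) * H).coeff i = 0 := by
  classical
  let R : MvPolynomial (Fin m × Fin 2) ℂ := ∑ i : Fin (d+1), aeval (Apar d ρ t) (pderiv i p) *
    (gprod (hU m) (hV m) (fun k => ρ k - 1) * H.map C).coeff i
  let Disc : MvPolynomial (Fin m × Fin 2) ℂ := (∏ j, X (j,0)) * ∏ j, ∏ k ∈ Finset.univ.erase j,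
    (X (j,0) * X (k,1) - X (k,0) * X (j,1))
  have hR : ∀ x : Fin m × Fin 2 → ℂ, eval x R = ∑ i : Fin (d+1),
      eval (crlPt d ρ t (fun j => x (j,0)) (fun j => x (j,1))) (pderiv i p) *
      ((∏ k, lin (x (k,0)) (x (k,1)) ^ (ρ k - 1)) * H).coeff i := by
    intro x
    simp only [R, map_sum, map_mul, eval_aeval, eval_Apar]
    refine Finset.sum_congr rfl fun i _ => ?_
    congr 1
    have := gprod_map (hU m) (hV m) (fun k => ρ k - 1) x
    simp only [hU, hV, eval_X] at this
    rw [← Polynomial.coeff_map, Polynomial.map_mul, this, Polynomial.map_map]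
    congr
    conv_rhs => rw [← Polynomial.map_id (p := H)]
    congr 1
    ext z
    simp
  have hRD : R * Disc = 0 := by
    apply mv_eq_zero
    intro x
    rw [map_mul, mul_eq_zero]
    by_cases hD : eval x Disc = 0
    · exact Or.inr hD
    · left
      rw [hR]
      simp only [Disc, map_mul, map_prod, eval_X, map_sub] at hD
      have hD1 := left_ne_zero_of_mul hD
      have hD2 := right_ne_zero_of_mul hD
      rw [Finset.prod_ne_zero_iff] at hD1 hD2
      refine tangent_distinct hρ hρ2 hm p hp t ht _ _ (fun j h => hD1 j (Finset.mem_univ _) (congrArg Prod.fst h)) ?_ H hH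
      intro j k hjk
      have := hD2 j (Finset.mem_univ _)
      rw [Finset.prod_ne_zero_iff] at this
      exact this k (by simp [hjk.symm])
  have hDisc : Disc ≠ 0 := by
    intro h
    have h1 : eval (fun x : Fin m × Fin 2 => if x.2 = 0 then (1:ℂ) else ((x.1 : ℕ) : ℂ)) Disc = 0 := by rw [h]; simp
    revert h1
    simp only [Disc, map_mul, map_prod, eval_X, map_sub]
    apply mul_ne_zero
    · simp
    · rw [Finset.prod_ne_zero_iff]
      intro j _
      rw [Finset.prod_ne_zero_iff]
      intro k hk
      have := Finset.ne_of_mem_erase hk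
      simp only [if_true, one_mul, show (1 : Fin 2) ≠ 0 from one_ne_zero, if_false, sub_ne_zero]
      intro hh
      exact this (Fin.ext (by exact_mod_cast hh))
  have hR0 : R = 0 := (mul_eq_zero.1 hRD).resolve_right hDisc
  have := hR (fun x => if x.2 = 0 then u x.1 else v x.1)
  rw [hR0] at this
  simpa using this.symm

end Dual


section Dual
variable {d m : ℕ} {ρ : Fin m → ℕ}

lemma sum_sub_one (hρ : ∑ j, ρ j = d) (hρ2 : ∀ j, 2 ≤ ρ j) : ∑ j, (ρ j - 1) + m = d := by
  rw [← hρ]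
  have : ∀ j, ρ j = (ρ j - 1) + 1 := fun j => by have := hρ2 j; omega
  conv_rhs => rw [Finset.sum_congr rfl fun j _ => this j, Finset.sum_add_distrib]
  simp

lemma two_mul_le (hρ : ∑ j, ρ j = d) (hρ2 : ∀ j, 2 ≤ ρ j) : 2 * m ≤ d := by
  rw [← hρ]
  calc 2 * m = ∑ j : Fin m, 2 := by simp [mul_comm]
    _ ≤ _ := Finset.sum_le_sum fun j _ => hρ2 j

lemma natDegree_tang (hρ : ∑ j, ρ j = d) (hρ2 : ∀ j, 2 ≤ ρ j) (u v : Fin m → ℂ) (q : Polynomial ℂ)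
    (hq : q.natDegree ≤ m) : ((∏ j, lin (u j) (v j) ^ (ρ j - 1)) * q).natDegree ≤ d := by
  refine Polynomial.natDegree_mul_le.trans ?_
  have h1 := natDegree_prod_lin_le Finset.univ u v (fun j => ρ j - 1)
  have := sum_sub_one hρ hρ2
  omega

/-- conormal set before closure -/
def preDual (d m : ℕ) (ρ : Fin m → ℕ) : Set (Fin (d+1) → ℂ) :=
  {h | h ≠ 0 ∧ ∃ a ∈ crlCone d m ρ, a ≠ 0 ∧ zTangentDim (crlCone d m ρ) a = m + 1 ∧
      ∀ v ∈ zTangentAt (crlCone d m ρ) a, apolarPair d h v = 0}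

lemma preDual_subset (hρ : ∑ j, ρ j = d) (hρ2 : ∀ j, 2 ≤ ρ j) (hm : 1 ≤ m) :
    preDual d m ρ ⊆ GG d m (fun j => ρ j - 1) := by
  rintro h ⟨-, a, ha, ha0, -, hv⟩
  rw [mem_crl_iff hρ] at ha
  obtain ⟨t, u, v, htuv⟩ := ha
  have hne : Polynomial.C t * ∏ j, lin (u j) (v j) ^ ρ j ≠ 0 := by
    rw [← htuv]
    intro h0
    exact ha0 (toPoly_injective d (by rw [h0, toPoly_zero]))
  have ht : t ≠ 0 := by
    rintro rfl
    simp at hne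
  have haa : a = crlPt d ρ t u v := toPoly_injective d (by rw [htuv, toPoly_crlPt hρ])
  refine ⟨u, v, ne_zero_of_prod_lin (fun j => by have := hρ2 j; omega) (right_ne_zero_of_mul hne), ?_⟩
  intro q hq
  have hs := sum_sub_one hρ hρ2
  have hq' : q.natDegree ≤ m := by
    beta_reduce at hq
    omega
  have h1 := hv (fun i => ((∏ j, lin (u j) (v j) ^ (ρ j - 1)) * q).coeff i) (by
    intro p hp
    rw [haa]
    exact tangent_all hρ hρ2 hm p hp t ht u v q hq')
  rwa [apolarPair_eq, toPoly_coeff d _ (natDegree_tang hρ hρ2 u v q hq')] at h1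

def tanSub (S : Set (Fin (d+1) → ℂ)) (a : Fin (d+1) → ℂ) : Submodule ℂ (Fin (d+1) → ℂ) where
  carrier := zTangentAt S a
  add_mem' := by
    intro x y hx hy p hp
    simp only [Pi.add_apply, mul_add, Finset.sum_add_distrib, hx p hp, hy p hp, add_zero]
  zero_mem' := by
    intro p hp
    simp
  smul_mem' := by
    intro c x hx p hp
    have : ∑ i, eval a (pderiv i p) * (c • x) i = c * ∑ i, eval a (pderiv i p) * x i := by
      rw [Finset.mul_sum]
      exact Finset.sum_congr rfl fun i _ => by rw [Pi.smul_apply, smul_eq_mul]; ring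
    rw [this, hx p hp, mul_zero]

/-- multiplication by a fixed polynomial on coefficient vectors -/
def mulCoef (d m : ℕ) (P : Polynomial ℂ) : (Fin (m+1) → ℂ) →ₗ[ℂ] (Fin (d+1) → ℂ) where
  toFun g := fun i => (P * toPoly m g).coeff i
  map_add' x y := by
    funext i
    rw [toPoly_add, mul_add, Polynomial.coeff_add]; rfl
  map_smul' c x := by
    funext i
    rw [toPoly_smul, mul_left_comm, Polynomial.coeff_C_mul]; rfl

lemma tangent_eq (hρ : ∑ j, ρ j = d) (hρ2 : ∀ j, 2 ≤ ρ j) (hm : 1 ≤ m) (t : ℂ) (ht : t ≠ 0) (u v : Fin m → ℂ)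
    (h0 : ∀ j, (u j, v j) ≠ 0) (B : Finset (Fin (d+1))) (hB : B.card ≤ m + 1)
    (hinj : ∀ w ∈ zTangentAt (crlCone d m ρ) (crlPt d ρ t u v), (∀ b ∈ B, w b = 0) → w = 0) :
    zTangentDim (crlCone d m ρ) (crlPt d ρ t u v) = m + 1 ∧
    ∀ w ∈ zTangentAt (crlCone d m ρ) (crlPt d ρ t u v), ∃ q : Polynomial ℂ, q.natDegree ≤ m ∧
      w = fun i : Fin (d+1) => ((∏ j, lin (u j) (v j) ^ (ρ j - 1)) * q).coeff i := by
  set P := ∏ j, lin (u j) (v j) ^ (ρ j - 1) with hP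
  set T := tanSub (crlCone d m ρ) (crlPt d ρ t u v) with hT
  have hP0 : P ≠ 0 := prod_lin_ne_zero h0
  have hLinj : Function.Injective (mulCoef d m P) := by
    rw [← LinearMap.ker_eq_bot, LinearMap.ker_eq_bot']
    intro g hg
    have h1 : P * toPoly m g = 0 := by
      rw [← toPoly_coeff d _ (natDegree_tang hρ hρ2 u v _ (natDegree_toPoly_le m g)), ← toPoly_zero]
      congr 1
    exact toPoly_injective m (by rw [(mul_eq_zero.1 h1).resolve_left hP0, toPoly_zero])
  have hle : LinearMap.range (mulCoef d m P) ≤ T := by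
    rintro _ ⟨g, rfl⟩
    intro p hp
    exact tangent_all hρ hρ2 hm p hp t ht u v _ (natDegree_toPoly_le m g)
  have hfr : Module.finrank ℂ (LinearMap.range (mulCoef d m P)) = m + 1 := by
    rw [LinearMap.finrank_range_of_inj hLinj]; simp
  have hTle : Module.finrank ℂ T ≤ m + 1 := by
    let r : T →ₗ[ℂ] (B → ℂ) := (LinearMap.funLeft ℂ ℂ (fun b : B => (b : Fin (d+1)))) ∘ₗ T.subtype
    have hr : Function.Injective r := by
      rw [← LinearMap.ker_eq_bot, LinearMap.ker_eq_bot']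
      rintro ⟨w, hw⟩ h
      apply Subtype.ext
      refine hinj w hw fun b hb => ?_
      exact congrFun h ⟨b, hb⟩
    have := LinearMap.finrank_le_finrank_of_injective hr
    simp at this
    omega
  have heq : LinearMap.range (mulCoef d m P) = T := Submodule.eq_of_le_of_finrank_le hle (by omega)
  constructor
  · unfold zTangentDim
    have : Submodule.span ℂ (zTangentAt (crlCone d m ρ) (crlPt d ρ t u v)) = T := Submodule.span_eq T
    rw [this, ← heq, hfr]
  · intro w hw
    have : w ∈ T := hw
    rw [← heq] at this
    obtain ⟨g, rfl⟩ := this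
    exact ⟨toPoly m g, natDegree_toPoly_le m g, rfl⟩

def phiPar (d : ℕ) (ρ : Fin m → ℕ) : Fin (d+1) → MvPolynomial (Option (Fin m)) ℂ :=
  fun i => X none * (gprod (fun _ => 1) (fun j => X (some j)) ρ).coeff i

lemma eval_phiPar (z : Option (Fin m) → ℂ) :
    (fun i => eval z (phiPar d ρ i)) = crlPt d ρ (z none) (fun j => 1) (fun j => z (some j)) := by
  funext i
  have := gprod_map (fun _ => 1) (fun j => X (some j)) ρ z
  simp only [map_one, eval_X] at this
  rw [crlPt, ← this, Polynomial.coeff_C_mul, Polynomial.coeff_map]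
  simp [phiPar]

lemma crlPt_normalize (t : ℂ) (u v : Fin m → ℂ) (hu : ∀ j, u j ≠ 0) :
    crlPt d ρ t u v = crlPt d ρ (t * ∏ j, u j ^ ρ j) (fun _ => 1) (fun j => v j / u j) := by
  funext i
  unfold crlPt
  congr 1
  rw [map_mul, mul_assoc, map_prod, ← Finset.prod_mul_distrib]
  congr 1
  refine Finset.prod_congr rfl fun j _ => ?_
  rw [map_pow, ← mul_pow, lin, lin, mul_add, ← mul_assoc, ← map_mul, ← map_mul, mul_div_cancel₀ _ (hu j), mul_one]

lemma vanish_of_phi (hρ : ∑ j, ρ j = d) (p : MvPolynomial (Fin (d+1)) ℂ) (hp : aeval (phiPar d ρ) p = 0) :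
    ∀ y ∈ crlCone d m ρ, eval y p = 0 := by
  intro y hy
  rw [mem_crl_iff hρ] at hy
  obtain ⟨t, u, v, htuv⟩ := hy
  have haa : y = crlPt d ρ t u v := toPoly_injective d (by rw [htuv, toPoly_crlPt hρ])
  have h1 : aeval (Apar d ρ t) p * ∏ j : Fin m, (X (j, 0) : MvPolynomial (Fin m × Fin 2) ℂ) = 0 := by
    apply mv_eq_zero
    intro x
    rw [map_mul, mul_eq_zero, eval_aeval, eval_Apar]
    by_cases hx : eval x (∏ j : Fin m, (X (j, 0) : MvPolynomial (Fin m × Fin 2) ℂ)) = 0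
    · exact Or.inr hx
    · left
      rw [map_prod, Finset.prod_eq_zero_iff] at hx
      rw [crlPt_normalize _ _ _ (fun j h => hx ⟨j, Finset.mem_univ _, by simpa using h⟩)]
      have := eval_phiPar (d := d) (ρ := ρ) (fun o => Option.elim o (t * ∏ j, x (j,0) ^ ρ j) (fun j => x (j,1) / x (j,0)))
      simp only [Option.elim] at this
      rw [← this, ← eval_aeval, hp, map_zero]
  have h2 : aeval (Apar d ρ t) p = 0 := (mul_eq_zero.1 h1).resolve_right
    (Finset.prod_ne_zero_iff.2 fun j _ => X_ne_zero _)
  have h3 := eval_Apar (d := d) (ρ := ρ) t (fun x => if x.2 = 0 then u x.1 else v x.1)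
  simp only [if_true, show (1 : Fin 2) ≠ 0 from one_ne_zero, if_false] at h3
  rw [haa, ← h3, ← eval_aeval, h2, map_zero]

lemma eval_zero_of_smul {n : ℕ} (p : MvPolynomial (Fin n) ℂ) (g : Fin n → ℂ)
    (h : ∀ s : ℂ, s ≠ 0 → eval (s • g) p = 0) : eval 0 p = 0 := by
  have hc : Continuous fun s : ℂ => eval (s • g) p :=
    (MvPolynomial.continuous_eval p).comp (continuous_id.smul continuous_const)
  have h1 : (fun s : ℂ => eval (s • g) p) = fun _ => 0 := by
    refine Continuous.ext_on (dense_compl_singleton (0:ℂ)) hc continuous_const ?_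
    intro s hs
    exact h s hs
  have := congrFun h1 0
  simpa using this

lemma GG_subset (hρ : ∑ j, ρ j = d) (hρ2 : ∀ j, 2 ≤ ρ j) (hm : 1 ≤ m) :
    GG d m (fun j => ρ j - 1) ⊆ zClosure (preDual d m ρ) := by
  classical
  have hs := sum_sub_one hρ hρ2
  have h2m := two_mul_le hρ hρ2
  obtain ⟨D, hD, hDt⟩ := generic_tangent (phiPar d ρ)
  have hz : ∃ z, eval z (aeval (phiPar d ρ) D * X none) ≠ 0 := by
    by_contra hcon
    push Not at hcon
    exact mul_ne_zero hD (X_ne_zero _) (mv_eq_zero _ hcon)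
  obtain ⟨z, hz⟩ := hz
  rw [map_mul, eval_X, eval_aeval, eval_phiPar] at hz
  set t := z none with htdef
  have ht : t ≠ 0 := right_ne_zero_of_mul hz
  have hQ : aeval (Apar d ρ t) D ≠ 0 := by
    intro h
    apply left_ne_zero_of_mul hz
    have h3 := eval_Apar (d := d) (ρ := ρ) t (fun x => if x.2 = 0 then 1 else z (some x.1))
    simp only [if_true, show (1 : Fin 2) ≠ 0 from one_ne_zero, if_false] at h3
    rw [← h3, ← eval_aeval, h, map_zero]
  intro f hf p hp
  rw [GG_eq d m _ (fun j => by have := hρ2 j; omega) (by omega)] at hf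
  refine kerFam_dense _ _ hQ p ?_ f hf
  clear hf f
  intro f hf
  rw [mem_kerFam_MM d _ _ _ (by omega)] at hf
  obtain ⟨x, hx1, hx2, hx3⟩ := hf
  rw [eval_aeval, eval_Apar] at hx2
  simp only [eval_X] at hx1 hx3
  have h0 := ne_zero_of_prod_lin (fun j => by have := hρ2 j; omega) hx1
  obtain ⟨B, hBc, hB⟩ := hDt _ hx2
  simp only [Fintype.card_option, Fintype.card_fin] at hBc
  obtain ⟨hdim, htan⟩ := tangent_eq hρ hρ2 hm t ht _ _ h0 B hBc (by
    intro w hw hwB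
    exact hB w (fun q hq => hw q (vanish_of_phi hρ q hq)) hwB)
  have ha0 : crlPt d ρ t (fun j => x (j,0)) (fun j => x (j,1)) ≠ 0 := by
    intro h
    have h1 := toPoly_crlPt hρ t (fun j => x (j,0)) (fun j => x (j,1))
    rw [h, toPoly_zero] at h1
    exact mul_ne_zero (by simpa using ht) (prod_lin_ne_zero h0) h1.symm
  have key : ∀ g : Fin (d+1) → ℂ, g ≠ 0 → Ann d g (∏ j, lin (x (j,0)) (x (j,1)) ^ (ρ j - 1)) (d - ∑ j, (ρ j - 1)) →
      g ∈ preDual d m ρ := by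
    intro g hg hAnn
    refine ⟨hg, _, crlPt_mem hρ _ _ _, ha0, hdim, ?_⟩
    intro w hw
    obtain ⟨q, hq, rfl⟩ := htan w hw
    rw [apolarPair_eq, toPoly_coeff d _ (natDegree_tang hρ hρ2 _ _ q hq)]
    exact hAnn q (by omega)
  by_cases hf0 : f = 0
  · rw [hf0]
    obtain ⟨g, hg, hg0⟩ : ∃ g ∈ LinearMap.ker (Matrix.mulVecLin (evM (MM d (hU m) (hV m) (fun j => ρ j - 1)) x)), g ≠ 0 := by
      apply Submodule.exists_mem_ne_zero_of_ne_bot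
      apply LinearMap.ker_ne_bot_of_finrank_lt
      simp
      omega
    rw [LinearMap.mem_ker, Matrix.mulVecLin_apply, evM_mulVec] at hg
    simp only [eval_X] at hg
    refine eval_zero_of_smul p g fun s hs0 => hp _ (key _ (smul_ne_zero hs0 hg0) ?_)
    intro q hq
    rw [apL_smul, hg q hq]; simp
  · exact hp _ (key f hf0 hx3)

lemma dual_eq (hρ : ∑ j, ρ j = d) (hρ2 : ∀ j, 2 ≤ ρ j) (hm : 1 ≤ m) :
    dualConeOf d (crlCone d m ρ) (m+1) = zClosure (GG d m (fun j => ρ j - 1)) := by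
  apply Set.Subset.antisymm
  · exact zClosure_min' ((preDual_subset hρ hρ2 hm).trans (subset_zClosure' _)) (zClosed_zClosure' _)
  · exact zClosure_min' (GG_subset hρ hρ2 hm) (zClosed_zClosure' _)

end Dual


section Topo
variable {σ : Type} [Fintype σ] [DecidableEq σ]

lemma eval_eq_of_agree (c : MvPolynomial σ ℂ) (j : σ) (hj : j ∉ c.vars) (x y : σ → ℂ)
    (h : ∀ i, i ≠ j → x i = y i) : eval x c = eval y c := by
  apply eval₂Hom_congr' rfl _ rfl
  intro i hi _
  exact h i (by rintro rfl; exact hj hi)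

lemma line_lemma (C : Set (σ → ℝ)) (hC : IsClosed C) (f : σ → ℝ) (δ : ℝ) (X : Set (σ → ℂ)) (hX : Thin X)
    (hT : ∀ y ∈ C \ interior C, y ∈ Metric.ball f δ → (fun i => ((y i : ℝ) : ℂ)) ∈ X) (j : σ)
    (p r : σ → ℝ) (hp : p ∈ interior C) (hpB : p ∈ Metric.ball f δ) (hr : r ∉ C) (hrB : r ∈ Metric.ball f δ)
    (hpr : ∀ i, i ≠ j → p i = r i) : False := by
  obtain ⟨c, hc, hcj, hcX⟩ := hX j
  have h1 : interior C ∩ Metric.ball f δ ∈ nhds p := (isOpen_interior.inter Metric.isOpen_ball).mem_nhds ⟨hp, hpB⟩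
  have h2 : Cᶜ ∩ Metric.ball f δ ∈ nhds r := (hC.isOpen_compl.inter Metric.isOpen_ball).mem_nhds ⟨hr, hrB⟩
  obtain ⟨e1, he1, hb1⟩ := Metric.mem_nhds_iff.1 h1
  obtain ⟨e2, he2, hb2⟩ := Metric.mem_nhds_iff.1 h2
  obtain ⟨b, hb, hbc⟩ := exists_real_ne_zero c hc p (min e1 e2) (lt_min he1 he2)
  have hbU := hb1 (Metric.ball_subset_ball (min_le_left _ _) hb)
  have hr' : Function.update b j (r j) ∈ Metric.ball r e2 := by
    have hb' := Metric.ball_subset_ball (min_le_right e1 e2) hb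
    rw [Metric.mem_ball, dist_pi_lt_iff he2] at hb' ⊢
    intro i
    by_cases hi : i = j
    · subst hi; simpa using he2
    · rw [Function.update_of_ne hi, ← hpr i hi]; exact hb' i
  have hrV := hb2 hr'
  set r' := Function.update b j (r j) with hr'def
  have hseg : IsPreconnected (segment ℝ b r') := (convex_segment b r').isPreconnected
  have hsegB : segment ℝ b r' ⊆ Metric.ball f δ := (convex_ball f δ).segment_subset hbU.2 hrV.2
  have hsub : segment ℝ b r' ⊆ interior C ∪ Cᶜ := by
    intro y hy
    by_contra hcon
    rw [Set.mem_union, not_or, Set.mem_compl_iff, not_not] at hcon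
    have hyX := hT y ⟨hcon.2, hcon.1⟩ (hsegB hy)
    apply hbc
    rw [← hcX _ hyX]
    apply eval_eq_of_agree c j hcj
    intro i hi
    obtain ⟨s, t, hs, ht, hst, rfl⟩ := hy
    have : r' i = b i := by rw [hr'def, Function.update_of_ne hi]
    simp only [Pi.add_apply, Pi.smul_apply, smul_eq_mul, this]
    rw [← add_mul, hst, one_mul]
  have := hseg (interior C) Cᶜ isOpen_interior hC.isOpen_compl hsub ⟨b, left_mem_segment ℝ b r', hbU.1⟩
    ⟨r', right_mem_segment ℝ b r', hrV.1⟩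
  obtain ⟨y, -, hy1, hy2⟩ := this
  exact hy2 (interior_subset hy1)

lemma no_thin_boundary (C : Set (σ → ℝ)) (hC : IsClosed C) (f : σ → ℝ) (δ : ℝ) (hδ : 0 < δ) (X : Set (σ → ℂ)) (hX : Thin X)
    (hT : ∀ y ∈ C \ interior C, y ∈ Metric.ball f δ → (fun i => ((y i : ℝ) : ℂ)) ∈ X)
    (p q : σ → ℝ) (hp : p ∈ interior C) (hpB : p ∈ Metric.ball f δ) (hq : q ∉ C) (hqB : q ∈ Metric.ball f δ) : False := by
  have key : ∀ s : Finset σ, ∀ p, p ∈ interior C → p ∈ Metric.ball f δ → (∀ i, i ∉ s → p i = q i) → False := by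
    intro s
    induction s using Finset.induction_on with
    | empty =>
      intro p hp _ h
      have : p = q := funext fun i => h i (by simp)
      rw [this] at hp
      exact hq (interior_subset hp)
    | insert j s hj ih =>
      intro p hp hpB h
      set r := Function.update p j (q j) with hr
      have hrB : r ∈ Metric.ball f δ := by
        rw [Metric.mem_ball, dist_pi_lt_iff hδ] at hpB hqB ⊢
        intro i
        by_cases hi : i = j
        · subst hi; simpa [hr] using hqB i
        · rw [hr, Function.update_of_ne hi]; exact hpB i
      by_cases hrU : r ∈ interior C
      · refine ih r hrU hrB ?_
        intro i hi
        by_cases hij : i = j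
        · subst hij; simp [hr]
        · rw [hr, Function.update_of_ne hij]
          exact h i (by simp [hij, hi])
      · -- a point outside `C` close to `r`
        have h1 : interior C ∩ Metric.ball f δ ∈ nhds p := (isOpen_interior.inter Metric.isOpen_ball).mem_nhds ⟨hp, hpB⟩
        obtain ⟨e1, he1, hb1⟩ := Metric.mem_nhds_iff.1 h1
        have h2 : Metric.ball r e1 ∩ Metric.ball f δ ∈ nhds r :=
          (Metric.isOpen_ball.inter Metric.isOpen_ball).mem_nhds ⟨Metric.mem_ball_self he1, hrB⟩
        have h3 : ¬ (Metric.ball r e1 ∩ Metric.ball f δ ⊆ C) := fun hsub =>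
          hrU (mem_interior_iff_mem_nhds.2 (Filter.mem_of_superset h2 hsub))
        obtain ⟨r', hr'1, hr'2⟩ := Set.not_subset.1 h3
        have hp' : Function.update r' j (p j) ∈ Metric.ball p e1 := by
          have hb' := hr'1.1
          rw [Metric.mem_ball, dist_pi_lt_iff he1] at hb' ⊢
          intro i
          by_cases hi : i = j
          · subst hi; simpa using he1
          · have := hb' i
            rw [hr, Function.update_of_ne hi] at this
            rwa [Function.update_of_ne hi]
        have hp'' := hb1 hp'
        exact line_lemma C hC f δ X hX hT j _ r' hp''.1 hp''.2 hr'2 hr'1.2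
          (fun i hi => Function.update_of_ne hi _ _)
  exact key Finset.univ p hp hpB (by simp)

end Topo


lemma Eset_succ (d s : ℕ) : Eset d s ⊆ Eset d (s+1) := by
  rintro a ⟨α, u, v, rfl⟩
  refine ⟨Fin.snoc α 0, Fin.snoc u 0, Fin.snoc v 0, ?_⟩
  rw [Fin.sum_univ_castSucc]
  simp

lemma Eset_mono (d : ℕ) : Monotone (Eset d) := monotone_nat_of_le_succ (Eset_succ d)

lemma waringRank_eq (d : ℕ) (a : Fin (d+1) → ℝ) : waringRank d (binForm d a) = sInf {r | a ∈ Eset d r} := by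
  unfold waringRank
  congr 1
  ext r
  simp only [Set.mem_setOf_eq, Eset]
  simp only [binForm_eq_sum_iff]

lemma realRankSet_eq (d r : ℕ) (hr : 1 ≤ r) : realRankSet d r = Eset d r \ Eset d (r-1) := by
  ext a
  simp only [realRankSet, Set.mem_setOf_eq, waringRank_eq, Set.mem_diff]
  constructor
  · intro h
    have hne : {r | a ∈ Eset d r}.Nonempty := by
      by_contra hcon
      rw [Set.not_nonempty_iff_eq_empty] at hcon
      rw [hcon, Nat.sInf_empty] at h
      omega
    refine ⟨?_, ?_⟩
    · have := Nat.sInf_mem hne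
      rwa [h] at this
    · have := Nat.notMem_of_lt_sInf (s := {r | a ∈ Eset d r}) (m := r-1) (by omega)
      exact this
  · rintro ⟨h1, h2⟩
    apply le_antisymm
    · exact Nat.sInf_le h1
    · by_contra hlt
      push Not at hlt
      have := Nat.sInf_mem (s := {r | a ∈ Eset d r}) ⟨r, h1⟩
      exact h2 (Eset_mono d (by omega) this)

lemma topBoundary_pt (d r : ℕ) (hr : 1 ≤ r) (f : Fin (d+1) → ℝ) (hf : f ∈ topBoundary d r) :
    ∃ s, s ≤ r ∧ f ∈ closure (Eset d s) ∧ f ∉ interior (Eset d s) := by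
  obtain ⟨h1, h2⟩ := hf
  have hsub : Rdr d r ⊆ Eset d r \ Eset d (r-1) := by
    rw [← realRankSet_eq d r hr]; exact interior_subset
  by_cases hInt : f ∈ interior (Eset d r)
  · refine ⟨r - 1, by omega, ?_, ?_⟩
    · by_contra hcl
      apply h2
      have hn : interior (Eset d r) ∩ (closure (Eset d (r-1)))ᶜ ∈ nhds f :=
        (isOpen_interior.inter isClosed_closure.isOpen_compl).mem_nhds ⟨hInt, hcl⟩
      have h3 : interior (Eset d r) ∩ (closure (Eset d (r-1)))ᶜ ⊆ Rdr d r := by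
        unfold Rdr
        apply interior_maximal _ (isOpen_interior.inter isClosed_closure.isOpen_compl)
        rw [realRankSet_eq d r hr]
        rintro x ⟨hx1, hx2⟩
        exact ⟨interior_subset hx1, fun h => hx2 (subset_closure h)⟩
      exact mem_interior_iff_mem_nhds.2 (Filter.mem_of_superset hn (h3.trans subset_closure))
    · intro hin
      obtain ⟨x, hx1, hx2⟩ := mem_closure_iff.1 h1 _ isOpen_interior hin
      exact (hsub hx2).2 (interior_subset hx1)
  · exact ⟨r, le_rfl, closure_mono (hsub.trans Set.diff_subset) h1, hInt⟩

lemma topBoundary_GG (d r : ℕ) (hr : 1 ≤ r) (hrd : r ≤ d) (f : Fin (d+1) → ℝ) (hf : f ∈ topBoundary d r) :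
    ∃ (N : ℕ) (μ : Fin N → ℕ), (∀ j, 1 ≤ μ j) ∧ (fun i => (f i : ℂ)) ∈ GG d N μ ∧ N + ∑ j, μ j ≤ d ∧
      (N + ∑ j, μ j = d → d - r ≤ N) := by
  obtain ⟨s, hs, h1, h2⟩ := topBoundary_pt d r hr f hf
  obtain ⟨N, μ, a1, a2, a3, a4⟩ := boundary_pt_complex d s (by omega) f h1 h2
  exact ⟨N, μ, a1, a2, a3, fun h => by have := a4 h; omega⟩

lemma exists_prime_vanishing {σ : Type} [Fintype σ] [DecidableEq σ] (S : Set (σ → ℂ)) (hS : zIrreducible S) (c : MvPolynomial σ ℂ)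
    (hc : c ≠ 0) (hv : ∀ x ∈ S, eval x c = 0) : ∃ F, Prime F ∧ ∀ x ∈ S, eval x F = 0 := by
  revert hc hv
  induction c using UniqueFactorizationMonoid.induction_on_prime with
  | h₁ => intro h; exact absurd rfl h
  | h₂ x hx =>
    intro _ hv
    obtain ⟨y, hy⟩ := hS.1
    have := (hx.map (eval y)).ne_zero
    exact absurd (hv y hy) this
  | h₃ a p ha hp ih =>
    intro _ hv
    rcases hS.2 p a (fun x hx => by have := hv x hx; rwa [map_mul, mul_eq_zero] at this) with h | h
    · exact ⟨p, hp, h⟩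
    · exact ih ha h

/-- finite index set of pairs (N, μ) -/
abbrev Idx (d : ℕ) := (N : Fin (d+1)) × (Fin N → Fin (d+1))

def Idx.G {d : ℕ} (ι : Idx d) : Set (Fin (d+1) → ℂ) := GG d ι.1 (fun j => (ι.2 j : ℕ))

def Idx.tot {d : ℕ} (ι : Idx d) : ℕ := (ι.1 : ℕ) + ∑ j, (ι.2 j : ℕ)

def Idx.pos {d : ℕ} (ι : Idx d) : Prop := ∀ j, 1 ≤ (ι.2 j : ℕ)

def Idx.good {d : ℕ} (r : ℕ) (ι : Idx d) : Prop := ι.pos ∧ ι.tot = d ∧ d - r ≤ ι.1 ∧ zClosure ι.G ⊆ algBoundary d r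

lemma topBoundary_Idx (d r : ℕ) (hr : 1 ≤ r) (hrd : r ≤ d) (f : Fin (d+1) → ℝ) (hf : f ∈ topBoundary d r) :
    ∃ ι : Idx d, ι.pos ∧ (fun i => (f i : ℂ)) ∈ ι.G ∧ ι.tot ≤ d ∧ (ι.tot = d → d - r ≤ ι.1) := by
  obtain ⟨N, μ, a1, a2, a3, a4⟩ := topBoundary_GG d r hr hrd f hf
  have hμ : ∀ j, μ j < d + 1 := by
    intro j
    have := Finset.single_le_sum (f := μ) (fun _ _ => Nat.zero_le _) (Finset.mem_univ j)
    omega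
  exact ⟨⟨⟨N, by omega⟩, fun j => ⟨μ j, hμ j⟩⟩, a1, a2, a3, a4⟩

lemma thin_of_not_good (d r : ℕ) (ι : Idx d) (h1 : ι.pos) (h2 : ι.tot ≤ d) (h3 : ι.tot = d → d - r ≤ ι.1)
    (h4 : ¬ ι.good r) : ∃ X : Set (Fin (d+1) → ℂ), Thin X ∧
      ∀ f ∈ topBoundary d r, (fun i => (f i : ℂ)) ∈ ι.G → (fun i => (f i : ℂ)) ∈ X := by
  rcases h2.lt_or_eq with hlt | heq
  · exact ⟨ι.G, GG_thin d _ _ hlt, fun f _ h => h⟩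
  · have hns : ¬ zClosure ι.G ⊆ algBoundary d r := fun h => h4 ⟨h1, heq, h3 heq, h⟩
    obtain ⟨x, hx1, hx2⟩ := Set.not_subset.1 hns
    have : ∃ g : MvPolynomial (Fin (d+1)) ℂ, (∀ y ∈ (fun (a : Fin (d+1) → ℝ) i => ((a i : ℝ) : ℂ)) '' topBoundary d r, eval y g = 0) ∧
        eval x g ≠ 0 := by
      by_contra hcon
      push Not at hcon
      exact hx2 hcon
    obtain ⟨g, hg1, hg2⟩ := this
    have htot : (ι.1 : ℕ) + ∑ j, (ι.2 j : ℕ) ≤ d := h2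
    obtain ⟨c, hc, hcv⟩ := GG_hyper d ι.1 (fun j => (ι.2 j : ℕ)) h2
    obtain ⟨F, hF, hFv⟩ := exists_prime_vanishing ι.G (GG_irreducible d _ _ h1 (by omega)) c hc hcv
    have hFg : ¬ F ∣ g := by
      rintro ⟨q, rfl⟩
      apply hg2
      rw [map_mul, hx1 F hFv, zero_mul]
    exact ⟨_, thin_inter F g hF hFg, fun f hf hfG => ⟨hFv _ hfG, hg1 _ ⟨f, hf, rfl⟩⟩⟩

lemma topBoundary_good (d r : ℕ) (hr : 1 ≤ r) (hrd : r ≤ d) (f : Fin (d+1) → ℝ) (hf : f ∈ topBoundary d r) :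
    ∃ ι : Idx d, ι.good r ∧ (fun i => (f i : ℂ)) ∈ zClosure ι.G := by
  classical
  by_contra hcon
  push Not at hcon
  obtain ⟨p, hp1, hp2⟩ := exists_sep (Finset.univ.filter fun ι : Idx d => ι.good r) (fun ι => zClosure ι.G)
    (fun ι _ => zClosed_zClosure' _) (fun i => (f i : ℂ)) (fun ι hι => hcon ι (Finset.mem_filter.1 hι).2)
  have hcont : Continuous fun y : Fin (d+1) → ℝ => eval (fun i => ((y i : ℝ) : ℂ)) p :=
    (MvPolynomial.continuous_eval p).comp (continuous_pi fun i => Complex.continuous_ofReal.comp (continuous_apply i))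
  have hopen : IsOpen {y : Fin (d+1) → ℝ | eval (fun i => ((y i : ℝ) : ℂ)) p ≠ 0} :=
    isOpen_ne_fun hcont continuous_const
  obtain ⟨δ, hδ, hball⟩ := Metric.isOpen_iff.1 hopen f hp2
  have hX : ∀ ι : Idx d, ∃ X : Set (Fin (d+1) → ℂ), Thin X ∧ (ι.pos → ι.tot ≤ d → (ι.tot = d → d - r ≤ ι.1) → ¬ ι.good r →
      ∀ f ∈ topBoundary d r, (fun i => (f i : ℂ)) ∈ ι.G → (fun i => (f i : ℂ)) ∈ X) := by
    intro ι
    by_cases h : ι.pos ∧ ι.tot ≤ d ∧ (ι.tot = d → d - r ≤ ι.1) ∧ ¬ ι.good r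
    · obtain ⟨X, hX1, hX2⟩ := thin_of_not_good d r ι h.1 h.2.1 h.2.2.1 h.2.2.2
      exact ⟨X, hX1, fun _ _ _ _ => hX2⟩
    · refine ⟨∅, ?_, fun a b c e => absurd ⟨a, b, c, e⟩ h⟩
      intro j
      exact ⟨1, one_ne_zero, by simp, by simp⟩
  choose X hXt hX using hX
  have hXX : Thin (⋃ ι ∈ (Finset.univ : Finset (Idx d)), X ι) := Thin.biUnion _ _ fun ι _ => hXt ι
  have hT : ∀ y ∈ closure (Rdr d r) \ interior (closure (Rdr d r)), y ∈ Metric.ball f δ →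
      (fun i => ((y i : ℝ) : ℂ)) ∈ ⋃ ι ∈ (Finset.univ : Finset (Idx d)), X ι := by
    intro y hy hyB
    obtain ⟨ι, a1, a2, a3, a4⟩ := topBoundary_Idx d r hr hrd y hy
    have hng : ¬ ι.good r := by
      intro hg
      exact hball hyB (hp1 ι (by simp [hg]) _ (subset_zClosure' _ a2))
    simp only [Set.mem_iUnion]
    exact ⟨ι, Finset.mem_univ _, hX ι a1 a3 a4 hng y hy a2⟩
  have hf' := hf
  obtain ⟨hf1, hf2⟩ := hf'
  obtain ⟨P, hPB, hPR⟩ := mem_closure_iff.1 hf1 _ Metric.isOpen_ball (Metric.mem_ball_self hδ)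
  have hPi : P ∈ interior (closure (Rdr d r)) :=
    interior_maximal subset_closure isOpen_interior hPR
  have hnb : ¬ (Metric.ball f δ ⊆ closure (Rdr d r)) := fun h =>
    hf2 (mem_interior_iff_mem_nhds.2 (Filter.mem_of_superset (Metric.ball_mem_nhds f hδ) h))
  obtain ⟨q, hqB, hq⟩ := Set.not_subset.1 hnb
  exact no_thin_boundary (closure (Rdr d r)) isClosed_closure f δ hδ _ hXX hT P q hPi hPB hq hqB

lemma main_aux (d r : ℕ) (hr : 1 ≤ r) (hrd : r < d) (Y : Set (Fin (d+1) → ℂ))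
    (hYsub : Y ⊆ algBoundary d r) (hYirr : zIrreducible Y) 
    (hYmax : ∀ Z, Z ⊆ algBoundary d r → zIrreducible Z → zClosed Z → Y ⊆ Z → Z = Y) :
    ∃ (m : ℕ) (ρ : Fin m → ℕ), isPartitionOf d m ρ ∧ (∀ t, 2 ≤ ρ t) ∧ d - r ≤ m ∧ 2 * m ≤ d ∧
      Y = dualConeOf d (crlCone d m ρ) (m + 1) := by
  classical
  have hcov : algBoundary d r ⊆ ⋃ ι ∈ (Finset.univ.filter fun ι : Idx d => ι.good r), zClosure ι.G := by
    intro x hx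
    by_contra hcon
    simp only [Set.mem_iUnion, not_exists] at hcon
    obtain ⟨p, hp1, hp2⟩ := exists_sep (Finset.univ.filter fun ι : Idx d => ι.good r) (fun ι => zClosure ι.G)
      (fun ι _ => zClosed_zClosure' _) x (fun ι hι => hcon ι hι)
    apply hp2
    apply hx p
    rintro _ ⟨f, hf, rfl⟩
    obtain ⟨ι, hg, hι⟩ := topBoundary_good d r hr hrd.le f hf
    exact hp1 ι (by simp [hg]) _ hι
  obtain ⟨ι, hι, hYι⟩ := zIrreducible_subset_of_union _ _ (fun ι _ => zClosed_zClosure' _) Y hYirr (hYsub.trans hcov)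
  obtain ⟨h1, h2, h3, h4⟩ := (Finset.mem_filter.1 hι).2
  have htot : (ι.1 : ℕ) + ∑ j, (ι.2 j : ℕ) = d := h2
  have hY := hYmax _ h4 (zIrreducible_zClosure' (GG_irreducible d _ _ h1 (by omega))) (zClosed_zClosure' _) hYι
  have hsum : ∑ j, ((ι.2 j : ℕ) + 1) = d := by
    rw [Finset.sum_add_distrib]; simp; omega
  have h2' : ∀ j, 2 ≤ (ι.2 j : ℕ) + 1 := fun j => by have := h1 j; omega
  refine ⟨ι.1, fun j => (ι.2 j : ℕ) + 1, ⟨fun j => Nat.le_add_left 1 _, hsum⟩, h2', h3, two_mul_le hsum h2', ?_⟩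
  have hN : 1 ≤ (ι.1 : ℕ) := by omega
  rw [dual_eq hsum h2' hN, ← hY]
  simp [Idx.G]

/-- for odd `d = 2k−1` and `1 ≤ i ≤ k−2`, every irreducible component `Y` of
the algebraic boundary `∂_alg(R_{d,k+i})` (i.e. every maximal irreducible Zariski-closed
subset of it) is the dual variety `(Δ_ρ)^∨` of a coincident root locus for some partition
`ρ` of `d` with all parts `≥ 2` and length between `k−1−i` and `k−1`. -/
theorem odd_boundary_components (k i : ℕ) (hi1 : 1 ≤ i) (hi2 : i + 2 ≤ k)
    (Y : Set (Fin (2*k - 1 + 1) → ℂ))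
    (hYsub : Y ⊆ algBoundary (2*k - 1) (k + i))
    (hYirr : zIrreducible Y) (hYcl : zClosed Y)
    (hYmax : ∀ Z, Z ⊆ algBoundary (2*k - 1) (k + i) →
      zIrreducible Z → zClosed Z → Y ⊆ Z → Z = Y) :
    ∃ (m : ℕ) (ρ : Fin m → ℕ), isPartitionOf (2*k - 1) m ρ ∧ (∀ t, 2 ≤ ρ t) ∧
      k - 1 - i ≤ m ∧ m ≤ k - 1 ∧
      Y = dualConeOf (2*k - 1) (crlCone (2*k - 1) m ρ) (m + 1) := by
  obtain ⟨m, ρ, h1, h2, h3, h4, h5⟩ := main_aux (2*k - 1) (k + i) (by omega) (by omega) Y hYsub hYirr hYmax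
  exact ⟨m, ρ, h1, h2, by omega, by omega, h5⟩
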